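/- arXiv:1704.03592 — 2 statements merged into one kernel-verified Lean document; each statement's English description precedes it below -/
import Mathlib

section
/- R(K_9, C_6) = 41. That is: (i) for every coloring of the edges of the complete graph on 41 vertices with 2 colors, either color 1 contains a subgraph isomorphic to the complete graph K_9 or color 2 contains a subgraph isomorphic to the cycle C_6; and (ii) there exists a 2-coloring of the edges of the complete graph on 40 vertices with neither a K_9 in color 1 nor a C_6 in color 2. -/
/-- The coloring `c` of the edges of the complete graph on `Fin n` with `k` colors contains a
copy of `G` all of whose edges have color `i`. -/
def HasMonoCopy {V : Type} {n k : ℕ} (G : SimpleGraph V)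
    (c : Sym2 (Fin n) → Fin k) (i : Fin k) : Prop :=
  ∃ f : V → Fin n, Function.Injective f ∧ ∀ u v : V, G.Adj u v → c s(f u, f v) = i

namespace RamseyC6

variable {V : Type}

/-- `G` has no (not necessarily induced) cycle on six vertices. -/
def NoC6 (G : SimpleGraph V) : Prop :=
  ∀ a b c d e f : V, G.Adj a b → G.Adj b c → G.Adj c d → G.Adj d e → G.Adj e f → G.Adj f a →
    a ≠ c → a ≠ d → a ≠ e → b ≠ d → b ≠ e → b ≠ f → c ≠ e → c ≠ f → d ≠ f → False

/-- `U` contains `k` pairwise non-adjacent vertices of `G`. -/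
def HasInd (G : SimpleGraph V) (U : Set V) (k : ℕ) : Prop :=
  ∃ s : Finset V, ↑s ⊆ U ∧ G.IsIndepSet ↑s ∧ k ≤ s.card

/-- `A` and `B` are disjoint and no edge of `G` joins them. -/
def Sep (G : SimpleGraph V) (A B : Set V) : Prop :=
  ∀ x ∈ A, ∀ y ∈ B, x ≠ y ∧ ¬ G.Adj x y

/-- Every vertex of `G` has at least `k` neighbours. -/
def MinDeg (G : SimpleGraph V) (k : ℕ) : Prop :=
  ∀ (v : V) (s : Finset V), s.card < k → ∃ u, u ∉ s ∧ G.Adj v u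

def NoK4 (G : SimpleGraph V) : Prop :=
  ∀ a b c d : V, G.Adj a b → G.Adj a c → G.Adj a d → G.Adj b c → G.Adj b d → G.Adj c d → False

def NoK5 (G : SimpleGraph V) : Prop :=
  ∀ a b c d e : V, G.Adj a b → G.Adj a c → G.Adj a d → G.Adj a e → G.Adj b c → G.Adj b d →
    G.Adj b e → G.Adj c d → G.Adj c e → G.Adj d e → False

section Basic

variable {G : SimpleGraph V} {A B C : Set V} {j k : ℕ}

lemma Sep.symm (h : Sep G A B) : Sep G B A := fun x hx y hy =>
  ⟨(h y hy x hx).1.symm, fun e => (h y hy x hx).2 e.symm⟩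

lemma Sep.union_left (h₁ : Sep G A C) (h₂ : Sep G B C) : Sep G (A ∪ B) C := by
  rintro x (hx | hx) y hy
  · exact h₁ x hx y hy
  · exact h₂ x hx y hy

lemma HasInd.le (h : HasInd G A k) (hj : j ≤ k) : HasInd G A j := by
  obtain ⟨s, h1, h2, h3⟩ := h
  exact ⟨s, h1, h2, hj.trans h3⟩

lemma HasInd.mono (h : HasInd G A k) (hAB : A ⊆ B) : HasInd G B k := by
  obtain ⟨s, h1, h2, h3⟩ := h
  exact ⟨s, h1.trans hAB, h2, h3⟩

lemma HasInd.zero : HasInd G A 0 := ⟨∅, by simp, by simp [SimpleGraph.IsIndepSet], by simp⟩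

lemma HasInd.one {x : V} (hx : x ∈ A) : HasInd G A 1 :=
  ⟨{x}, by simpa using hx, by simp [SimpleGraph.IsIndepSet], by simp⟩

lemma HasInd.two {x y : V} (hx : x ∈ A) (hy : y ∈ A) (hne : x ≠ y) (h : ¬ G.Adj x y) :
    HasInd G A 2 := by
  classical
  refine ⟨{x, y}, by simp [Set.insert_subset_iff, hx, hy], ?_, by simp [hne]⟩
  intro a ha b hb hab
  simp only [Finset.coe_insert, Finset.coe_singleton, Set.mem_insert_iff,
    Set.mem_singleton_iff] at ha hb
  rcases ha with rfl | rfl <;> rcases hb with rfl | rfl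
  · exact absurd rfl hab
  · exact h
  · exact fun e => h e.symm
  · exact absurd rfl hab

lemma HasInd.union (hA : HasInd G A j) (hB : HasInd G B k) (h : Sep G A B) :
    HasInd G (A ∪ B) (j + k) := by
  classical
  obtain ⟨s, s1, s2, s3⟩ := hA
  obtain ⟨t, t1, t2, t3⟩ := hB
  refine ⟨s ∪ t, ?_, ?_, ?_⟩
  · rw [Finset.coe_union]
    exact Set.union_subset_union s1 t1
  · intro a ha b hb hab
    simp only [Finset.coe_union, Set.mem_union] at ha hb
    rcases ha with ha | ha <;> rcases hb with hb | hb
    · exact s2 ha hb hab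
    · exact (h a (s1 ha) b (t1 hb)).2
    · exact fun e => (h b (s1 hb) a (t1 ha)).2 e.symm
    · exact t2 ha hb hab
  · rw [Finset.card_union_of_disjoint]
    · omega
    · rw [Finset.disjoint_left]
      intro a ha hb
      exact (h a (s1 ha) a (t1 hb)).1 rfl

lemma HasInd.union' {m : ℕ} (hA : HasInd G A j) (hB : HasInd G B k) (h : Sep G A B)
    (hm : m ≤ j + k) : HasInd G (A ∪ B) m := (hA.union hB h).le hm

lemma MinDeg.le (h : MinDeg G k) (hj : j ≤ k) : MinDeg G j :=
  fun v s hs => h v s (hs.trans_le hj)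

lemma MinDeg.avoid_four (h : MinDeg G 5) (v a b c d : V) :
    ∃ u, G.Adj v u ∧ u ≠ a ∧ u ≠ b ∧ u ≠ c ∧ u ≠ d := by
  classical
  obtain ⟨u, hu, hv⟩ := h v {a, b, c, d} (by
    have := Finset.card_le_four (a := a) (b := b) (c := c) (d := d); omega)
  exact ⟨u, hv, by simpa using hu⟩

lemma MinDeg.avoid_five (h : MinDeg G 6) (v a b c d e : V) :
    ∃ u, G.Adj v u ∧ u ≠ a ∧ u ≠ b ∧ u ≠ c ∧ u ≠ d ∧ u ≠ e := by
  classical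
  obtain ⟨u, hu, hv⟩ := h v {a, b, c, d, e} (by
    have := Finset.card_le_five (a := a) (b := b) (c := c) (d := d) (e := e); omega)
  exact ⟨u, hv, by simpa using hu⟩

end Basic

section Core

variable (G : SimpleGraph V) (W : Set V)

/-- Neighbours of `z` outside `W`. -/
def ext (z : V) : Set V := {y | y ∉ W ∧ G.Adj z y}

/-- Vertices outside `W` that can be reached from `z` in at most two steps outside `W`. -/
def ball (z : V) : Set V := {w | w ∉ W ∧ (G.Adj z w ∨ ∃ y ∈ ext G W z, G.Adj y w)}

/-- Vertices outside `W` at distance exactly two from `z` along paths outside `W`. -/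
def sphere (z : V) : Set V := {w | w ∉ W ∧ ¬ G.Adj z w ∧ ∃ y ∈ ext G W z, G.Adj y w}

/-- `z` and `z'` have no common neighbour outside `W`, and their neighbourhoods outside `W` are
not joined by an edge. -/
def Apart₁ (z z' : V) : Prop :=
  ∀ y ∈ ext G W z, ∀ y' ∈ ext G W z', y ≠ y' ∧ ¬ G.Adj y y'

def Apart₂ (z z' : V) : Prop :=
  ∀ y ∈ ext G W z, ∀ y' ∈ ext G W z', ∀ w, w ∉ W → G.Adj y w → G.Adj w y' → False

def Apart₃ (z z' : V) : Prop :=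
  ∀ y ∈ ext G W z, ∀ y' ∈ ext G W z', ∀ w w', w ∉ W → w' ∉ W →
    G.Adj y w → G.Adj w w' → G.Adj w' y' → False

variable {G W} {z z' : V}

lemma ext_subset_ball : ext G W z ⊆ ball G W z := fun _ hy => ⟨hy.1, Or.inl hy.2⟩

lemma sphere_subset_ball : sphere G W z ⊆ ball G W z := fun _ hy => ⟨hy.1, Or.inr hy.2.2⟩

lemma apart₁_of_path (h6 : NoC6 G) (hz : z ∈ W) (hz' : z' ∈ W) (hne : z ≠ z')
    (hd : ∀ y ∈ ext G W z, y ∉ ext G W z') {a b : V} (ha : a ∈ W) (hb : b ∈ W)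
    (h1 : G.Adj z a) (h2 : G.Adj a b) (h3 : G.Adj b z') (h4 : a ≠ z') (h5 : b ≠ z) :
    Apart₁ G W z z' := by
  rintro y ⟨hy, hzy⟩ y' ⟨hy', hzy'⟩
  refine ⟨?_, fun e => ?_⟩
  · rintro rfl
    exact hd y ⟨hy, hzy⟩ ⟨hy', hzy'⟩
  · exact h6 z y y' z' b a hzy e hzy'.symm h3.symm h2.symm h1.symm
      (by grind) (by grind) (by grind) (by grind) (by grind) (by grind) (by grind) (by grind)
      (by grind)

lemma ext_disjoint_of_path (h6 : NoC6 G) (hne : z ≠ z') {a b c : V}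
    (ha : a ∈ W) (hb : b ∈ W) (hc : c ∈ W)
    (h1 : G.Adj z a) (h2 : G.Adj a b) (h3 : G.Adj b c) (h4 : G.Adj c z')
    (d1 : z ≠ b) (d2 : z ≠ c) (d3 : a ≠ c) (d4 : a ≠ z') (d5 : b ≠ z') :
    ∀ y ∈ ext G W z, y ∉ ext G W z' := by
  rintro y ⟨hy, hzy⟩ ⟨hy', hzy'⟩
  exact h6 y z a b c z' hzy.symm h1 h2 h3 h4 hzy'
    (by grind) (by grind) (by grind) (by grind) (by grind) (by grind) (by grind) (by grind)
    (by grind)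

lemma apart₂_of_path (h6 : NoC6 G) (hz : z ∈ W) (hz' : z' ∈ W) (hne : z ≠ z')
    (hd : Apart₁ G W z z') {a : V} (ha : a ∈ W) (h1 : G.Adj z a) (h2 : G.Adj a z') :
    Apart₂ G W z z' := by
  rintro y hy y' hy' w hw e1 e2
  have := (hd y hy y' hy').1
  obtain ⟨hy, hzy⟩ := hy
  obtain ⟨hy', hzy'⟩ := hy'
  exact h6 z y w y' z' a hzy e1 e2 hzy'.symm h2.symm h1.symm
    (by grind) (by grind) (by grind) (by grind) (by grind) (by grind) (by grind) (by grind)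
    (by grind)

lemma apart₃_of_adj (h6 : NoC6 G) (hz : z ∈ W) (hz' : z' ∈ W)
    (hd : Apart₁ G W z z') (h : G.Adj z z') : Apart₃ G W z z' := by
  rintro y hy y' hy' w w' hw hw' e1 e2 e3
  have hne := hd y hy y' hy'
  obtain ⟨hy, hzy⟩ := hy
  obtain ⟨hy', hzy'⟩ := hy'
  exact h6 z y w w' y' z' hzy e1 e2 e3 hzy'.symm h.symm
    (by grind) (by grind) (by grind) (by grind) (by grind) (by grind) (by grind) (by grind)
    (by grind)

lemma Apart₁.symm (h : Apart₁ G W z z') : Apart₁ G W z' z := fun y hy y' hy' =>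
  ⟨(h y' hy' y hy).1.symm, fun e => (h y' hy' y hy).2 e.symm⟩

lemma Apart₁.sep_ext (h : Apart₁ G W z z') : Sep G (ext G W z) (ext G W z') := h

lemma Apart₁.sep_singleton (h : Apart₁ G W z z') (hz : z ∈ W) :
    Sep G {z} (ball G W z') := by
  rintro x rfl y ⟨hy, hy'⟩
  refine ⟨by grind, fun e => ?_⟩
  rcases hy' with h1 | ⟨u, hu, huy⟩
  · exact (h y ⟨hy, e⟩ y ⟨hy, h1⟩).1 rfl
  · exact (h y ⟨hy, e⟩ u hu).2 huy.symm

lemma sep_ext_ball (h1 : Apart₁ G W z z') (h2 : Apart₂ G W z z') :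
    Sep G (ext G W z) (ball G W z') := by
  rintro x hx y ⟨hy, hy' | ⟨u, hu, huy⟩⟩
  · exact h1 x hx y ⟨hy, hy'⟩
  · refine ⟨?_, fun e => h2 x hx u hu y hy e huy.symm⟩
    rintro rfl
    exact (h1 x hx u hu).2 huy.symm

lemma sep_ball (h1 : Apart₁ G W z z') (h2 : Apart₂ G W z z') (h3 : Apart₃ G W z z') :
    Sep G (ball G W z) (ball G W z') := by
  rintro x ⟨hx, hx' | ⟨u, hu, hux⟩⟩ y hy
  · exact sep_ext_ball h1 h2 x ⟨hx, hx'⟩ y hy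
  · obtain ⟨hy, hy' | ⟨t, ht, hty⟩⟩ := hy
    · refine ⟨?_, fun e => h2 u hu y ⟨hy, hy'⟩ x hx hux e⟩
      rintro rfl
      exact (h1 u hu x ⟨hy, hy'⟩).2 hux
    · refine ⟨?_, fun e => h3 u hu t ht x y hx hy hux e hty.symm⟩
      rintro rfl
      exact h2 u hu t ht x hx hux hty.symm

/-- If every outside neighbour of `z` has no further neighbour in `W`, the minimum degree is at
least five and there is no `K₅`, then the ball around `z` contains two non-adjacent vertices. -/
lemma hasInd_ball (h5 : NoK5 G) (hδ : MinDeg G 5) {x : V} (hx : x ∈ ext G W z)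
    (hW : ∀ y ∈ ext G W z, ∀ u ∈ W, G.Adj y u → u = z) : HasInd G (ball G W z) 2 := by
  by_contra hcon
  have hcl : ∀ u ∈ ball G W z, ∀ w ∈ ball G W z, u ≠ w → G.Adj u w := by
    intro u hu w hw hne
    by_contra hn
    exact hcon (HasInd.two hu hw hne hn)
  have hb : ∀ u, G.Adj x u → u ≠ z → u ∈ ball G W z := fun u hu hne =>
    ⟨fun huW => hne (hW x hx u huW hu), Or.inr ⟨x, hx, hu⟩⟩
  obtain ⟨a, ha, ha1, -⟩ := hδ.avoid_four x z z z z
  obtain ⟨b, hb', hb1, hb2, -⟩ := hδ.avoid_four x z a a a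
  obtain ⟨c, hc, hc1, hc2, hc3, -⟩ := hδ.avoid_four x z a b b
  obtain ⟨d, hd, hd1, hd2, hd3, hd4⟩ := hδ.avoid_four x z a b c
  have ma := hb a ha ha1
  have mb := hb b hb' hb1
  have mc := hb c hc hc1
  have md := hb d hd hd1
  exact h5 x a b c d ha hb' hc hd (hcl _ ma _ mb hb2.symm) (hcl _ ma _ mc hc2.symm)
    (hcl _ ma _ md hd2.symm) (hcl _ mb _ mc hc3.symm) (hcl _ mb _ md hd3.symm)
    (hcl _ mc _ md hd4.symm)

end Core

section Sphere

variable {G : SimpleGraph V} {W : Set V} {z : V}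

/-- The set `N` contains no path on five vertices. -/
def NoP5 (G : SimpleGraph V) (N : Set V) : Prop :=
  ∀ a ∈ N, ∀ b ∈ N, ∀ c ∈ N, ∀ d ∈ N, ∀ e ∈ N, G.Adj a b → G.Adj b c → G.Adj c d → G.Adj d e →
    a ≠ c → a ≠ d → a ≠ e → b ≠ d → b ≠ e → c ≠ e → False

lemma noP5_of_forall_adj (h6 : NoC6 G) {N : Set V} (hN : ∀ y ∈ N, G.Adj z y) : NoP5 G N := by
  intro a ha b hb c hc d hd e he h1 h2 h3 h4 n1 n2 n3 n4 n5 n6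
  exact h6 z a b c d e (hN a ha) h1 h2 h3 h4 (hN e he).symm (hN b hb).ne (hN c hc).ne (hN d hd).ne
    n1 n2 n3 n4 n5 n6

lemma not_noP5_of_degrees {N : Set V} (hP : NoP5 G N)
    (h4 : ∀ a ∈ N, ∀ b ∈ N, ∀ c ∈ N, ∀ d ∈ N, G.Adj a b → G.Adj a c → G.Adj a d → G.Adj b c →
      G.Adj b d → G.Adj c d → False)
    (y₀ : V) (h2 : ∀ y ∈ N, ∀ a, ∃ u ∈ N, G.Adj y u ∧ u ≠ a)
    (h3 : ∀ y ∈ N, y ≠ y₀ → ∀ a b, ∃ u ∈ N, G.Adj y u ∧ u ≠ a ∧ u ≠ b)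
    {y : V} (hy : y ∈ N) (hy₀ : y ≠ y₀) : False := by
  have key : ∀ u₁ ∈ N, ∀ u₂ ∈ N, G.Adj y u₁ → G.Adj y u₂ → u₁ ≠ u₂ → u₂ ≠ y₀ →
      G.Adj u₁ u₂ := by
    intro u₁ hu₁ u₂ hu₂ e₁ e₂ hne hne₀
    by_contra hn
    obtain ⟨w, hw, hw1, hw2⟩ := h2 u₁ hu₁ y
    obtain ⟨w', hw', hw1', hw2', hw3'⟩ := h3 u₂ hu₂ hne₀ y w
    refine hP w hw u₁ hu₁ y hy u₂ hu₂ w' hw' hw1.symm e₁.symm e₂ hw1' hw2 ?_ hw3'.symm hne ?_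
      hw2'.symm
    · rintro rfl
      exact hn hw1
    · rintro rfl
      exact hn hw1'.symm
  have key' : ∀ u₁ ∈ N, ∀ u₂ ∈ N, G.Adj y u₁ → G.Adj y u₂ → u₁ ≠ u₂ → G.Adj u₁ u₂ := by
    intro u₁ hu₁ u₂ hu₂ e₁ e₂ hne
    by_cases h : u₂ = y₀
    · exact (key u₂ hu₂ u₁ hu₁ e₂ e₁ hne.symm (fun h' => hne (h'.trans h.symm))).symm
    · exact key u₁ hu₁ u₂ hu₂ e₁ e₂ hne h
  obtain ⟨a, ha, a1, -⟩ := h2 y hy y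
  obtain ⟨b, hb, b1, b2, -⟩ := h3 y hy hy₀ a a
  obtain ⟨c, hc, c1, c2, c3⟩ := h3 y hy hy₀ a b
  exact h4 y hy a ha b hb c hc a1 b1 c1 (key' a ha b hb a1 b1 b2.symm)
    (key' a ha c hc a1 c1 c2.symm) (key' b hb c hc b1 c1 c3.symm)

lemma not_isClique_sphere (h6 : NoC6 G) (h5 : NoK5 G) (hδ : MinDeg G 5) (hz : z ∈ W)
    {x x' : V} (hx : x ∈ ext G W z) (hx' : x' ∈ ext G W z) (hne : x ≠ x')
    (hW : ∀ y ∈ ext G W z, ∀ u ∈ W, G.Adj y u → u = z)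
    (hcl : ∀ u ∈ sphere G W z, ∀ w ∈ sphere G W z, u ≠ w → G.Adj u w) : False := by
  have hnb : ∀ y ∈ ext G W z, ∀ u, G.Adj y u → u ≠ z → u ∉ sphere G W z → u ∈ ext G W z := by
    intro y hy u hyu huz hus
    have huW : u ∉ W := fun h => huz (hW y hy u h hyu)
    by_contra h
    exact hus ⟨huW, fun e => h ⟨huW, e⟩, y, hy, hyu⟩
  have hK4 : ∀ a ∈ ext G W z, ∀ b ∈ ext G W z, ∀ c ∈ ext G W z, ∀ d ∈ ext G W z, G.Adj a b →
      G.Adj a c → G.Adj a d → G.Adj b c → G.Adj b d → G.Adj c d → False :=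
    fun a ha b hb c hc d hd => h5 z a b c d ha.2 hb.2 hc.2 hd.2
  have hP : NoP5 G (ext G W z) := noP5_of_forall_adj h6 fun y hy => hy.2
  by_cases h3 : ∃ m₁ ∈ sphere G W z, ∃ m₂ ∈ sphere G W z, ∃ m₃ ∈ sphere G W z,
      m₁ ≠ m₂ ∧ m₁ ≠ m₃ ∧ m₂ ≠ m₃
  · obtain ⟨m₁, hm₁, m₂, hm₂, m₃, hm₃, n12, n13, n23⟩ := h3
    have hsdr : ∀ y ∈ ext G W z, ∀ y' ∈ ext G W z, ∀ m ∈ sphere G W z, ∀ m' ∈ sphere G W z,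
        G.Adj y m → G.Adj y' m' → m ≠ m' → y = y' := by
      intro y hy y' hy' m hm m' hm' e e' hmm
      by_contra hyy
      obtain ⟨t, ht, ht1, ht2⟩ : ∃ t ∈ sphere G W z, t ≠ m ∧ t ≠ m' := by grind
      exact h6 z y m t m' y' hy.2 e (hcl m hm t ht ht1.symm) (hcl t ht m' hm' ht2) e'.symm hy'.2.symm
        (by rintro rfl; exact hm.1 hz) (by rintro rfl; exact ht.1 hz)
        (by rintro rfl; exact hm'.1 hz) (by rintro rfl; exact ht.2.1 hy.2)
        (by rintro rfl; exact hm'.2.1 hy.2) hyy hmm (by rintro rfl; exact hm.2.1 hy'.2)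
        (by rintro rfl; exact ht.2.1 hy'.2)
    obtain ⟨y₁, hy₁, e₁⟩ := hm₁.2.2
    obtain ⟨y₂, hy₂, e₂⟩ := hm₂.2.2
    have h12 : y₁ = y₂ := hsdr y₁ hy₁ y₂ hy₂ m₁ hm₁ m₂ hm₂ e₁ e₂ n12
    have honly : ∀ y ∈ ext G W z, ∀ m ∈ sphere G W z, G.Adj y m → y = y₁ := by
      intro y hy m hm e
      by_cases h : m = m₁
      · subst h
        exact (hsdr y hy y₂ hy₂ m hm m₂ hm₂ e e₂ n12).trans h12.symm
      · exact hsdr y hy y₁ hy₁ m hm m₁ hm₁ e e₁ h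
    have hbig : ∀ y ∈ ext G W z \ {y₁}, ∀ a b, ∃ u ∈ ext G W z \ {y₁},
        G.Adj y u ∧ u ≠ a ∧ u ≠ b := by
      rintro y ⟨hy, hyy⟩ a b
      obtain ⟨u, hu, u1, u2, u3, u4⟩ := hδ.avoid_four y z y₁ a b
      exact ⟨u, ⟨hnb y hy u hu u1 fun h => hyy (honly y hy u h hu), u2⟩, hu, u3, u4⟩
    obtain ⟨y, hy, hyy⟩ : ∃ y ∈ ext G W z, y ≠ y₁ := by
      by_cases h : x = y₁
      · exact ⟨x', hx', fun h' => hne (h.trans h'.symm)⟩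
      · exact ⟨x, hx, h⟩
    refine not_noP5_of_degrees (N := ext G W z \ {y₁})
      (noP5_of_forall_adj h6 fun y hy => hy.1.2)
      (fun a ha b hb c hc d hd => hK4 a ha.1 b hb.1 c hc.1 d hd.1) y₁
      (fun y hy a => ?_) (fun y hy _ => hbig y hy) ⟨hy, hyy⟩ hyy
    obtain ⟨u, hu, u1, u2, -⟩ := hbig y hy a a
    exact ⟨u, hu, u1, u2⟩
  · by_cases h2 : ∃ m ∈ sphere G W z, ∃ m' ∈ sphere G W z, m ≠ m'
    · obtain ⟨m, hm, m', hm', hmm⟩ := h2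
      have hS : ∀ u, u ≠ m → u ≠ m' → u ∉ sphere G W z := by grind
      have htwo : ∀ y ∈ ext G W z, ∀ a, ∃ u ∈ ext G W z, G.Adj y u ∧ u ≠ a := by
        intro y hy a
        obtain ⟨u, hu, u1, u2, u3, u4⟩ := hδ.avoid_four y z m m' a
        exact ⟨u, hnb y hy u hu u1 (hS u u2 u3), hu, u4⟩
      have huniq : ∀ y ∈ ext G W z, ∀ y' ∈ ext G W z, G.Adj y m → G.Adj y' m' → y = y' := by
        intro y hy y' hy' e e'
        by_contra hyy
        obtain ⟨w, hw, w1, w2⟩ := htwo y' hy' y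
        exact h6 z y m m' y' w hy.2 e (hcl m hm m' hm' hmm) e'.symm w1 hw.2.symm
          (by rintro rfl; exact hm.1 hz) (by rintro rfl; exact hm'.1 hz) hy'.2.ne
          (by rintro rfl; exact hm'.2.1 hy.2) hyy w2.symm (by rintro rfl; exact hm.2.1 hy'.2)
          (by rintro rfl; exact hm.2.1 hw.2) (by rintro rfl; exact hm'.2.1 hw.2)
      obtain ⟨y₀, hy₀⟩ : ∃ y₀, ∀ y ∈ ext G W z, G.Adj y m → G.Adj y m' → y = y₀ := by
        by_cases h : ∃ y₀ ∈ ext G W z, G.Adj y₀ m ∧ G.Adj y₀ m'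
        · obtain ⟨y₀, h0, h1, h2⟩ := h
          exact ⟨y₀, fun y hy e _ => huniq y hy y₀ h0 e h2⟩
        · exact ⟨m, fun y hy e e' => (h ⟨y, hy, e, e'⟩).elim⟩
      obtain ⟨y, hy, hyy⟩ : ∃ y ∈ ext G W z, y ≠ y₀ := by
        by_cases h : x = y₀
        · exact ⟨x', hx', fun h' => hne (h.trans h'.symm)⟩
        · exact ⟨x, hx, h⟩
      refine not_noP5_of_degrees hP hK4 y₀ htwo (fun y hy hyy a b => ?_) hy hyy
      by_cases hym : G.Adj y m
      · have hym' : ¬ G.Adj y m' := fun h => hyy (hy₀ y hy hym h)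
        obtain ⟨u, hu, u1, u2, u3, u4⟩ := hδ.avoid_four y z m a b
        exact ⟨u, hnb y hy u hu u1 (hS u u2 fun h => hym' (h ▸ hu)), hu, u3, u4⟩
      · obtain ⟨u, hu, u1, u2, u3, u4⟩ := hδ.avoid_four y z m' a b
        exact ⟨u, hnb y hy u hu u1 (hS u (fun h => hym (h ▸ hu)) u2), hu, u3, u4⟩
    · obtain ⟨m, hm⟩ : ∃ m, ∀ u, u ≠ m → u ∉ sphere G W z := by
        by_cases h : ∃ m, m ∈ sphere G W z
        · obtain ⟨m, hm⟩ := h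
          exact ⟨m, fun u hu hus => h2 ⟨u, hus, m, hm, hu⟩⟩
        · exact ⟨z, fun u _ hus => h ⟨u, hus⟩⟩
      have hbig : ∀ y ∈ ext G W z, ∀ a b, ∃ u ∈ ext G W z, G.Adj y u ∧ u ≠ a ∧ u ≠ b := by
        intro y hy a b
        obtain ⟨u, hu, u1, u2, u3, u4⟩ := hδ.avoid_four y z m a b
        exact ⟨u, hnb y hy u hu u1 (hm u u2), hu, u3, u4⟩
      refine not_noP5_of_degrees hP hK4 z (fun y hy a => ?_) (fun y hy _ => hbig y hy) hx hx.2.ne'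
      obtain ⟨u, hu, u1, u2, -⟩ := hbig y hy a a
      exact ⟨u, hu, u1, u2⟩

lemma hasInd_insert_sphere (h6 : NoC6 G) (h5 : NoK5 G) (hδ : MinDeg G 5) (hz : z ∈ W)
    {x x' : V} (hx : x ∈ ext G W z) (hx' : x' ∈ ext G W z) (hne : x ≠ x')
    (hW : ∀ y ∈ ext G W z, ∀ u ∈ W, G.Adj y u → u = z) :
    HasInd G ({z} ∪ ball G W z) 3 := by
  have h2 : HasInd G (sphere G W z) 2 := by
    by_contra hcon
    refine not_isClique_sphere h6 h5 hδ hz hx hx' hne hW fun u hu w hw huw => ?_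
    by_contra hn
    exact hcon (HasInd.two hu hw huw hn)
  have hsep : Sep G {z} (sphere G W z) := by
    rintro y rfl w hw
    exact ⟨by rintro rfl; exact hw.1 hz, hw.2.1⟩
  exact ((HasInd.one (Set.mem_singleton z)).union h2 hsep).mono
    (Set.union_subset_union_right _ sphere_subset_ball)

end Sphere

section Cliques

variable {G : SimpleGraph V} {W : Set V} {z : V}

lemma HasInd.biUnion {ι : Type} {B : ι → Set V} {k : ℕ} (s : Finset ι)
    (hB : ∀ i ∈ s, HasInd G (B i) k) (hs : ∀ i ∈ s, ∀ j ∈ s, i ≠ j → Sep G (B i) (B j)) :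
    HasInd G (⋃ i ∈ s, B i) (s.card * k) := by
  classical
  induction s using Finset.induction_on with
  | empty => simpa using HasInd.zero
  | insert i s hi ih =>
    have h := ih (fun j hj => hB j (Finset.mem_insert_of_mem hj)) fun j hj l hl =>
      hs j (Finset.mem_insert_of_mem hj) l (Finset.mem_insert_of_mem hl)
    rw [Finset.set_biUnion_insert, Finset.card_insert_of_notMem hi]
    refine (hB i (Finset.mem_insert_self _ _)).union' h ?_ (by ring_nf; omega)
    intro x hx y hy
    simp only [Set.mem_iUnion] at hy
    obtain ⟨j, hj, hy⟩ := hy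
    exact hs i (Finset.mem_insert_self _ _) j (Finset.mem_insert_of_mem hj)
      (by rintro rfl; exact hi hj) x hx y hy

lemma eq_of_adj_ext (h : ∀ u ∈ W, u ≠ z → Apart₁ G W z u) :
    ∀ y ∈ ext G W z, ∀ u ∈ W, G.Adj y u → u = z := by
  intro y hy u hu e
  by_contra hne
  exact (h u hu hne y hy y ⟨hy.1, e.symm⟩).1 rfl

lemma apart_of_clique {n : ℕ} {q : Fin n → V} (h6 : NoC6 G)
    (hq : ∀ i j, i ≠ j → G.Adj (q i) (q j)) {i j k l : Fin n} (hij : i ≠ j) (hik : i ≠ k)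
    (hil : i ≠ l) (hjk : j ≠ k) (hjl : j ≠ l) (hkl : k ≠ l)
    (hd : ∀ y ∈ ext G (Set.range q) (q i), y ∉ ext G (Set.range q) (q j)) :
    Apart₁ G (Set.range q) (q i) (q j) ∧ Apart₂ G (Set.range q) (q i) (q j) ∧
      Apart₃ G (Set.range q) (q i) (q j) := by
  have h1 : Apart₁ G (Set.range q) (q i) (q j) :=
    apart₁_of_path h6 ⟨i, rfl⟩ ⟨j, rfl⟩ (hq i j hij).ne hd ⟨k, rfl⟩ ⟨l, rfl⟩ (hq i k hik)
      (hq k l hkl) (hq l j hjl.symm) (hq k j hjk.symm).ne (hq l i hil.symm).ne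
  exact ⟨h1, apart₂_of_path h6 ⟨i, rfl⟩ ⟨j, rfl⟩ (hq i j hij).ne h1 ⟨k, rfl⟩ (hq i k hik)
    (hq k j hjk.symm), apart₃_of_adj h6 ⟨i, rfl⟩ ⟨j, rfl⟩ h1 (hq i j hij)⟩

set_option synthInstance.maxSize 1000 in
set_option synthInstance.maxHeartbeats 200000 in
lemma apart_of_K5 {q : Fin 5 → V} (h6 : NoC6 G) (hq : ∀ i j, i ≠ j → G.Adj (q i) (q j))
    {i j : Fin 5} (hij : i ≠ j) :
    Apart₁ G (Set.range q) (q i) (q j) ∧ Apart₂ G (Set.range q) (q i) (q j) ∧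
      Apart₃ G (Set.range q) (q i) (q j) := by
  have hex : ∀ i j : Fin 5, i ≠ j → ∃ k l m : Fin 5, i ≠ k ∧ i ≠ l ∧ i ≠ m ∧ j ≠ k ∧ j ≠ l ∧
      j ≠ m ∧ k ≠ l ∧ k ≠ m ∧ l ≠ m := by
    decide
  obtain ⟨k, l, m, hik, hil, him, hjk, hjl, hjm, hkl, hkm, hlm⟩ := hex i j hij
  refine apart_of_clique h6 hq hij hik hil hjk hjl hkl ?_
  exact ext_disjoint_of_path h6 (hq i j hij).ne ⟨k, rfl⟩ ⟨l, rfl⟩ ⟨m, rfl⟩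
    (hq i k hik) (hq k l hkl) (hq l m hlm) (hq m j hjm.symm) (hq i l hil).ne (hq i m him).ne
    (hq k m hkm).ne (hq k j hjk.symm).ne (hq l j hjl.symm).ne

lemma exists_mem_ext {n : ℕ} {q : Fin n → V} (hδ : MinDeg G n) (i : Fin n) :
    ∃ y, y ∈ ext G (Set.range q) (q i) := by
  classical
  obtain ⟨u, hu, e⟩ := hδ (q i) ((Finset.univ.erase i).image q) (by
    refine Finset.card_image_le.trans_lt ?_
    have := i.pos
    rw [Finset.card_erase_of_mem (Finset.mem_univ _), Finset.card_fin]
    omega)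
  refine ⟨u, ?_, e⟩
  rintro ⟨j, rfl⟩
  refine hu (Finset.mem_image_of_mem _ (Finset.mem_erase.2 ⟨?_, Finset.mem_univ _⟩))
  rintro rfl
  exact G.loopless.irrefl _ e

theorem hasInd_of_K5 {q : Fin 5 → V} (h6 : NoC6 G) (hδ : MinDeg G 5)
    (hq : ∀ i j, i ≠ j → G.Adj (q i) (q j)) : HasInd G Set.univ 9 := by
  classical
  have hap := fun {i j : Fin 5} (hij : i ≠ j) => apart_of_K5 h6 hq hij
  have hsep : ∀ i j : Fin 5, i ≠ j →
      Sep G (ball G (Set.range q) (q i)) (ball G (Set.range q) (q j)) :=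
    fun i j hij => sep_ball (hap hij).1 (hap hij).2.1 (hap hij).2.2
  choose x hx using fun i => exists_mem_ext (q := q) hδ i
  by_cases hall : ∀ i, HasInd G (ball G (Set.range q) (q i)) 2
  · exact ((HasInd.biUnion Finset.univ (fun i _ => hall i) fun i _ j _ => hsep i j).mono
      (Set.subset_univ _)).le (by simp)
  push Not at hall
  obtain ⟨i, hi⟩ := hall
  have hcl : ∀ u ∈ ball G (Set.range q) (q i), ∀ w ∈ ball G (Set.range q) (q i), u ≠ w →
      G.Adj u w := by
    intro u hu w hw hne
    by_contra hn
    exact hi (HasInd.two hu hw hne hn)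
  have hW : ∀ y ∈ ext G (Set.range q) (q i), ∀ u ∈ Set.range q, G.Adj y u → u = q i := by
    refine eq_of_adj_ext ?_
    rintro _ ⟨j, rfl⟩ hj
    exact (hap (by rintro rfl; exact hj rfl)).1
  have hb : ∀ u, G.Adj (x i) u → u ≠ q i → u ∈ ball G (Set.range q) (q i) := fun u hu hne =>
    ⟨fun huW => hne (hW _ (hx i) u huW hu), Or.inr ⟨x i, hx i, hu⟩⟩
  obtain ⟨a, ha, ha1, -⟩ := hδ.avoid_four (x i) (q i) (q i) (q i) (q i)
  obtain ⟨b, hb', hb1, hb2, -⟩ := hδ.avoid_four (x i) (q i) a a a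
  obtain ⟨c, hc, hc1, hc2, hc3, -⟩ := hδ.avoid_four (x i) (q i) a b b
  obtain ⟨d, hd, hd1, hd2, hd3, hd4⟩ := hδ.avoid_four (x i) (q i) a b c
  have mx : x i ∈ ball G (Set.range q) (q i) := ext_subset_ball (hx i)
  have ma := hb a ha ha1
  have mb := hb b hb' hb1
  have mc := hb c hc hc1
  have md := hb d hd hd1
  obtain ⟨r, hr0, hrball, hrinj⟩ : ∃ r : Fin 5 → V, r 0 = x i ∧
      (∀ j, r j ∈ ball G (Set.range q) (q i)) ∧ ∀ j k, j ≠ k → r j ≠ r k := by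
    refine ⟨![x i, a, b, c, d], rfl, ?_, ?_⟩
    · intro j
      fin_cases j <;> assumption
    · have := ha.ne
      have := hb'.ne
      have := hc.ne
      have := hd.ne
      intro j k
      fin_cases j <;> fin_cases k <;> simp <;> grind
  have hr : ∀ j k, j ≠ k → G.Adj (r j) (r k) := fun j k hjk =>
    hcl _ (hrball j) _ (hrball k) (hrinj j k hjk)
  have hap' := fun {j k : Fin 5} (hjk : j ≠ k) => apart_of_K5 h6 hr hjk
  have hqi : q i ∈ ext G (Set.range r) (r 0) := by
    refine ⟨?_, by rw [hr0]; exact (hx i).2.symm⟩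
    rintro ⟨j, hj⟩
    exact (hj ▸ hrball j).1 ⟨i, rfl⟩
  choose y hy using fun i => exists_mem_ext (q := r) hδ i
  set e : Fin 5 → V := fun j => if j = 0 then q i else y j with he
  have heext : ∀ j, e j ∈ ext G (Set.range r) (r j) := by
    intro j
    by_cases hj : j = 0
    · subst hj
      simpa [he] using hqi
    · simpa [he, hj] using hy j
  have he0 : e 0 = q i := by simp [he]
  have hE : HasInd G (⋃ j ∈ (Finset.univ : Finset (Fin 5)), {e j}) (5 * 1) :=
    HasInd.biUnion Finset.univ (fun j _ => HasInd.one (Set.mem_singleton _)) (by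
      rintro j - k - hjk _ rfl _ rfl
      exact (hap' hjk).1 _ (heext j) _ (heext k))
  have hF : HasInd G (⋃ k ∈ (Finset.univ.erase i : Finset (Fin 5)), {x k})
      ((Finset.univ.erase i).card * 1) :=
    HasInd.biUnion _ (fun j _ => HasInd.one (Set.mem_singleton _)) (by
      rintro j - k - hjk _ rfl _ rfl
      exact (hap hjk).1 _ (hx j) _ (hx k))
  refine ((hE.union hF ?_).mono (Set.subset_univ _)).le (by simp)
  intro s hs t ht
  simp only [Set.mem_iUnion, Set.mem_singleton_iff, Finset.mem_univ, exists_const,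
    Finset.mem_erase, and_true] at hs ht
  obtain ⟨j, rfl⟩ := hs
  obtain ⟨k, hk, rfl⟩ := ht
  have mk : x k ∈ ball G (Set.range q) (q k) := ext_subset_ball (hx k)
  by_cases hj : j = 0
  · subst hj
    rw [he0]
    exact (hap (Ne.symm hk)).1.sep_singleton ⟨i, rfl⟩ _ rfl _ mk
  have hrx := hsep i k (Ne.symm hk) _ (hrball j) _ mk
  have hadj : G.Adj (r j) (e j) := (heext j).2
  refine ⟨fun h => hrx.2 (h ▸ hadj), fun h => ?_⟩
  have hxr : G.Adj (x i) (r j) := hr0 ▸ hr 0 j (Ne.symm hj)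
  refine h6 (q i) (x i) (r j) (e j) (x k) (q k) (hx i).2 hxr hadj h (hx k).2.symm
    (hq k i hk) ?_ ?_ ?_ ?_ ?_ ?_ hrx.1 ?_ ?_
  · intro h
    exact (h ▸ (hrball j).1) ⟨i, rfl⟩
  · rw [← he0]
    exact ((hap' (Ne.symm hj)).1 _ (heext 0) _ (heext j)).1
  · intro h
    exact (hx k).1 (h ▸ ⟨i, rfl⟩)
  · intro h
    exact (heext j).1 ⟨0, hr0.trans h⟩
  · exact ((hap (Ne.symm hk)).1 _ (hx i) _ (hx k)).1
  · intro h
    exact (hx i).1 (h ▸ ⟨k, rfl⟩)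
  · intro h
    exact (hrball j).1 (h ▸ ⟨k, rfl⟩)
  · intro h
    exact ((hap hk).1.sep_singleton ⟨k, rfl⟩ _ rfl _ (hrball j)).2 (h ▸ hadj.symm)

end Cliques

section FourClique

variable {G : SimpleGraph V} {W : Set V}

/-- All three separation properties between the neighbourhoods of `z` and `z'`. -/
def Apart (G : SimpleGraph V) (W : Set V) (z z' : V) : Prop :=
  Apart₁ G W z z' ∧ Apart₂ G W z z' ∧ Apart₃ G W z z'

lemma Apart.sep_ball {z z' : V} (h : Apart G W z z') : Sep G (ball G W z) (ball G W z') :=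
  RamseyC6.sep_ball h.1 h.2.1 h.2.2

lemma Apart.of_disjoint {z z' a b c : V} (h6 : NoC6 G) (hz : z ∈ W) (hz' : z' ∈ W)
    (h : G.Adj z z') (hd : ∀ y ∈ ext G W z, y ∉ ext G W z') (ha : a ∈ W) (hb : b ∈ W)
    (hc : c ∈ W) (h1 : G.Adj z a) (h2 : G.Adj a b) (h3 : G.Adj b z') (h4 : a ≠ z') (h5 : b ≠ z)
    (h7 : G.Adj z c) (h8 : G.Adj c z') : Apart G W z z' := by
  have h1 := apart₁_of_path h6 hz hz' h.ne hd ha hb h1 h2 h3 h4 h5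
  exact ⟨h1, apart₂_of_path h6 hz hz' h.ne h1 hc h7 h8, apart₃_of_adj h6 hz hz' h1 h⟩

lemma hasInd_of_K5_minus_edge (h6 : NoC6 G) (h5 : NoK5 G) (hδ : MinDeg G 5) {a b c p q : V}
    (hab : G.Adj a b) (hac : G.Adj a c) (hbc : G.Adj b c) (hap : G.Adj a p) (hbp : G.Adj b p)
    (hcp : G.Adj c p) (haq : G.Adj a q) (hbq : G.Adj b q) (hcq : G.Adj c q) (hpq : p ≠ q) :
    HasInd G Set.univ 9 := by
  obtain ⟨W, hW⟩ : ∃ W : Set V, ∀ u, u ∈ W ↔ u = a ∨ u = b ∨ u = c ∨ u = p ∨ u = q :=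
    ⟨{u | u = a ∨ u = b ∨ u = c ∨ u = p ∨ u = q}, fun _ => Iff.rfl⟩
  have ma : a ∈ W := by simp [hW]
  have mb : b ∈ W := by simp [hW]
  have mc : c ∈ W := by simp [hW]
  have mp : p ∈ W := by simp [hW]
  have mq : q ∈ W := by simp [hW]
  have hT : ∀ a ∈ W, ∀ b ∈ W, ∀ c ∈ W, G.Adj a b → G.Adj a c → G.Adj b c → G.Adj a p →
      G.Adj b p → G.Adj c p → G.Adj a q → G.Adj b q → G.Adj c q → Apart G W a b := by
    intro a ma b mb c mc hab hac hbc hap hbp hcp haq hbq hcq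
    exact Apart.of_disjoint h6 ma mb hab (ext_disjoint_of_path h6 hab.ne mp mc mq hap
      hcp.symm hcq hbq.symm hac.ne haq.ne hpq hbp.ne' hbc.ne') mp mc mp hap hcp.symm hbc.symm
      hbp.ne' hac.ne' hap hbp.symm
  have hP : ∀ a ∈ W, ∀ b ∈ W, ∀ c ∈ W, ∀ p ∈ W, ∀ q ∈ W, G.Adj a b → G.Adj a c → G.Adj b c →
      G.Adj a p → G.Adj b p → G.Adj c p → G.Adj a q → G.Adj b q → G.Adj c q → p ≠ q →
      Apart G W a p := by
    intro a ma b mb c mc p mp q mq hab hac hbc hap hbp hcp haq hbq hcq hpq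
    exact Apart.of_disjoint h6 ma mp hap (ext_disjoint_of_path h6 hap.ne mq mb mc haq
      hbq.symm hbc hcp hab.ne hac.ne hcq.ne' hpq.symm hbp.ne) mb mc mb hab hbc hcp hbp.ne
      hac.ne' hab hbp
  have Aab := hT a ma b mb c mc hab hac hbc hap hbp hcp haq hbq hcq
  have Aac := hT a ma c mc b mb hac hab hbc.symm hap hcp hbp haq hcq hbq
  have Abc := hT b mb c mc a ma hbc hab.symm hac.symm hbp hcp hap hbq hcq haq
  have Aap := hP a ma b mb c mc p mp q mq hab hac hbc hap hbp hcp haq hbq hcq hpq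
  have Abp := hP b mb a ma c mc p mp q mq hab.symm hbc hac hbp hap hcp hbq haq hcq hpq
  have Acp := hP c mc a ma b mb p mp q mq hac.symm hbc.symm hab hcp hap hbp hcq haq hbq hpq
  have Aaq := hP a ma b mb c mc q mq p mp hab hac hbc haq hbq hcq hap hbp hcp hpq.symm
  have Abq := hP b mb a ma c mc q mq p mp hab.symm hbc hac hbq haq hcq hbp hap hcp hpq.symm
  have Acq := hP c mc a ma b mb q mq p mp hac.symm hbc.symm hab hcq haq hbq hcp hap hbp hpq.symm
  have Apq : Apart₁ G W p q := apart₁_of_path h6 mp mq hpq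
    (ext_disjoint_of_path h6 hpq ma mb mc hap.symm hab hbc hcq hbp.ne' hcp.ne' hac.ne
      haq.ne hbq.ne) ma mb hap.symm hab hbq haq.ne hbp.ne
  have key : ∀ z, (∀ u ∈ W, u ≠ z → Apart₁ G W z u) →
      (∃ u, u ∈ ext G W z) → HasInd G (ball G W z) 2 := by
    rintro z h ⟨u, hu⟩
    exact hasInd_ball h5 hδ hu (eq_of_adj_ext h)
  have Ba : HasInd G (ball G W a) 2 := by
    refine key a (fun u hu hne => ?_) ?_
    · rcases (hW u).1 hu with rfl | rfl | rfl | rfl | rfl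
      exacts [(hne rfl).elim, Aab.1, Aac.1, Aap.1, Aaq.1]
    · obtain ⟨u, hu, h1, h2, h3, h4⟩ := hδ.avoid_four a b c p q
      exact ⟨u, by simp [hu.ne', *], hu⟩
  have Bb : HasInd G (ball G W b) 2 := by
    refine key b (fun u hu hne => ?_) ?_
    · rcases (hW u).1 hu with rfl | rfl | rfl | rfl | rfl
      exacts [Aab.1.symm, (hne rfl).elim, Abc.1, Abp.1, Abq.1]
    · obtain ⟨u, hu, h1, h2, h3, h4⟩ := hδ.avoid_four b a c p q
      exact ⟨u, by simp [hu.ne', *], hu⟩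
  have Bc : HasInd G (ball G W c) 2 := by
    refine key c (fun u hu hne => ?_) ?_
    · rcases (hW u).1 hu with rfl | rfl | rfl | rfl | rfl
      exacts [Aac.1.symm, Abc.1.symm, (hne rfl).elim, Acp.1, Acq.1]
    · obtain ⟨u, hu, h1, h2, h3, h4⟩ := hδ.avoid_four c a b p q
      exact ⟨u, by simp [hu.ne', *], hu⟩
  have Bp : HasInd G (ball G W p) 2 := by
    refine key p (fun u hu hne => ?_) ?_
    · rcases (hW u).1 hu with rfl | rfl | rfl | rfl | rfl
      exacts [Aap.1.symm, Abp.1.symm, Acp.1.symm, (hne rfl).elim, Apq]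
    · obtain ⟨u, hu, h1, h2, h3, h4⟩ := hδ.avoid_four p a b c q
      exact ⟨u, by simp [hu.ne', *], hu⟩
  have Bq : HasInd G {q} 1 := HasInd.one rfl
  have S1 := Bq.union Ba (Aaq.1.symm.sep_singleton mq)
  have S2 := S1.union Bb ((Abq.1.symm.sep_singleton mq).union_left Aab.sep_ball)
  have S3 := S2.union Bc
    (((Acq.1.symm.sep_singleton mq).union_left Aac.sep_ball).union_left Abc.sep_ball)
  have S4 := S3.union Bp ((((Apq.symm.sep_singleton mq).union_left
    Aap.sep_ball).union_left Abp.sep_ball).union_left Acp.sep_ball)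
  exact S4.mono (Set.subset_univ _)

/-- `G` contains no `K₅` minus an edge. -/
def NoK5MinusEdge (G : SimpleGraph V) : Prop :=
  ∀ a b c p q : V, G.Adj a b → G.Adj a c → G.Adj b c → G.Adj a p → G.Adj b p → G.Adj c p →
    G.Adj a q → G.Adj b q → G.Adj c q → p = q

/-- The vertices `a, b, c, d` are pairwise adjacent. -/
structure IsK4 (G : SimpleGraph V) (a b c d : V) : Prop where
  ab : G.Adj a b
  ac : G.Adj a c
  ad : G.Adj a d
  bc : G.Adj b c
  bd : G.Adj b d
  cd : G.Adj c d

lemma IsK4.swap_left {a b c d : V} (h : IsK4 G a b c d) : IsK4 G b a c d :=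
  ⟨h.ab.symm, h.bc, h.bd, h.ac, h.ad, h.cd⟩

lemma IsK4.swap_right {a b c d : V} (h : IsK4 G a b c d) : IsK4 G a b d c :=
  ⟨h.ab, h.ad, h.ac, h.bd, h.bc, h.cd.symm⟩

/-- Common neighbours of `a` and `b` other than `c` and `d`. -/
def ears (G : SimpleGraph V) (a b c d : V) : Set V :=
  {u | G.Adj u a ∧ G.Adj u b ∧ u ≠ c ∧ u ≠ d}

/-- The vertices `a, b, c, d` together with all further common neighbours of `a` and `b`. -/
def fan (G : SimpleGraph V) (a b c d : V) : Set V :=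
  {u | u = a ∨ u = b ∨ u = c ∨ u = d ∨ u ∈ ears G a b c d}

section Fan

variable {a b c d x x' : V}

lemma ears_swap_left : ears G a b c d = ears G b a c d := by
  ext u
  simp only [ears, Set.mem_ofPred_eq]
  tauto

lemma ears_swap_right : ears G a b c d = ears G a b d c := by
  ext u
  simp only [ears, Set.mem_ofPred_eq]
  tauto

lemma fan_swap_left : fan G a b c d = fan G b a c d := by
  ext u
  simp only [fan, Set.mem_ofPred_eq, ears_swap_left (a := a)]
  tauto

lemma fan_swap_right : fan G a b c d = fan G a b d c := by
  ext u
  simp only [fan, Set.mem_ofPred_eq, ears_swap_right (c := c)]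
  tauto

lemma mem_fan_one : a ∈ fan G a b c d := by simp [fan]

lemma mem_fan_two : b ∈ fan G a b c d := by simp [fan]

lemma mem_fan_three : c ∈ fan G a b c d := by simp [fan]

lemma mem_fan_four : d ∈ fan G a b c d := by simp [fan]

lemma ears_subset_fan : ears G a b c d ⊆ fan G a b c d := fun u hu => by simp [fan, hu]

lemma fan_apart_center (h6 : NoC6 G) (h : IsK4 G a b c d) : Apart G (fan G a b c d) a b := by
  refine Apart.of_disjoint h6 mem_fan_one mem_fan_two h.ab ?_ mem_fan_three mem_fan_four
    mem_fan_three h.ac h.cd h.bd.symm h.bc.ne' h.ad.ne' h.ac h.bc.symm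
  rintro y ⟨h1, h2⟩ ⟨-, h3⟩
  refine h1 (ears_subset_fan ⟨h2.symm, h3.symm, ?_, ?_⟩)
  · rintro rfl
    exact h1 mem_fan_three
  · rintro rfl
    exact h1 mem_fan_four

lemma fan_apart_rim (h6 : NoC6 G) (h : IsK4 G a b c d) (hx : x ∈ ears G a b c d) :
    Apart G (fan G a b c d) c d :=
  Apart.of_disjoint h6 mem_fan_three mem_fan_four h.cd
    (ext_disjoint_of_path h6 h.cd.ne mem_fan_one (ears_subset_fan hx)
      mem_fan_two h.ac.symm hx.1.symm hx.2.1 h.bd hx.2.2.1.symm h.bc.ne' h.ab.ne h.ad.ne hx.2.2.2)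
    mem_fan_one mem_fan_two mem_fan_one h.ac.symm h.ab h.bd h.ad.ne h.bc.ne h.ac.symm h.ad

lemma fan_apart_spoke (h6 : NoC6 G) (h : IsK4 G a b c d) (hx : x ∈ ears G a b c d) :
    Apart G (fan G a b c d) a c :=
  Apart.of_disjoint h6 mem_fan_one mem_fan_three h.ac
    (ext_disjoint_of_path h6 h.ac.ne (ears_subset_fan hx) mem_fan_two
      mem_fan_four hx.1.symm hx.2.1 h.bd h.cd.symm h.ab.ne h.ad.ne hx.2.2.2 hx.2.2.1 h.bc.ne)
    mem_fan_two mem_fan_four mem_fan_two h.ab h.bd h.cd.symm h.bc.ne h.ad.ne' h.ab h.bc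

lemma fan_apart_ear_center (h6 : NoC6 G) (h : IsK4 G a b c d) (hx : x ∈ ears G a b c d) :
    Apart G (fan G a b c d) x a :=
  Apart.of_disjoint h6 (ears_subset_fan hx) mem_fan_one hx.1
    (ext_disjoint_of_path h6 hx.1.ne mem_fan_two mem_fan_three
      mem_fan_four hx.2.1 h.bc h.cd h.ad.symm hx.2.2.1 hx.2.2.2 h.bd.ne h.ab.ne' h.ac.ne')
    mem_fan_two mem_fan_three mem_fan_two hx.2.1 h.bc h.ac.symm h.ab.ne' hx.2.2.1.symm hx.2.1
    h.ab.symm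

lemma fan_apart_ear_rim (h6 : NoC6 G) (h : IsK4 G a b c d) (hx : x ∈ ears G a b c d) :
    Apart₁ G (fan G a b c d) x c ∧ Apart₂ G (fan G a b c d) x c := by
  have h1 : Apart₁ G (fan G a b c d) x c :=
    apart₁_of_path h6 (ears_subset_fan hx) mem_fan_three hx.2.2.1
      (ext_disjoint_of_path h6 hx.2.2.1 mem_fan_one mem_fan_two
        mem_fan_four hx.1 h.ab h.bd h.cd.symm hx.2.1.ne hx.2.2.2 h.ad.ne h.ac.ne h.bc.ne)
      mem_fan_one mem_fan_two hx.1 h.ab h.bc h.ac.ne hx.2.1.ne'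
  exact ⟨h1, apart₂_of_path h6 (ears_subset_fan hx) mem_fan_three hx.2.2.1 h1 mem_fan_one hx.1
    h.ac⟩

lemma fan_apart_ears (h6 : NoC6 G) (h : IsK4 G a b c d) (hx : x ∈ ears G a b c d)
    (hx' : x' ∈ ears G a b c d) (hne : x ≠ x') : Apart₁ G (fan G a b c d) x x' :=
  apart₁_of_path h6 (ears_subset_fan hx) (ears_subset_fan hx') hne
    (ext_disjoint_of_path h6 hne mem_fan_one
      mem_fan_three mem_fan_two hx.1 h.ac h.bc.symm hx'.2.1.symm hx.2.2.1 hx.2.1.ne h.ab.ne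
      hx'.1.ne' hx'.2.2.1.symm)
    mem_fan_one mem_fan_two hx.1 h.ab hx'.2.1.symm hx'.1.ne' hx.2.1.ne'

lemma ears_not_adj (h6 : NoC6 G) (h : IsK4 G a b c d) (hx : x ∈ ears G a b c d)
    (hx' : x' ∈ ears G a b c d) : ¬ G.Adj x x' := fun e =>
  h6 a c d b x' x h.ac h.cd h.bd.symm hx'.2.1.symm e.symm hx.1 h.ad.ne h.ab.ne hx'.1.ne' h.bc.ne'
    hx'.2.2.1.symm hx.2.2.1.symm hx'.2.2.2.symm hx.2.2.2.symm hx.2.1.ne'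

lemma ear_not_adj_rim (hE : NoK5MinusEdge G) (h : IsK4 G a b c d) (hx : x ∈ ears G a b c d) :
    ¬ G.Adj x c := fun e =>
  hx.2.2.2 (hE a b c x d h.ab h.ac h.bc hx.1.symm hx.2.1.symm e.symm h.ad h.bd h.cd)

lemma fan_adj_center (h6 : NoC6 G) (h : IsK4 G a b c d) (hx : x ∈ ears G a b c d) :
    ∀ y ∈ ext G (fan G a b c d) a, ∀ u ∈ fan G a b c d, G.Adj y u → u = a := by
  refine eq_of_adj_ext fun u hu hne => ?_
  rcases hu with rfl | rfl | rfl | rfl | hu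
  · exact (hne rfl).elim
  · exact (fan_apart_center h6 h).1
  · exact (fan_apart_spoke h6 h hx).1
  · rw [fan_swap_right]
    exact (fan_apart_spoke h6 h.swap_right (ears_swap_right ▸ hx)).1
  · exact (fan_apart_ear_center h6 h hu).1.symm

lemma fan_adj_rim (h6 : NoC6 G) (h : IsK4 G a b c d) (hx : x ∈ ears G a b c d) :
    ∀ y ∈ ext G (fan G a b c d) c, ∀ u ∈ fan G a b c d, G.Adj y u → u = c := by
  refine eq_of_adj_ext fun u hu hne => ?_
  rcases hu with rfl | rfl | rfl | rfl | hu
  · exact (fan_apart_spoke h6 h hx).1.symm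
  · rw [fan_swap_left]
    exact (fan_apart_spoke h6 h.swap_left (ears_swap_left ▸ hx)).1.symm
  · exact (hne rfl).elim
  · exact (fan_apart_rim h6 h hx).1
  · exact (fan_apart_ear_rim h6 h hu).1.symm

lemma fan_mem_ext_rim (hE : NoK5MinusEdge G) (h : IsK4 G a b c d) {y : V} (hy : G.Adj c y)
    (ha : y ≠ a) (hb : y ≠ b) (hd : y ≠ d) : y ∈ ext G (fan G a b c d) c := by
  refine ⟨?_, hy⟩
  rintro (hu | hu | hu | hu | hu)
  exacts [ha hu, hb hu, hy.ne' hu, hd hu, ear_not_adj_rim hE h hu hy.symm]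

lemma fan_mem_ext_ear (h6 : NoC6 G) (hE : NoK5MinusEdge G) (h : IsK4 G a b c d)
    (hx : x ∈ ears G a b c d) {y : V} (hy : G.Adj x y) (ha : y ≠ a) (hb : y ≠ b) :
    y ∈ ext G (fan G a b c d) x := by
  refine ⟨?_, hy⟩
  rintro (hu | hu | rfl | rfl | hu)
  exacts [ha hu, hb hu, ear_not_adj_rim hE h hx hy,
    ear_not_adj_rim hE h.swap_right (ears_swap_right ▸ hx) hy, ears_not_adj h6 h hx hu hy]

lemma fan_hasInd_rim (h6 : NoC6 G) (h5 : NoK5 G) (hδ : MinDeg G 5) (hE : NoK5MinusEdge G)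
    (h : IsK4 G a b c d) (hx : x ∈ ears G a b c d) : HasInd G (ball G (fan G a b c d) c) 2 := by
  obtain ⟨y, hy, y1, y2, y3, -⟩ := hδ.avoid_four c a b d d
  exact hasInd_ball h5 hδ (fan_mem_ext_rim hE h hy y1 y2 y3) (fan_adj_rim h6 h hx)

lemma fan_hasInd_insert_rim (h6 : NoC6 G) (h5 : NoK5 G) (hδ : MinDeg G 5)
    (hE : NoK5MinusEdge G) (h : IsK4 G a b c d) (hx : x ∈ ears G a b c d) :
    HasInd G ({c} ∪ ball G (fan G a b c d) c) 3 := by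
  obtain ⟨y, hy, y1, y2, y3, -⟩ := hδ.avoid_four c a b d d
  obtain ⟨t, ht, t1, t2, t3, t4⟩ := hδ.avoid_four c a b d y
  exact hasInd_insert_sphere h6 h5 hδ mem_fan_three (fan_mem_ext_rim hE h hy y1 y2 y3)
    (fan_mem_ext_rim hE h ht t1 t2 t3) t4.symm (fan_adj_rim h6 h hx)

lemma fan_hasInd_of_ext (h6 : NoC6 G) (h5 : NoK5 G) (hδ : MinDeg G 5) (hE : NoK5MinusEdge G)
    (h : IsK4 G a b c d) (hx : x ∈ ears G a b c d) {s t : V} (hs : s ∈ ext G (fan G a b c d) a)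
    (ht : t ∈ ext G (fan G a b c d) b) : HasInd G Set.univ 9 := by
  have hl := h.swap_left
  have hr := h.swap_right
  have hlr := hl.swap_right
  have hxl : x ∈ ears G b a c d := ears_swap_left ▸ hx
  have hxr : x ∈ ears G a b d c := ears_swap_right ▸ hx
  have hxlr : x ∈ ears G b a d c := ears_swap_right ▸ hxl
  have el : fan G b a c d = fan G a b c d := fan_swap_left
  have er : fan G a b d c = fan G a b c d := fan_swap_right
  have elr : fan G b a d c = fan G a b c d := fan_swap_left.trans er
  have Ba := hasInd_ball h5 hδ hs (fan_adj_center h6 h hx)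
  have Bb := hasInd_ball h5 hδ ht (el ▸ fan_adj_center h6 hl hxl)
  have Bc := fan_hasInd_rim h6 h5 hδ hE h hx
  have Bd := er ▸ fan_hasInd_rim h6 h5 hδ hE hr hxr
  have mx := ears_subset_fan hx
  have S1 := (HasInd.one (G := G) (Set.mem_singleton x)).union Ba
    ((fan_apart_ear_center h6 h hx).1.sep_singleton mx)
  have S2 := S1.union Bb (((el ▸ fan_apart_ear_center h6 hl hxl).1.sep_singleton mx).union_left
    (fan_apart_center h6 h).sep_ball)
  have S3 := S2.union Bc ((((fan_apart_ear_rim h6 h hx).1.sep_singleton mx).union_left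
    (fan_apart_spoke h6 h hx).sep_ball).union_left (el ▸ fan_apart_spoke h6 hl hxl).sep_ball)
  have S4 := S3.union Bd (((((er ▸ fan_apart_ear_rim h6 hr hxr).1.sep_singleton mx).union_left
    (er ▸ fan_apart_spoke h6 hr hxr).sep_ball).union_left
    (elr ▸ fan_apart_spoke h6 hlr hxlr).sep_ball).union_left (fan_apart_rim h6 h hx).sep_ball)
  exact S4.mono (Set.subset_univ _)

lemma fan_hasInd_ext_ear (h6 : NoC6 G) (h5 : NoK5 G) (hδ : MinDeg G 6) (hE : NoK5MinusEdge G)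
    (h : IsK4 G a b c d) (hx : x ∈ ears G a b c d) : HasInd G (ext G (fan G a b c d) x) 2 := by
  by_contra hcon
  have hcl : ∀ u ∈ ext G (fan G a b c d) x, ∀ w ∈ ext G (fan G a b c d) x, u ≠ w →
      G.Adj u w := by
    intro u hu w hw hne
    by_contra hn
    exact hcon (HasInd.two hu hw hne hn)
  obtain ⟨p, hp, p1, p2, -⟩ := hδ.avoid_five x a b b b b
  obtain ⟨q, hq, q1, q2, q3, -⟩ := hδ.avoid_five x a b p p p
  obtain ⟨r, hr, r1, r2, r3, r4, -⟩ := hδ.avoid_five x a b p q q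
  obtain ⟨s, hs, s1, s2, s3, s4, s5⟩ := hδ.avoid_five x a b p q r
  have mp := fan_mem_ext_ear h6 hE h hx hp p1 p2
  have mq := fan_mem_ext_ear h6 hE h hx hq q1 q2
  have mr := fan_mem_ext_ear h6 hE h hx hr r1 r2
  have ms := fan_mem_ext_ear h6 hE h hx hs s1 s2
  exact h5 x p q r s hp hq hr hs (hcl _ mp _ mq q3.symm) (hcl _ mp _ mr r3.symm)
    (hcl _ mp _ ms s3.symm) (hcl _ mq _ mr r4.symm) (hcl _ mq _ ms s4.symm)
    (hcl _ mr _ ms s5.symm)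

lemma fan_hasInd_of_ext_eq_empty (h6 : NoC6 G) (h5 : NoK5 G) (hδ : MinDeg G 5)
    (hE : NoK5MinusEdge G) (h : IsK4 G a b c d) (hempty : ∀ y, y ∉ ext G (fan G a b c d) a) :
    HasInd G Set.univ 7 ∧ (MinDeg G 6 → HasInd G Set.univ 9) := by
  have hear : ∀ y, G.Adj a y → y ≠ b → y ≠ c → y ≠ d → y ∈ ears G a b c d := by
    intro y hy hb hc hd
    by_contra hn
    refine hempty y ⟨?_, hy⟩
    rintro (hu | hu | hu | hu | hu)
    exacts [hy.ne' hu, hb hu, hc hu, hd hu, hn hu]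
  obtain ⟨x, hx, x1, x2, x3, -⟩ := hδ.avoid_four a b c d d
  obtain ⟨y, hy, y1, y2, y3, y4⟩ := hδ.avoid_four a b c d x
  replace hx := hear x hx x1 x2 x3
  replace hy := hear y hy y1 y2 y3
  have hr := h.swap_right
  have er : fan G a b d c = fan G a b c d := fan_swap_right
  have hxr : x ∈ ears G a b d c := ears_swap_right ▸ hx
  have hrc : ∀ {u}, u ∈ ears G a b c d →
      Sep G (ball G (fan G a b c d) c) (ext G (fan G a b c d) u) := fun hu =>
    (sep_ext_ball (fan_apart_ear_rim h6 h hu).1 (fan_apart_ear_rim h6 h hu).2).symm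
  have hrd : ∀ {u}, u ∈ ears G a b c d →
      Sep G (ball G (fan G a b c d) d) (ext G (fan G a b c d) u) := fun {u} hu => by
    have := fan_apart_ear_rim h6 hr (ears_swap_right (c := c) ▸ hu)
    rw [er] at this
    exact (sep_ext_ball this.1 this.2).symm
  have hBd : HasInd G (ball G (fan G a b c d) d) 2 := er ▸ fan_hasInd_rim h6 h5 hδ hE hr hxr
  have Acd := fan_apart_rim h6 h hx
  constructor
  · have key : ∀ {u}, u ∈ ears G a b c d → HasInd G (ext G (fan G a b c d) u) 1 ∧
        Sep G {c} (ext G (fan G a b c d) u) := by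
      intro u hu
      obtain ⟨t, ht, t1, t2, -⟩ := hδ.avoid_four u a b b b
      refine ⟨HasInd.one (fan_mem_ext_ear h6 hE h hu ht t1 t2), fun s hs w hw => ?_⟩
      exact (fan_apart_ear_rim h6 h hu).1.symm.sep_singleton mem_fan_three s hs w
        (ext_subset_ball hw)
    have S1 := (fan_hasInd_insert_rim h6 h5 hδ hE h hx).union hBd
      ((Acd.1.sep_singleton mem_fan_three).union_left Acd.sep_ball)
    have S2 := S1.union (key hx).1 (((key hx).2.union_left (hrc hx)).union_left (hrd hx))
    have S3 := S2.union (key hy).1 ((((key hy).2.union_left (hrc hy)).union_left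
      (hrd hy)).union_left (fan_apart_ears h6 h hx hy y4.symm).sep_ext)
    exact S3.mono (Set.subset_univ _)
  · intro hδ'
    obtain ⟨z, hz, z1, z2, z3, z4, z5⟩ := hδ'.avoid_five a b c d x y
    replace hz := hear z hz z1 z2 z3
    have S1 := (fan_hasInd_rim h6 h5 hδ hE h hx).union hBd Acd.sep_ball
    have S2 := S1.union (fan_hasInd_ext_ear h6 h5 hδ' hE h hx) ((hrc hx).union_left (hrd hx))
    have S3 := S2.union (fan_hasInd_ext_ear h6 h5 hδ' hE h hy)
      (((hrc hy).union_left (hrd hy)).union_left (fan_apart_ears h6 h hx hy y4.symm).sep_ext)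
    have S4 := S3.union (fan_hasInd_ext_ear h6 h5 hδ' hE h hz)
      ((((hrc hz).union_left (hrd hz)).union_left
        (fan_apart_ears h6 h hx hz z4.symm).sep_ext).union_left
        (fan_apart_ears h6 h hy hz z5.symm).sep_ext)
    exact (S4.mono (Set.subset_univ _)).le (by norm_num)

lemma fan_hasInd (h6 : NoC6 G) (h5 : NoK5 G) (hδ : MinDeg G 5)
    (hE : NoK5MinusEdge G) (h : IsK4 G a b c d) (hx : x ∈ ears G a b c d) :
    HasInd G Set.univ 7 ∧ (MinDeg G 6 → HasInd G Set.univ 9) := by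
  by_cases ha : ∀ y, y ∉ ext G (fan G a b c d) a
  · exact fan_hasInd_of_ext_eq_empty h6 h5 hδ hE h ha
  by_cases hb : ∀ y, y ∉ ext G (fan G a b c d) b
  · exact fan_hasInd_of_ext_eq_empty h6 h5 hδ hE h.swap_left (fan_swap_left (a := a) ▸ hb)
  push Not at ha hb
  obtain ⟨s, hs⟩ := ha
  obtain ⟨t, ht⟩ := hb
  have := fan_hasInd_of_ext h6 h5 hδ hE h hx hs ht
  exact ⟨this.le (by norm_num), fun _ => this⟩

end Fan

lemma hasInd_of_isolated_K4 {q : Fin 4 → V} (h6 : NoC6 G) (h5 : NoK5 G) (hδ : MinDeg G 5)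
    (hq : ∀ i j, i ≠ j → G.Adj (q i) (q j))
    (hd : ∀ i j, i ≠ j → ∀ y ∈ ext G (Set.range q) (q i), y ∉ ext G (Set.range q) (q j)) :
    HasInd G Set.univ 9 := by
  have hex : ∀ i j : Fin 4, i ≠ j → ∃ k l : Fin 4, i ≠ k ∧ i ≠ l ∧ j ≠ k ∧ j ≠ l ∧ k ≠ l := by
    decide
  have hap : ∀ i j : Fin 4, i ≠ j → Apart G (Set.range q) (q i) (q j) := by
    intro i j hij
    obtain ⟨k, l, hik, hil, hjk, hjl, hkl⟩ := hex i j hij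
    exact apart_of_clique h6 hq hij hik hil hjk hjl hkl (hd i j hij)
  have hW : ∀ i, ∀ y ∈ ext G (Set.range q) (q i), ∀ u ∈ Set.range q, G.Adj y u → u = q i := by
    intro i
    refine eq_of_adj_ext ?_
    rintro _ ⟨j, rfl⟩ hj
    exact (hap i j (by rintro rfl; exact hj rfl)).1
  have hB : ∀ i, HasInd G (ball G (Set.range q) (q i)) 2 := by
    intro i
    obtain ⟨x, hx⟩ := exists_mem_ext (q := q) (hδ.le (by norm_num)) i
    exact hasInd_ball h5 hδ hx (hW i)
  have mem : ∀ u, u ≠ q 0 → u ≠ q 1 → u ≠ q 2 → u ≠ q 3 → u ∉ Set.range q := by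
    rintro u h0 h1 h2 h3 ⟨i, rfl⟩
    fin_cases i
    exacts [h0 rfl, h1 rfl, h2 rfl, h3 rfl]
  obtain ⟨x, hx, x1, x2, x3, -⟩ := hδ.avoid_four (q 0) (q 1) (q 2) (q 3) (q 3)
  obtain ⟨y, hy, y1, y2, y3, y4⟩ := hδ.avoid_four (q 0) (q 1) (q 2) (q 3) x
  have B0 := hasInd_insert_sphere (W := Set.range q) (z := q 0) h6 h5 hδ ⟨0, rfl⟩ ⟨mem x hx.ne' x1 x2 x3, hx⟩
    ⟨mem y hy.ne' y1 y2 y3, hy⟩ y4.symm (hW 0)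
  have hs : ∀ i, 0 ≠ i → Sep G ({q 0} ∪ ball G (Set.range q) (q 0))
      (ball G (Set.range q) (q i)) := fun i hi =>
    ((hap 0 i hi).1.sep_singleton ⟨0, rfl⟩).union_left (hap 0 i hi).sep_ball
  have S1 := B0.union (hB 1) (hs 1 (by decide))
  have S2 := S1.union (hB 2) ((hs 2 (by decide)).union_left (hap 1 2 (by decide)).sep_ball)
  have S3 := S2.union (hB 3) (((hs 3 (by decide)).union_left
    (hap 1 3 (by decide)).sep_ball).union_left (hap 2 3 (by decide)).sep_ball)
  exact S3.mono (Set.subset_univ _)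

theorem hasInd_of_K4 {a b c d : V} (h6 : NoC6 G) (h5 : NoK5 G) (hδ : MinDeg G 5)
    (h : IsK4 G a b c d) : HasInd G Set.univ 7 ∧ (MinDeg G 6 → HasInd G Set.univ 9) := by
  by_cases hE : NoK5MinusEdge G
  · obtain ⟨q, rfl, rfl, rfl, rfl⟩ : ∃ q : Fin 4 → V, q 0 = a ∧ q 1 = b ∧ q 2 = c ∧ q 3 = d :=
      ⟨![a, b, c, d], rfl, rfl, rfl, rfl⟩
    have hq : ∀ i j, i ≠ j → G.Adj (q i) (q j) := by
      intro i j
      fin_cases i <;> fin_cases j <;> simp [h.ab, h.ac, h.ad, h.bc, h.bd, h.cd, h.ab.symm,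
        h.ac.symm, h.ad.symm, h.bc.symm, h.bd.symm, h.cd.symm]
    by_cases hd : ∀ i j, i ≠ j → ∀ y ∈ ext G (Set.range q) (q i), y ∉ ext G (Set.range q) (q j)
    · have := hasInd_of_isolated_K4 h6 h5 hδ hq hd
      exact ⟨this.le (by norm_num), fun _ => this⟩
    · push Not at hd
      obtain ⟨i, j, hij, y, hi, hj⟩ := hd
      have hex : ∀ i j : Fin 4, i ≠ j →
          ∃ k l : Fin 4, i ≠ k ∧ i ≠ l ∧ j ≠ k ∧ j ≠ l ∧ k ≠ l := by
        decide
      obtain ⟨k, l, hik, hil, hjk, hjl, hkl⟩ := hex i j hij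
      exact fan_hasInd h6 h5 hδ hE (c := q k) (d := q l) ⟨hq i j hij, hq i k hik, hq i l hil,
        hq j k hjk, hq j l hjl, hq k l hkl⟩ ⟨hi.2.symm, hj.2.symm,
        fun h => hi.1 ⟨k, h.symm⟩, fun h => hi.1 ⟨l, h.symm⟩⟩
  · unfold NoK5MinusEdge at hE
    push Not at hE
    obtain ⟨a, b, c, p, q, h1, h2, h3, h4, h5', h6', h7, h8, h9, h10⟩ := hE
    have := hasInd_of_K5_minus_edge h6 h5 hδ h1 h2 h3 h4 h5' h6' h7 h8 h9 h10
    exact ⟨this.le (by norm_num), fun _ => this⟩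

end FourClique

section SmallIndependence

variable {G : SimpleGraph V}

lemma HasInd.three {A : Set V} {x y z : V} (hx : x ∈ A) (hy : y ∈ A) (hz : z ∈ A) (hxy : x ≠ y)
    (hxz : x ≠ z) (hyz : y ≠ z) (nxy : ¬ G.Adj x y) (nxz : ¬ G.Adj x z) (nyz : ¬ G.Adj y z) :
    HasInd G A 3 := by
  have hS : Sep G {x} {y, z} := by
    rintro u rfl w (rfl | rfl)
    exacts [⟨hxy, nxy⟩, ⟨hxz, nxz⟩]
  refine ((HasInd.one (Set.mem_singleton x)).union
    (HasInd.two (by simp) (by simp) hyz nyz) hS).mono ?_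
  rintro u (rfl | rfl | rfl) <;> assumption

lemma exists_avoid_eight (hbig : ∀ s : Finset V, s.card < 9 → ∃ u, u ∉ s)
    (a b c d e f g h : V) : ∃ u, u ≠ a ∧ u ≠ b ∧ u ≠ c ∧ u ≠ d ∧ u ≠ e ∧ u ≠ f ∧ u ≠ g ∧ u ≠ h := by
  classical
  obtain ⟨u, hu⟩ := hbig ([a, b, c, d, e, f, g, h].toFinset)
    (Nat.lt_succ_of_le (List.toFinset_card_le _))
  exact ⟨u, by simpa using hu⟩

lemma false_of_K5_minus_edge (h6 : NoC6 G) (h5 : NoK5 G)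
    (h3 : ∀ x y z : V, x ≠ y → x ≠ z → y ≠ z → G.Adj x y ∨ G.Adj x z ∨ G.Adj y z)
    (hbig : ∀ s : Finset V, s.card < 9 → ∃ u, u ∉ s) {a b c p q : V}
    (hab : G.Adj a b) (hac : G.Adj a c) (hbc : G.Adj b c) (hap : G.Adj a p) (hbp : G.Adj b p)
    (hcp : G.Adj c p) (haq : G.Adj a q) (hbq : G.Adj b q) (hcq : G.Adj c q) (hpq : p ≠ q) :
    False := by
  have npq : ¬ G.Adj p q := fun e => h5 a b c p q hab hac hap haq hbc hbp hbq hcp hcq e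
  set E : Set V := {e | e ≠ a ∧ e ≠ b ∧ e ≠ c ∧ e ≠ p ∧ e ≠ q} with hE
  have hd : ∀ e ∈ E, ¬ (G.Adj e a ∧ G.Adj e b) ∧ ¬ (G.Adj e a ∧ G.Adj e c) ∧
      ¬ (G.Adj e b ∧ G.Adj e c) ∧ ¬ (G.Adj e p ∧ G.Adj e q) := by
    rintro e ⟨e1, e2, e3, e4, e5⟩
    refine ⟨fun h => ?_, fun h => ?_, fun h => ?_, fun h => ?_⟩
    · exact h6 e a p c q b h.1 hap hcp.symm hcq hbq.symm h.2.symm e4 e3 e5 hac.ne haq.ne hab.ne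
        hpq hbp.ne' hbc.ne'
    · exact h6 e a p b q c h.1 hap hbp.symm hbq hcq.symm h.2.symm e4 e2 e5 hab.ne haq.ne hac.ne
        hpq hcp.ne' hbc.ne
    · exact h6 e b p a q c h.1 hbp hap.symm haq hcq.symm h.2.symm e4 e1 e5 hab.ne' hbq.ne hbc.ne
        hpq hcp.ne' hac.ne
    · exact h6 e p a b c q h.1 hap.symm hab hbc hcq h.2.symm e1 e2 e3 hbp.ne' hcp.ne' hpq
        hac.ne haq.ne hbq.ne
  have hcl : ∀ e ∈ E, ∀ e' ∈ E, e ≠ e' → G.Adj e e' := by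
    intro e he e' he' hne
    have k1 := hd e he
    have k2 := hd e' he'
    have t1 := h3 e e' a hne he.1 he'.1
    have t2 := h3 e e' b hne he.2.1 he'.2.1
    have t3 := h3 e e' c hne he.2.2.1 he'.2.2.1
    clear_value E
    grind
  have hor : ∀ e ∈ E, G.Adj e p ∨ G.Adj e q := by
    rintro e ⟨-, -, -, e4, e5⟩
    exact (h3 e p q e4 e5 hpq).imp_right fun h => h.resolve_right npq
  obtain ⟨e, e1, e2, e3, e4, e5, -⟩ := exists_avoid_eight hbig a b c p q q q q
  obtain ⟨f, f1, f2, f3, f4, f5, f6, -⟩ := exists_avoid_eight hbig a b c p q e e e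
  obtain ⟨g, g1, g2, g3, g4, g5, g6, g7, -⟩ := exists_avoid_eight hbig a b c p q e f f
  obtain ⟨h, i1, i2, i3, i4, i5, i6, i7, i8⟩ := exists_avoid_eight hbig a b c p q e f g
  have me : e ∈ E := ⟨e1, e2, e3, e4, e5⟩
  have mf : f ∈ E := ⟨f1, f2, f3, f4, f5⟩
  have mg : g ∈ E := ⟨g1, g2, g3, g4, g5⟩
  have mh : h ∈ E := ⟨i1, i2, i3, i4, i5⟩
  have hall : ∀ r, ¬ ∀ e ∈ E, G.Adj r e := fun r hr =>
    h5 r e f g h (hr e me) (hr f mf) (hr g mg) (hr h mh) (hcl _ me _ mf f6.symm)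
      (hcl _ me _ mg g6.symm) (hcl _ me _ mh i6.symm) (hcl _ mf _ mg g7.symm)
      (hcl _ mf _ mh i7.symm) (hcl _ mg _ mh i8.symm)
  have hp := hall p
  have hq := hall q
  push Not at hp hq
  obtain ⟨s, hs, hs'⟩ := hp
  obtain ⟨t, ht, ht'⟩ := hq
  have hsq : G.Adj s q := (hor s hs).resolve_left fun e => hs' e.symm
  have htp : G.Adj t p := (hor t ht).resolve_right fun e => ht' e.symm
  have hst : s ≠ t := fun h => hs' (h ▸ htp.symm)
  obtain ⟨w, hw, hws, hwt⟩ : ∃ w ∈ E, w ≠ s ∧ w ≠ t := by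
    by_cases h1 : e ≠ s ∧ e ≠ t
    · exact ⟨e, me, h1⟩
    by_cases h2 : f ≠ s ∧ f ≠ t
    · exact ⟨f, mf, h2⟩
    exact ⟨g, mg, by grind, by grind⟩
  exact h6 p t w s q a htp.symm (hcl t ht w hw hwt.symm) (hcl w hw s hs hws) hsq haq.symm hap
    hw.2.2.2.1.symm hs.2.2.2.1.symm hpq hst.symm ht.2.2.2.2 ht.1 hw.2.2.2.2 hw.1 hs.1

theorem false_of_K4_of_not_hasInd_three (h6 : NoC6 G) (h5 : NoK5 G)
    (hind : ¬ HasInd G Set.univ 3) (hbig : ∀ s : Finset V, s.card < 9 → ∃ u, u ∉ s)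
    {a b c d : V} (h : IsK4 G a b c d) : False := by
  have h3 : ∀ x y z : V, x ≠ y → x ≠ z → y ≠ z → G.Adj x y ∨ G.Adj x z ∨ G.Adj y z := by
    intro x y z hxy hxz hyz
    by_contra hn
    push Not at hn
    exact hind (HasInd.three trivial trivial trivial hxy hxz hyz hn.1 hn.2.1 hn.2.2)
  set E : Set V := {e | e ≠ a ∧ e ≠ b ∧ e ≠ c ∧ e ≠ d} with hE
  obtain ⟨r, hr, s, hs, hrs, nrs⟩ : ∃ r ∈ E, ∃ s ∈ E, r ≠ s ∧ ¬ G.Adj r s := by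
    by_contra hcl
    push Not at hcl
    obtain ⟨e, e1, e2, e3, e4, -⟩ := exists_avoid_eight hbig a b c d d d d d
    obtain ⟨f, f1, f2, f3, f4, f5, -⟩ := exists_avoid_eight hbig a b c d e e e e
    obtain ⟨g, g1, g2, g3, g4, g5, g6, -⟩ := exists_avoid_eight hbig a b c d e f f f
    obtain ⟨h, i1, i2, i3, i4, i5, i6, i7, -⟩ := exists_avoid_eight hbig a b c d e f g g
    obtain ⟨k, k1, k2, k3, k4, k5, k6, k7, k8⟩ := exists_avoid_eight hbig a b c d e f g h
    have me : e ∈ E := ⟨e1, e2, e3, e4⟩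
    have mf : f ∈ E := ⟨f1, f2, f3, f4⟩
    have mg : g ∈ E := ⟨g1, g2, g3, g4⟩
    have mh : h ∈ E := ⟨i1, i2, i3, i4⟩
    have mk : k ∈ E := ⟨k1, k2, k3, k4⟩
    exact h5 e f g h k (hcl _ me _ mf f5.symm) (hcl _ me _ mg g5.symm) (hcl _ me _ mh i5.symm)
      (hcl _ me _ mk k5.symm) (hcl _ mf _ mg g6.symm) (hcl _ mf _ mh i6.symm)
      (hcl _ mf _ mk k6.symm) (hcl _ mg _ mh i7.symm) (hcl _ mg _ mk k7.symm)
      (hcl _ mh _ mk k8.symm)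
  have hor : ∀ q, r ≠ q → s ≠ q → G.Adj r q ∨ G.Adj s q := by
    intro q h1 h2
    exact (h3 r s q hrs h1 h2).resolve_left nrs
  have split : ∀ r s, r ≠ s → ∀ a b c d, IsK4 G a b c d → r ≠ a → r ≠ d → s ≠ b →
      s ≠ c → G.Adj r b → G.Adj r c → G.Adj s a → G.Adj s d → False := by
    intro r s hrs a b c d h n1 n2 n3 n4 e1 e2 e3 e4
    exact h6 r b a s d c e1 h.ab.symm e3.symm e4 h.cd.symm e2.symm n1 hrs n2 n3.symm h.bd.ne
      h.bc.ne h.ad.ne h.ac.ne n4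
  have three : ∀ r, ∀ a b c d, IsK4 G a b c d → r ≠ d → G.Adj r a → G.Adj r b → G.Adj r c →
      False := fun r a b c d h n e1 e2 e3 =>
    false_of_K5_minus_edge h6 h5 h3 hbig h.ab h.ac h.bc h.ad h.bd h.cd e1.symm e2.symm e3.symm
      n.symm
  obtain ⟨r1, r2, r3, r4⟩ := hr
  obtain ⟨s1, s2, s3, s4⟩ := hs
  have habdc := h.swap_right
  have hacdb : IsK4 G a c d b := ⟨h.ac, h.ad, h.ab, h.cd, h.bc.symm, h.bd.symm⟩
  have hbcda : IsK4 G b c d a := ⟨h.bc, h.bd, h.ab.symm, h.cd, h.ac.symm, h.ad.symm⟩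
  rcases hor a r1 s1 with ea | ea <;> rcases hor b r2 s2 with eb | eb <;>
    rcases hor c r3 s3 with ec | ec <;> rcases hor d r4 s4 with ed | ed
  · exact three r a b c d h r4 ea eb ec
  · exact three r a b c d h r4 ea eb ec
  · exact three r a b d c habdc r3 ea eb ed
  · exact split s r hrs.symm a c d b hacdb s1 s2 r3 r4 ec ed ea eb
  · exact three r a c d b hacdb r2 ea ec ed
  · exact split s r hrs.symm a b d c habdc s1 s3 r2 r4 eb ed ea ec
  · exact split s r hrs.symm a b c d h s1 s4 r2 r3 eb ec ea ed
  · exact three s b c d a hbcda s1 eb ec ed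
  · exact three r b c d a hbcda r1 eb ec ed
  · exact split r s hrs a b c d h r1 r4 s2 s3 eb ec ea ed
  · exact split r s hrs a b d c habdc r1 r3 s2 s4 eb ed ea ec
  · exact three s a c d b hacdb s2 ea ec ed
  · exact split r s hrs a c d b hacdb r1 r2 s3 s4 ec ed ea eb
  · exact three s a b d c habdc s3 ea eb ed
  · exact three s a b c d h s4 ea eb ec
  · exact three s a b c d h s4 ea eb ec

end SmallIndependence

section Matching

variable {G : SimpleGraph V}

/-- The set `N` contains no triangle. -/
def NoTriangle (G : SimpleGraph V) (N : Set V) : Prop :=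
  ∀ a ∈ N, ∀ b ∈ N, ∀ c ∈ N, G.Adj a b → G.Adj a c → G.Adj b c → False

/-- The set `S` contains an independent set `I` such that `S \ I` is matched into `I`. -/
def Matched (G : SimpleGraph V) (S : Set V) : Prop :=
  ∃ I ⊆ S, G.IsIndepSet I ∧ ∃ f : V → V, Set.InjOn f (S \ I) ∧
    ∀ x ∈ S \ I, f x ∈ I ∧ G.Adj x (f x)

lemma Matched.extend {S P J : Set V} (h : Matched G (S \ P)) (hP : P ⊆ S) (hJ : J ⊆ P)
    (hJi : G.IsIndepSet J) (hsep : ∀ x ∈ J, ∀ y ∈ S \ P, ¬ G.Adj x y) (g : V → V)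
    (hg : Set.InjOn g (P \ J)) (hgJ : ∀ x ∈ P \ J, g x ∈ J ∧ G.Adj x (g x)) : Matched G S := by
  classical
  obtain ⟨I, hI, hIi, f, hf, hfI⟩ := h
  have hIP : ∀ x ∈ I, x ∉ P := fun x hx => (hI hx).2
  refine ⟨I ∪ J, Set.union_subset (hI.trans Set.sdiff_subset) (hJ.trans hP), ?_,
    fun x => if x ∈ P then g x else f x, ?_, ?_⟩
  · rintro x (hx | hx) y (hy | hy) hxy
    · exact hIi hx hy hxy
    · exact fun e => hsep y hy x (hI hx) e.symm
    · exact hsep x hx y (hI hy)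
    · exact hJi hx hy hxy
  · rintro x ⟨hxS, hx⟩ y ⟨hyS, hy⟩ hxy
    rw [Set.mem_union, not_or] at hx hy
    simp only at hxy
    split_ifs at hxy with h1 h2 h2
    · exact hg ⟨h1, hx.2⟩ ⟨h2, hy.2⟩ hxy
    · exact (hIP _ (hfI y ⟨⟨hyS, h2⟩, hy.1⟩).1 (hxy ▸ hJ (hgJ x ⟨h1, hx.2⟩).1)).elim
    · exact (hIP _ (hfI x ⟨⟨hxS, h1⟩, hx.1⟩).1 (hxy ▸ hJ (hgJ y ⟨h2, hy.2⟩).1)).elim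
    · exact hf ⟨⟨hxS, h1⟩, hx.1⟩ ⟨⟨hyS, h2⟩, hy.1⟩ hxy
  · rintro x ⟨hxS, hx⟩
    rw [Set.mem_union, not_or] at hx
    simp only
    split_ifs with h1
    · exact ⟨Or.inr (hgJ x ⟨h1, hx.2⟩).1, (hgJ x ⟨h1, hx.2⟩).2⟩
    · exact ⟨Or.inl (hfI x ⟨⟨hxS, h1⟩, hx.1⟩).1, (hfI x ⟨⟨hxS, h1⟩, hx.1⟩).2⟩

lemma NoTriangle.mono {A B : Set V} (h : NoTriangle G B) (hAB : A ⊆ B) : NoTriangle G A :=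
  fun a ha b hb c hc => h a (hAB ha) b (hAB hb) c (hAB hc)

lemma NoP5.mono {A B : Set V} (h : NoP5 G B) (hAB : A ⊆ B) : NoP5 G A :=
  fun a ha b hb c hc d hd e he => h a (hAB ha) b (hAB hb) c (hAB hc) d (hAB hd) e (hAB he)

theorem matched_of_noP5 {S : Set V} (hS : S.Finite) (hT : NoTriangle G S) (hP : NoP5 G S) :
    Matched G S := by
  classical
  induction hn : S.ncard using Nat.strong_induction_on generalizing S with
  | _ n ih =>
  subst hn
  have step : ∀ P ⊆ S, P.Nonempty → Matched G (S \ P) := by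
    rintro P hPS ⟨p, hp⟩
    refine ih _ ?_ (hS.subset Set.sdiff_subset) (hT.mono Set.sdiff_subset)
      (hP.mono Set.sdiff_subset) rfl
    exact Set.ncard_lt_ncard ⟨Set.sdiff_subset, fun h => (h (hPS hp)).2 hp⟩ hS
  rcases S.eq_empty_or_nonempty with rfl | ⟨y₀, hy₀⟩
  · exact ⟨∅, by simp, by simp [SimpleGraph.IsIndepSet], id, by simp, by simp⟩
  by_cases hdeg : ∃ y ∈ S, ∀ u ∈ S, ∀ u' ∈ S, G.Adj y u → G.Adj y u' → u = u'
  · obtain ⟨y, hy, hu⟩ := hdeg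
    by_cases hnb : ∃ u ∈ S, G.Adj y u
    · obtain ⟨u, huS, hyu⟩ := hnb
      refine (step {y, u} (by simp [Set.insert_subset_iff, *]) ⟨y, by simp⟩).extend
        (J := {y}) (by simp [Set.insert_subset_iff, *]) (by simp) (by simp)
        ?_ (fun _ => y) ?_ ?_
      · rintro x rfl z ⟨hz, hz'⟩ e
        exact hz' (Or.inr (hu z hz u huS e hyu))
      · rintro x ⟨rfl | rfl, hx⟩ z ⟨rfl | rfl, hz⟩ - <;> simp_all
      · rintro x ⟨rfl | rfl, hx⟩
        · exact (hx rfl).elim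
        · exact ⟨rfl, hyu.symm⟩
    · push Not at hnb
      refine (step {y} (by simpa using hy) ⟨y, rfl⟩).extend (J := {y}) (by simpa using hy) le_rfl
        (by simp) ?_ id (by simp) (by simp)
      rintro x rfl z ⟨hz, -⟩
      exact hnb z hz
  · push Not at hdeg
    obtain ⟨u, hu, w, hw, hyu, hyw, huw⟩ := hdeg y₀ hy₀
    have hother : ∀ y ∈ S, ∀ x, ∃ z ∈ S, G.Adj y z ∧ z ≠ x := by
      intro y hy x
      obtain ⟨p, hp, q, hq, e1, e2, hpq⟩ := hdeg y hy
      by_cases h : p = x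
      · exact ⟨q, hq, e2, fun h' => hpq (h.trans h'.symm)⟩
      · exact ⟨p, hp, e1, h⟩
    have nuw : ¬ G.Adj u w := hT y₀ hy₀ u hu w hw hyu hyw
    obtain ⟨z, hz, huz, hzy⟩ := hother u hu y₀
    obtain ⟨z', hz', hwz', hzy'⟩ := hother w hw y₀
    have hzw : z ≠ w := by rintro rfl; exact nuw huz
    have hzu' : z' ≠ u := by rintro rfl; exact nuw hwz'.symm
    obtain rfl : z = z' := by
      by_contra hne
      exact hP z hz u hu y₀ hy₀ w hw z' hz' huz.symm hyu.symm hyw hwz' hzy hzw hne huw hzu'.symm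
        hzy'.symm
    have nyz : ¬ G.Adj y₀ z := fun e => hT y₀ hy₀ u hu z hz hyu e huz
    refine (step {y₀, u, w, z} (by simp [Set.insert_subset_iff, *]) ⟨y₀, by simp⟩).extend
      (J := {y₀, z}) (by simp [Set.insert_subset_iff, *]) (by simp [Set.insert_subset_iff])
      ?_ ?_ (fun x => if x = u then y₀ else z) ?_ ?_
    · rintro x (rfl | rfl) t (rfl | rfl) hxt
      exacts [(hxt rfl).elim, nyz, fun e => nyz e.symm, (hxt rfl).elim]
    · rintro x (rfl | rfl) t ⟨ht, htP⟩ e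
      · refine hP t ht x hy₀ u hu z hz w hw e.symm hyu huz hwz'.symm ?_ ?_ ?_ hzy.symm hyw.ne huw
        all_goals rintro rfl; exact htP (by simp)
      · refine hP t ht x hz u hu y₀ hy₀ w hw e.symm huz.symm hyu.symm hyw ?_ ?_ ?_ hzy hwz'.ne' huw
        all_goals rintro rfl; exact htP (by simp)
    · rintro x ⟨hx, hx'⟩ t ⟨ht, ht'⟩ h
      have := hyu.ne
      have := hyw.ne
      have := huz.ne
      simp only [Set.mem_insert_iff, Set.mem_singleton_iff] at hx hx' ht ht'
      grind
    · rintro x ⟨hx, hx'⟩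
      simp only [Set.mem_insert_iff, Set.mem_singleton_iff] at hx hx' ⊢
      rcases hx with rfl | rfl | rfl | rfl
      · exact (hx' (Or.inl rfl)).elim
      · simpa using hyu.symm
      · simpa [huw.symm] using hwz'
      · exact (hx' (Or.inr rfl)).elim

lemma Matched.hasInd {S : Set V} (hS : S.Finite) (h : Matched G S) :
    ∃ k, HasInd G S k ∧ S.ncard ≤ 2 * k := by
  obtain ⟨I, hI, hIi, f, hf, hfI⟩ := h
  have hIf := hS.subset hI
  refine ⟨I.ncard, ⟨hIf.toFinset, by simpa using hI, by simpa using hIi,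
    (Set.ncard_eq_toFinset_card I hIf).le⟩, ?_⟩
  have h1 : (S \ I).ncard ≤ I.ncard :=
    Set.ncard_le_ncard_of_injOn f (fun x hx => (hfI x hx).1) hf hIf
  have h2 := Set.ncard_sdiff_add_ncard_of_subset hI hS
  omega

end Matching

section SecondNeighbourhood

variable {G : SimpleGraph V} {v : V}

/-- Vertices at distance exactly two from `v`. -/
def second (G : SimpleGraph V) (v : V) : Set V :=
  {x | x ≠ v ∧ ¬ G.Adj v x ∧ ∃ u, G.Adj v u ∧ G.Adj u x}

lemma noTriangle_neighborSet (h4 : NoK4 G) : NoTriangle G (G.neighborSet v) :=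
  fun a ha b hb c hc => h4 v a b c ha hb hc

lemma parent_eq (h6 : NoC6 G) {x y z u w : V} (hx : x ∈ second G v) (hy : y ∈ second G v)
    (hz : z ∈ second G v) (hxy : G.Adj x y) (hyz : G.Adj y z) (hxz : x ≠ z) (hvu : G.Adj v u)
    (hux : G.Adj u x) (hvw : G.Adj v w) (hwz : G.Adj w z) : u = w := by
  by_contra hne
  have hN : ∀ {s t}, s ∈ second G v → G.Adj v t → s ≠ t := fun hs ht h => hs.2.1 (h ▸ ht)
  exact h6 v u x y z w hvu hux hxy hyz hwz.symm hvw.symm hx.1.symm hy.1.symm hz.1.symm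
    (hN hy hvu).symm (hN hz hvu).symm hne hxz (hN hx hvw) (hN hy hvw)

lemma noTriangle_second (h6 : NoC6 G) (h4 : NoK4 G) : NoTriangle G (second G v) := by
  intro x hx y hy z hz hxy hxz hyz
  obtain ⟨u, hvu, hux⟩ := hx.2.2
  obtain ⟨w, hvw, hwy⟩ := hy.2.2
  obtain ⟨t, hvt, htz⟩ := hz.2.2
  obtain rfl := parent_eq h6 hx hz hy hxz hyz.symm hxy.ne hvu hux hvw hwy
  obtain rfl := parent_eq h6 hx hy hz hxy hyz hxz.ne hvu hux hvt htz
  exact h4 u x y z hux hwy htz hxy hxz hyz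

lemma noP5_second (h6 : NoC6 G) : NoP5 G (second G v) := by
  intro a ha b hb c hc d hd e he hab hbc hcd hde nac nad nae nbd nbe nce
  obtain ⟨u, hvu, hua⟩ := ha.2.2
  obtain ⟨w, hvw, hwc⟩ := hc.2.2
  obtain ⟨t, hvt, hte⟩ := he.2.2
  obtain rfl := parent_eq h6 ha hb hc hab hbc nac hvu hua hvw hwc
  obtain rfl := parent_eq h6 hc hd he hcd hde nce hvw hwc hvt hte
  have hN : ∀ {s}, s ∈ second G v → u ≠ s := fun hs h => hs.2.1 (h ▸ hvu)
  exact h6 u a b c d e hua hab hbc hcd hde hte.symm (hN hb) (hN hc) (hN hd) nac nad nae nbd nbe nce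

/-- Vertices at distance at least three from `v`. -/
def far (G : SimpleGraph V) (v : V) : Set V :=
  {x | x ≠ v ∧ ¬ G.Adj v x ∧ x ∉ second G v}

lemma sep_neighborSet_far : Sep G (G.neighborSet v) (far G v) := by
  intro x hx y hy
  refine ⟨?_, fun e => hy.2.2 ⟨hy.1, hy.2.1, x, hx, e⟩⟩
  rintro rfl
  exact hy.2.1 hx

/-- Decomposition of a graph without `K₄` and `C₆` by distance from a vertex. -/
theorem card_le_add_ncard_far [Finite V] (h6 : NoC6 G) (h4 : NoK4 G) {a : ℕ}
    (hind : ¬ HasInd G Set.univ (a + 1)) :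
    ∃ k, HasInd G (G.neighborSet v) k ∧ (G.neighborSet v).ncard ≤ 2 * k ∧
      Nat.card V + 1 ≤ 2 * a + (G.neighborSet v).ncard + (far G v).ncard := by
  obtain ⟨k, hk, hk'⟩ := (matched_of_noP5 (Set.toFinite _) (noTriangle_neighborSet (v := v) h4)
    (noP5_of_forall_adj (z := v) h6 fun y hy => hy)).hasInd (Set.toFinite _)
  obtain ⟨m, hm, hm'⟩ := (matched_of_noP5 (Set.toFinite _) (noTriangle_second (v := v) h6 h4)
    (noP5_second h6)).hasInd (Set.toFinite _)
  refine ⟨k, hk, hk', ?_⟩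
  have hma : m + 1 ≤ a := by
    by_contra hlt
    refine hind ((((HasInd.one (Set.mem_singleton v)).union hm ?_).mono (Set.subset_univ _)).le
      (by omega))
    rintro x rfl y hy
    exact ⟨hy.1.symm, hy.2.1⟩
  have hcov : (Set.univ : Set V) ⊆ {v} ∪ G.neighborSet v ∪ second G v ∪ far G v := by
    intro x _
    by_cases h1 : x = v
    · exact Or.inl (Or.inl (Or.inl h1))
    by_cases h2 : G.Adj v x
    · exact Or.inl (Or.inl (Or.inr h2))
    by_cases h3 : x ∈ second G v
    · exact Or.inl (Or.inr h3)
    · exact Or.inr ⟨h1, h2, h3⟩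
  have h := Set.ncard_le_ncard hcov (Set.toFinite _)
  rw [Set.ncard_univ] at h
  have h1 := Set.ncard_union_le ({v} ∪ G.neighborSet v ∪ second G v) (far G v)
  have h2 := Set.ncard_union_le ({v} ∪ G.neighborSet v) (second G v)
  have h3 := Set.ncard_union_le {v} (G.neighborSet v)
  rw [Set.ncard_singleton] at h3
  omega

lemma sep_second_of_matched (h6 : NoC6 G) {a a' b b' : V} (ha : G.Adj v a) (ha' : G.Adj v a')
    (hb : G.Adj v b) (hb' : G.Adj v b') (haa : G.Adj a a') (hbb : G.Adj b b') (hab : a ≠ b)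
    (hab' : a ≠ b') (hba' : a' ≠ b) (hba'' : a' ≠ b') :
    Sep G (G.neighborSet a ∩ second G v) (G.neighborSet b ∩ second G v) := by
  have hN : ∀ {s t}, s ∈ second G v → G.Adj v t → s ≠ t := fun hs ht h => hs.2.1 (h ▸ ht)
  rintro x ⟨hax, hx⟩ y ⟨hby, hy⟩
  refine ⟨?_, fun e => ?_⟩
  · rintro rfl
    exact h6 v a' a x b b' ha' haa.symm hax hby.symm hbb hb'.symm ha.ne hx.1.symm hb.ne
      (hN hx ha').symm hba' hba'' hab hab' (hN hx hb')
  · exact h6 v a' a x y b ha' haa.symm hax e hby.symm hb.symm ha.ne hx.1.symm hy.1.symm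
      (hN hx ha').symm (hN hy ha').symm hba' (hN hy ha).symm hab (hN hx hb)

end SecondNeighbourhood

section PerfectMatching

variable {v a a' b b' c c' : V} {G : SimpleGraph V}

/-- The neighbourhood of `v` consists of the six distinct vertices `a, a', b, b', c, c'`, matched
by the edges `aa'`, `bb'` and `cc'`. -/
structure PerfectLink (G : SimpleGraph V) (v a a' b b' c c' : V) : Prop where
  cover : ∀ w, G.Adj v w → w = a ∨ w = a' ∨ w = b ∨ w = b' ∨ w = c ∨ w = c'
  va : G.Adj v a
  va' : G.Adj v a'
  vb : G.Adj v b
  vb' : G.Adj v b'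
  vc : G.Adj v c
  vc' : G.Adj v c'
  aa : G.Adj a a'
  bb : G.Adj b b'
  cc : G.Adj c c'
  a_b : a ≠ b
  a_b' : a ≠ b'
  a_c : a ≠ c
  a_c' : a ≠ c'
  a'_b : a' ≠ b
  a'_b' : a' ≠ b'
  a'_c : a' ≠ c
  a'_c' : a' ≠ c'
  b_c : b ≠ c
  b_c' : b ≠ c'
  b'_c : b' ≠ c
  b'_c' : b' ≠ c'

namespace PerfectLink

lemma rotate (h : PerfectLink G v a a' b b' c c') : PerfectLink G v b b' c c' a a' where
  cover w hw := by
    have := h.cover w hw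
    tauto
  va := h.vb
  va' := h.vb'
  vb := h.vc
  vb' := h.vc'
  vc := h.va
  vc' := h.va'
  aa := h.bb
  bb := h.cc
  cc := h.aa
  a_b := h.b_c
  a_b' := h.b_c'
  a_c := h.a_b.symm
  a_c' := h.a'_b.symm
  a'_b := h.b'_c
  a'_b' := h.b'_c'
  a'_c := h.a_b'.symm
  a'_c' := h.a'_b'.symm
  b_c := h.a_c.symm
  b_c' := h.a'_c.symm
  b'_c := h.a_c'.symm
  b'_c' := h.a'_c'.symm

lemma flip (h : PerfectLink G v a a' b b' c c') : PerfectLink G v a' a b b' c c' where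
  cover w hw := by
    have := h.cover w hw
    tauto
  va := h.va'
  va' := h.va
  vb := h.vb
  vb' := h.vb'
  vc := h.vc
  vc' := h.vc'
  aa := h.aa.symm
  bb := h.bb
  cc := h.cc
  a_b := h.a'_b
  a_b' := h.a'_b'
  a_c := h.a'_c
  a_c' := h.a'_c'
  a'_b := h.a_b
  a'_b' := h.a_b'
  a'_c := h.a_c
  a'_c' := h.a_c'
  b_c := h.b_c
  b_c' := h.b_c'
  b'_c := h.b'_c
  b'_c' := h.b'_c'

end PerfectLink

lemma six_le_ncard_add_card [Finite V] (hδ : MinDeg G 6) {u : V} (hvu : G.Adj v u)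
    (P : Finset V) (hP : ∀ w, G.Adj v w → G.Adj u w → w ∈ P) :
    6 ≤ (G.neighborSet u ∩ second G v).ncard + P.card + 1 := by
  classical
  by_contra hlt
  have hfin : (G.neighborSet u ∩ second G v).Finite := Set.toFinite _
  rw [Set.ncard_eq_toFinset_card _ hfin] at hlt
  obtain ⟨w, hw, huw⟩ := hδ u (hfin.toFinset ∪ P ∪ {v}) (by
    have h1 := Finset.card_union_le (hfin.toFinset ∪ P) {v}
    have h2 := Finset.card_union_le hfin.toFinset P
    rw [Finset.card_singleton] at h1
    omega)
  simp only [Finset.mem_union, Set.Finite.mem_toFinset, Finset.mem_singleton, not_or] at hw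
  obtain ⟨⟨h1, h2⟩, h3⟩ := hw
  exact h1 ⟨huw, h3, fun h => h2 (hP w h huw), u, hvu, huw⟩

namespace PerfectLink

lemma exists_adj_eq (h : PerfectLink G v a a' b b' c c') (h6 : NoC6 G) (h4 : NoK4 G) :
    ∃ p, ∀ w, G.Adj v w → G.Adj a w → w = a' ∨ w = p := by
  have hT : ∀ x y, G.Adj v x → G.Adj v y → G.Adj x y → G.Adj a x → G.Adj a y → False :=
    fun x y hx hy hxy hax hay => h4 v a x y h.va hx hy hax hay hxy
  have hP : ∀ x x' y y', G.Adj v x → G.Adj v x' → G.Adj v y → G.Adj v y' → G.Adj x x' →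
      G.Adj y y' → x ≠ y → x ≠ y' → x' ≠ y → x' ≠ y' → a ≠ x' → a ≠ y' → G.Adj a x → G.Adj a y →
      False := fun x x' y y' hx hx' hy hy' hxx hyy n1 n2 n3 n4 n5 n6 hax hay =>
    h6 v x' x a y y' hx' hxx.symm hax.symm hay hyy hy'.symm hx.ne h.va.ne hy.ne n5.symm n3 n4 n1
      n2 n6
  have bb := hT b b' h.vb h.vb' h.bb
  have cc := hT c c' h.vc h.vc' h.cc
  have bc := hP b b' c c' h.vb h.vb' h.vc h.vc' h.bb h.cc h.b_c h.b_c' h.b'_c h.b'_c' h.a_b' h.a_c'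
  have bc' := hP b b' c' c h.vb h.vb' h.vc' h.vc h.bb h.cc.symm h.b_c' h.b_c h.b'_c' h.b'_c
    h.a_b' h.a_c
  have b'c := hP b' b c c' h.vb' h.vb h.vc h.vc' h.bb.symm h.cc h.b'_c h.b'_c' h.b_c h.b_c'
    h.a_b h.a_c'
  have b'c' := hP b' b c' c h.vb' h.vb h.vc' h.vc h.bb.symm h.cc.symm h.b'_c' h.b'_c h.b_c' h.b_c
    h.a_b h.a_c
  have pick : ∀ p, (G.Adj a b → b = p) → (G.Adj a b' → b' = p) → (G.Adj a c → c = p) →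
      (G.Adj a c' → c' = p) → ∀ w, G.Adj v w → G.Adj a w → w = a' ∨ w = p := by
    intro p p1 p2 p3 p4 w hw haw
    rcases h.cover w hw with rfl | rfl | rfl | rfl | rfl | rfl
    exacts [(haw.ne rfl).elim, Or.inl rfl, Or.inr (p1 haw), Or.inr (p2 haw), Or.inr (p3 haw),
      Or.inr (p4 haw)]
  by_cases hb : G.Adj a b
  · exact ⟨b, pick b (fun _ => rfl) (fun e => (bb hb e).elim) (fun e => (bc hb e).elim)
      fun e => (bc' hb e).elim⟩
  by_cases hb' : G.Adj a b'
  · exact ⟨b', pick b' (fun e => (hb e).elim) (fun _ => rfl) (fun e => (b'c hb' e).elim)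
      fun e => (b'c' hb' e).elim⟩
  by_cases hc : G.Adj a c
  · exact ⟨c, pick c (fun e => (hb e).elim) (fun e => (hb' e).elim) (fun _ => rfl)
      fun e => (cc hc e).elim⟩
  · exact ⟨c', pick c' (fun e => (hb e).elim) (fun e => (hb' e).elim) (fun e => (hc e).elim)
      fun _ => rfl⟩

lemma disjoint_of_adj (h : PerfectLink G v a a' b b' c c') (h6 : NoC6 G) {p : V}
    (hp : G.Adj v p) (hap : G.Adj a p) (hpa : p ≠ a') :
    Disjoint (G.neighborSet a ∩ second G v) (G.neighborSet a' ∩ second G v) := by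
  have key : ∀ q, G.Adj v q → G.Adj p q → q ≠ a → q ≠ a' →
      Disjoint (G.neighborSet a ∩ second G v) (G.neighborSet a' ∩ second G v) := by
    intro q hq hpq hqa hqa'
    rw [Set.disjoint_left]
    rintro x ⟨hax, hx⟩ ⟨hax', -⟩
    have hN : ∀ {t}, G.Adj v t → x ≠ t := fun ht h => hx.2.1 (h ▸ ht)
    exact h6 a' x a p q v hax' hax.symm hap hpq hq.symm h.va' h.aa.ne' hpa.symm hqa'.symm
      (hN hp) (hN hq) hx.1 hqa.symm h.va.ne' hp.ne'
  rcases h.cover p hp with rfl | rfl | rfl | rfl | rfl | rfl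
  · exact (hap.ne rfl).elim
  · exact (hpa rfl).elim
  · exact key b' h.vb' h.bb h.a_b'.symm h.a'_b'.symm
  · exact key b h.vb h.bb.symm h.a_b.symm h.a'_b.symm
  · exact key c' h.vc' h.cc h.a_c'.symm h.a'_c'.symm
  · exact key c h.vc h.cc.symm h.a_c.symm h.a'_c.symm

lemma hasInd_pair [Finite V] (h : PerfectLink G v a a' b b' c c') (h6 : NoC6 G) (h4 : NoK4 G)
    (hδ : MinDeg G 6) :
    HasInd G (G.neighborSet a ∩ second G v ∪ G.neighborSet a' ∩ second G v) 3 := by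
  classical
  set A := G.neighborSet a ∩ second G v with hA
  set A' := G.neighborSet a' ∩ second G v with hA'
  have hsub : A ∪ A' ⊆ second G v := Set.union_subset Set.inter_subset_right
    Set.inter_subset_right
  have hM : Matched G (A ∪ A') := matched_of_noP5 (Set.toFinite _)
    ((noTriangle_second h6 h4).mono hsub) ((noP5_second h6).mono hsub)
  have hbig : 5 ≤ (A ∪ A').ncard → HasInd G (A ∪ A') 3 := by
    intro hcard
    obtain ⟨k, hk, hk'⟩ := hM.hasInd (Set.toFinite _)
    exact hk.le (by omega)
  have h3 : ∀ {a a' b b' c c'}, PerfectLink G v a a' b b' c c' →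
      3 ≤ (G.neighborSet a ∩ second G v).ncard := by
    intro a a' b b' c c' h
    obtain ⟨p, hp⟩ := h.exists_adj_eq h6 h4
    have := six_le_ncard_add_card hδ h.va {a', p} (by simpa using hp)
    have := Finset.card_le_two (a := a') (b := p)
    omega
  have h4' : ∀ {a a' b b' c c'}, PerfectLink G v a a' b b' c c' →
      (∀ w, G.Adj v w → G.Adj a w → w = a') → 4 ≤ (G.neighborSet a ∩ second G v).ncard := by
    intro a a' b b' c c' h hp
    have := six_le_ncard_add_card hδ h.va {a'} (by simpa using hp)
    rw [Finset.card_singleton] at this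
    omega
  have hdisj : Disjoint A A' → HasInd G (A ∪ A') 3 := by
    intro hd
    refine hbig ?_
    rw [Set.ncard_union_eq hd]
    have h1 : 3 ≤ A.ncard := h3 h
    have h2 : 3 ≤ A'.ncard := h3 h.flip
    omega
  by_cases hc : ∀ w, G.Adj v w → G.Adj a w → w = a'
  swap
  · push Not at hc
    obtain ⟨p, hp, hap, hpa⟩ := hc
    exact hdisj (h.disjoint_of_adj h6 hp hap hpa)
  by_cases hc' : ∀ w, G.Adj v w → G.Adj a' w → w = a
  swap
  · push Not at hc'
    obtain ⟨p, hp, hap, hpa⟩ := hc'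
    exact hdisj (h.flip.disjoint_of_adj h6 hp hap hpa).symm
  by_cases hcard : 5 ≤ (A ∪ A').ncard
  · exact hbig hcard
  have hA4 : 4 ≤ A.ncard := h4' h hc
  have hA4' : 4 ≤ A'.ncard := h4' h.flip hc'
  have eA : A = A ∪ A' := Set.eq_of_subset_of_ncard_le Set.subset_union_left (by omega)
  have eA' : A' = A ∪ A' := Set.eq_of_subset_of_ncard_le Set.subset_union_right (by omega)
  obtain ⟨I, hI, hIi, f, hf, hfI⟩ := hM
  by_cases hI3 : 3 ≤ I.ncard
  · exact ⟨(Set.toFinite I).toFinset, by simpa using hI, by simpa using hIi,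
      hI3.trans (Set.ncard_eq_toFinset_card I _).le⟩
  exfalso
  have hdiff := Set.ncard_sdiff_add_ncard_of_subset hI
  have hone : 1 < ((A ∪ A') \ I).ncard := by
    have := Set.ncard_le_ncard (s := A) (t := A ∪ A') Set.subset_union_left
    omega
  obtain ⟨x, hx, y, hy, hxy⟩ := (Set.one_lt_ncard (Set.toFinite _)).1 hone
  have hfx := hfI x hx
  have hfy := hfI y hy
  have memA : ∀ {z}, z ∈ A ∪ A' → G.Adj a z := fun hz => (eA ▸ hz : _ ∈ A).1
  have memA' : ∀ {z}, z ∈ A ∪ A' → G.Adj a' z := fun hz => (eA' ▸ hz : _ ∈ A').1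
  have hN : ∀ {z t}, z ∈ A ∪ A' → G.Adj v t → t ≠ z := fun hz ht h => (hsub hz).2.1 (h ▸ ht)
  refine h6 a x (f x) a' y (f y) (memA hx.1) hfx.2 (memA' (hI hfx.1)).symm (memA' hy.1) hfy.2
    (memA (hI hfy.1)).symm (hN (hI hfx.1) h.va) h.aa.ne (hN hy.1 h.va) (hN hx.1 h.va').symm hxy
    ?_ ?_ (fun e => hxy (hf hx hy e)) (hN (hI hfy.1) h.va')
  · intro e
    exact hx.2 (e ▸ hfy.1)
  · intro e
    exact hy.2 (e ▸ hfx.1)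

theorem hasInd [Finite V] (h : PerfectLink G v a a' b b' c c') (h6 : NoC6 G) (h4 : NoK4 G)
    (hδ : MinDeg G 6) : HasInd G Set.univ 9 := by
  have hs : ∀ {a a' b b' c c'}, PerfectLink G v a a' b b' c c' →
      Sep G (G.neighborSet a ∩ second G v ∪ G.neighborSet a' ∩ second G v)
        (G.neighborSet b ∩ second G v ∪ G.neighborSet b' ∩ second G v) := by
    intro a a' b b' c c' h
    refine ((Sep.union_left ?_ ?_).symm.union_left (Sep.union_left ?_ ?_).symm).symm
    · exact sep_second_of_matched h6 h.va h.va' h.vb h.vb' h.aa h.bb h.a_b h.a_b' h.a'_b h.a'_b'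
    · exact sep_second_of_matched h6 h.va' h.va h.vb h.vb' h.aa.symm h.bb h.a'_b h.a'_b' h.a_b
        h.a_b'
    · exact sep_second_of_matched h6 h.va h.va' h.vb' h.vb h.aa h.bb.symm h.a_b' h.a_b h.a'_b'
        h.a'_b
    · exact sep_second_of_matched h6 h.va' h.va h.vb' h.vb h.aa.symm h.bb.symm h.a'_b' h.a'_b
        h.a_b' h.a_b
  have S1 := (h.hasInd_pair h6 h4 hδ).union (h.rotate.hasInd_pair h6 h4 hδ) (hs h)
  have S2 := S1.union (h.rotate.rotate.hasInd_pair h6 h4 hδ)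
    ((hs h.rotate.rotate).symm.union_left (hs h.rotate))
  exact S2.mono (Set.subset_univ _)

end PerfectLink

theorem hasInd_nine_of_degree_six [Finite V] (h6 : NoC6 G) (h4 : NoK4 G) (hδ : MinDeg G 6)
    (hdeg : (G.neighborSet v).ncard = 6) (hind : ¬ HasInd G (G.neighborSet v) 4) :
    HasInd G Set.univ 9 := by
  classical
  obtain ⟨I, hI, hIi, f, hf, hfI⟩ : Matched G (G.neighborSet v) :=
    matched_of_noP5 (Set.toFinite _) (noTriangle_neighborSet h4)
      (noP5_of_forall_adj (z := v) h6 fun y hy => hy)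
  have hI3 : I.ncard ≤ 3 := by
    by_contra hlt
    exact hind ⟨(Set.toFinite I).toFinset, by simpa using hI, by simpa using hIi,
      (by omega : 4 ≤ I.ncard).trans (Set.ncard_eq_toFinset_card I _).le⟩
  have hdiff := Set.ncard_sdiff_add_ncard_of_subset hI
  have hle : (G.neighborSet v \ I).ncard ≤ I.ncard :=
    Set.ncard_le_ncard_of_injOn f (fun x hx => (hfI x hx).1) hf
  have himg : f '' (G.neighborSet v \ I) = I := by
    refine Set.eq_of_subset_of_ncard_le ?_ ?_
    · rintro _ ⟨x, hx, rfl⟩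
      exact (hfI x hx).1
    · rw [hf.ncard_image]
      omega
  obtain ⟨a, b, c, hab, hac, hbc, habc⟩ := Set.ncard_eq_three.1
    (show (G.neighborSet v \ I).ncard = 3 by omega)
  have ma : a ∈ G.neighborSet v \ I := by simp [habc]
  have mb : b ∈ G.neighborSet v \ I := by simp [habc]
  have mc : c ∈ G.neighborSet v \ I := by simp [habc]
  have hne : ∀ {x y}, x ∈ G.neighborSet v \ I → y ∈ G.neighborSet v \ I → x ≠ f y :=
    fun hx hy h => hx.2 (h ▸ (hfI _ hy).1)
  have hlink : PerfectLink G v a (f a) b (f b) c (f c) :=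
    { cover := by
        intro w hw
        by_cases hwI : w ∈ I
        · rw [← himg, habc] at hwI
          obtain ⟨x, rfl | rfl | rfl, rfl⟩ := hwI <;> simp
        · have : w ∈ ({a, b, c} : Set V) := habc ▸ ⟨hw, hwI⟩
          rcases this with rfl | rfl | rfl <;> simp
      va := ma.1
      va' := hI (hfI a ma).1
      vb := mb.1
      vb' := hI (hfI b mb).1
      vc := mc.1
      vc' := hI (hfI c mc).1
      aa := (hfI a ma).2
      bb := (hfI b mb).2
      cc := (hfI c mc).2
      a_b := hab
      a_b' := hne ma mb
      a_c := hac
      a_c' := hne ma mc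
      a'_b := (hne mb ma).symm
      a'_b' := fun e => hab (hf ma mb e)
      a'_c := (hne mc ma).symm
      a'_c' := fun e => hac (hf ma mc e)
      b_c := hbc
      b_c' := hne mb mc
      b'_c := (hne mc mb).symm
      b'_c' := fun e => hbc (hf mb mc e) }
  exact hlink.hasInd h6 h4 hδ

end PerfectMatching

section Bounds

/-- Every finite graph satisfying `P` without `a + 1` pairwise non-adjacent vertices has at most
`N` vertices. -/
def Bound (P : ∀ {V : Type}, SimpleGraph V → Prop) (a N : ℕ) : Prop :=
  ∀ (V : Type) [Finite V] (G : SimpleGraph V), P G → ¬ HasInd G Set.univ (a + 1) →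
    Nat.card V ≤ N

/-- `P` passes to induced subgraphs. -/
def Hereditary (P : ∀ {V : Type}, SimpleGraph V → Prop) : Prop :=
  ∀ {V : Type} {G : SimpleGraph V} (U : Set V), P G → P (G.induce U)

variable {P : ∀ {V : Type}, SimpleGraph V → Prop} {G : SimpleGraph V} {a d N : ℕ}

lemma HasInd.of_induce {U : Set V} {k : ℕ} (h : HasInd (G.induce U) Set.univ k) :
    HasInd G U k := by
  obtain ⟨s, -, h2, h3⟩ := h
  refine ⟨s.map (Function.Embedding.subtype _), by simp, ?_, by simpa using h3⟩
  intro x hx y hy hxy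
  simp only [Finset.coe_map, Function.Embedding.subtype_apply, Set.mem_image] at hx hy
  obtain ⟨x, hx, rfl⟩ := hx
  obtain ⟨y, hy, rfl⟩ := hy
  exact h2 hx hy fun e => hxy (congrArg _ e)

lemma NoC6.induce (h6 : NoC6 G) (U : Set V) : NoC6 (G.induce U) := by
  intro a b c d e f h1 h2 h3 h4 h5 h6' n1 n2 n3 n4 n5 n6 n7 n8 n9
  exact h6 a b c d e f h1 h2 h3 h4 h5 h6' (Subtype.coe_ne_coe.2 n1) (Subtype.coe_ne_coe.2 n2)
    (Subtype.coe_ne_coe.2 n3) (Subtype.coe_ne_coe.2 n4) (Subtype.coe_ne_coe.2 n5)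
    (Subtype.coe_ne_coe.2 n6) (Subtype.coe_ne_coe.2 n7) (Subtype.coe_ne_coe.2 n8)
    (Subtype.coe_ne_coe.2 n9)

lemma hereditary_noC6 : Hereditary NoC6 := fun U h => h.induce U

lemma hereditary_noC6_noK4 : Hereditary fun G => NoC6 G ∧ NoK4 G := fun U h =>
  ⟨h.1.induce U, fun a b c d => h.2 a b c d⟩

lemma hereditary_noC6_noK5 : Hereditary fun G => NoC6 G ∧ NoK5 G := fun U h =>
  ⟨h.1.induce U, fun a b c d e => h.2 a b c d e⟩

lemma bound_zero : Bound P 0 N := by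
  intro V _ G _ hind
  have : IsEmpty V := ⟨fun v => hind (HasInd.one (Set.mem_univ v))⟩
  simp

lemma Bound.ncard_le [Finite V] (hB : Bound P a N) (hP : Hereditary P) (hG : P G) {U : Set V}
    (hind : ¬ HasInd G U (a + 1)) : U.ncard ≤ N :=
  hB U (G.induce U) (hP U hG) fun h => hind h.of_induce

lemma Bound.minDeg [Finite V] (hB : Bound P a N) (hP : Hereditary P) (hG : P G)
    (hind : ¬ HasInd G Set.univ (a + 2)) (hcard : N + d < Nat.card V) : MinDeg G d := by
  classical
  intro v s hs
  by_contra! hcon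
  have hle : ((↑(insert v s) : Set V)ᶜ).ncard ≤ N := by
    refine hB.ncard_le hP hG fun h => hind ?_
    refine (((HasInd.one (Set.mem_singleton v)).union h ?_).mono (Set.subset_univ _)).le (by omega)
    rintro x rfl y hy
    simp only [Finset.coe_insert, Set.mem_compl_iff, Set.mem_insert_iff, Finset.mem_coe,
      not_or] at hy
    exact ⟨fun e => hy.1 e.symm, hcon y hy.2⟩
  have hsum := Set.ncard_add_ncard_compl (↑(insert v s) : Set V)
  rw [Set.ncard_coe_finset] at hsum
  have := Finset.card_insert_le v s
  omega

lemma MinDeg.le_ncard_neighborSet [Finite V] (hδ : MinDeg G d) (v : V) :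
    d ≤ (G.neighborSet v).ncard := by
  by_contra! hlt
  have hfin := Set.toFinite (G.neighborSet v)
  rw [Set.ncard_eq_toFinset_card _ hfin] at hlt
  obtain ⟨u, hu, huv⟩ := hδ v _ hlt
  exact hu (by simpa using huv)

lemma exists_clique_of_not_hasInd_two [Finite V] (hind : ¬ HasInd G Set.univ 2) {n : ℕ}
    (hn : n ≤ Nat.card V) : ∃ q : Fin n → V, ∀ i j, i ≠ j → G.Adj (q i) (q j) := by
  have := Fintype.ofFinite V
  obtain ⟨q⟩ : Nonempty (Fin n ↪ V) :=
    Function.Embedding.nonempty_of_card_le (by rwa [Fintype.card_fin, ← Nat.card_eq_fintype_card])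
  refine ⟨q, fun i j hij => ?_⟩
  by_contra hadj
  exact hind (HasInd.two (Set.mem_univ _) (Set.mem_univ _) (q.injective.ne hij) hadj)

/-- The largest number of vertices allowed for a graph without six-cycles and `K₄` whose
independent sets have at most `a ≤ 8` vertices. -/
def noK4Bound : ℕ → ℕ
  | 0 => 0
  | 1 => 3
  | 2 => 7
  | 3 => 12
  | 4 => 17
  | 5 => 22
  | 6 => 28
  | 7 => 34
  | _ => 40

/-- The largest number of vertices allowed for a graph without six-cycles and `K₅` whose
independent sets have at most `a ≤ 8` vertices. -/
def noK5Bound : ℕ → ℕ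
  | 0 => 0
  | 1 => 4
  | 2 => 8
  | 3 => 13
  | 4 => 18
  | 5 => 23
  | 6 => 28
  | 7 => 34
  | _ => 40

lemma exists_card_le_of_minDeg [Finite V] (h6 : NoC6 G) (h4 : NoK4 G) {k₀ : ℕ}
    (hind : ¬ HasInd G Set.univ (a + 1)) (hδ : MinDeg G (2 * k₀ - 1)) (v : V) :
    ∃ k, k₀ ≤ k ∧ k ≤ a ∧ ¬ HasInd G (far G v) (a - k + 1) ∧
      Nat.card V + 1 ≤ 2 * a + 2 * k + (far G v).ncard := by
  obtain ⟨k, hk, hdeg, hcard⟩ := card_le_add_ncard_far (v := v) h6 h4 hind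
  have hd := hδ.le_ncard_neighborSet v
  have hka : k ≤ a := by
    by_contra! hlt
    exact hind ((hk.mono (Set.subset_univ _)).le hlt)
  refine ⟨k, by omega, hka, fun h => hind ?_, by omega⟩
  exact ((hk.union h sep_neighborSet_far).mono (Set.subset_univ _)).le (by omega)

lemma exists_card_le_of_minDeg_six [Finite V] (h6 : NoC6 G) (h4 : NoK4 G)
    (hind : ¬ HasInd G Set.univ (a + 1)) (ha : a ≤ 8) (hδ : MinDeg G 6) (v : V) :
    ∃ k, 4 ≤ k ∧ k ≤ a ∧ ¬ HasInd G (far G v) (a - k + 1) ∧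
      Nat.card V + 1 ≤ 2 * a + 2 * k + (far G v).ncard := by
  obtain ⟨k, hk, hdeg, hcard⟩ := card_le_add_ncard_far (v := v) h6 h4 hind
  have hd := hδ.le_ncard_neighborSet v
  obtain ⟨m, hm, hm4, hdeg'⟩ : ∃ m, HasInd G (G.neighborSet v) m ∧ 4 ≤ m ∧
      (G.neighborSet v).ncard ≤ 2 * m := by
    by_cases h : HasInd G (G.neighborSet v) 4
    · rcases le_total 4 k with hk4 | hk4
      · exact ⟨k, hk, hk4, hdeg⟩
      · exact ⟨4, h, le_rfl, by omega⟩
    · have hk3 : k < 4 := by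
        by_contra! hlt
        exact h (hk.le hlt)
      exact absurd ((hasInd_nine_of_degree_six h6 h4 hδ (by omega) h).le (by omega)) hind
  have hma : m ≤ a := by
    by_contra! hlt
    exact hind ((hm.mono (Set.subset_univ _)).le hlt)
  refine ⟨m, hm4, hma, fun h => hind ?_, by omega⟩
  exact ((hm.union h sep_neighborSet_far).mono (Set.subset_univ _)).le (by omega)

theorem bound_noK4 (ha : a ≤ 8) : Bound (fun G => NoC6 G ∧ NoK4 G) a (noK4Bound a) := by
  induction a using Nat.strong_induction_on with
  | _ a ih =>
    rcases a with _ | _ | a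
    · exact bound_zero
    · intro V _ G hG hind
      by_contra! hcard
      obtain ⟨q, hq⟩ := exists_clique_of_not_hasInd_two hind (n := 4) hcard
      exact hG.2 (q 0) (q 1) (q 2) (q 3) (hq _ _ (by decide)) (hq _ _ (by decide))
        (hq _ _ (by decide)) (hq _ _ (by decide)) (hq _ _ (by decide)) (hq _ _ (by decide))
    · intro V _ G hG hind
      by_contra! hcard
      change noK4Bound (a + 2) < Nat.card V at hcard
      obtain ⟨v⟩ : Nonempty V := (Nat.card_pos_iff.1 (by omega)).1
      have hδ : MinDeg G (noK4Bound (a + 2) - noK4Bound (a + 1)) := by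
        refine (ih (a + 1) (by omega) (by omega)).minDeg hereditary_noC6_noK4 hG hind ?_
        have : noK4Bound (a + 1) ≤ noK4Bound (a + 2) := by
          have : a ≤ 6 := by omega
          interval_cases a <;> decide
        omega
      obtain ⟨k, hk, hka, hfar, hle⟩ : ∃ k, (if a < 1 then 2 else if a < 4 then 3 else 4) ≤ k ∧
          k ≤ a + 2 ∧ ¬ HasInd G (far G v) (a + 2 - k + 1) ∧
          Nat.card V + 1 ≤ 2 * (a + 2) + 2 * k + (far G v).ncard := by
        have ha6 : a ≤ 6 := by omega
        rcases lt_or_ge a 4 with ha4 | ha4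
        · refine exists_card_le_of_minDeg hG.1 hG.2 hind (hδ.le ?_) v
          interval_cases a <;> decide
        · rw [if_neg (by omega), if_neg (by omega)]
          refine exists_card_le_of_minDeg_six hG.1 hG.2 hind ha (hδ.le ?_) v
          interval_cases a <;> decide
      have hk0 : k ≠ 0 := by
        rintro rfl
        split_ifs at hk <;> omega
      have hfar' := (ih (a + 2 - k) (by omega) (by omega)).ncard_le hereditary_noC6_noK4 hG hfar
      have ha6 : a ≤ 6 := by omega
      have key : ∀ a ≤ 6, ∀ k ≤ a + 2, (if a < 1 then 2 else if a < 4 then 3 else 4) ≤ k →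
          2 * (a + 2) + 2 * k + noK4Bound (a + 2 - k) ≤ noK4Bound (a + 2) + 1 := by decide
      have := key a ha6 k hka hk
      omega

theorem bound_noK5 (ha : a ≤ 8) : Bound (fun G => NoC6 G ∧ NoK5 G) a (noK5Bound a) := by
  induction a with
  | zero => exact bound_zero
  | succ a ih =>
    intro V _ G hG hind
    by_contra! hcard
    have ha7 : a ≤ 7 := by omega
    by_cases h4 : NoK4 G
    · have := bound_noK4 ha V G ⟨hG.1, h4⟩ hind
      have : noK4Bound (a + 1) ≤ noK5Bound (a + 1) := by interval_cases a <;> decide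
      omega
    · simp only [NoK4, not_forall] at h4
      obtain ⟨x, y, z, w, xy, xz, xw, yz, yw, zw, -⟩ := h4
      have hK : IsK4 G x y z w := ⟨xy, xz, xw, yz, yw, zw⟩
      rcases a with _ | _ | a
      · obtain ⟨q, hq⟩ := exists_clique_of_not_hasInd_two hind (n := 5) hcard
        exact hG.2 (q 0) (q 1) (q 2) (q 3) (q 4) (hq _ _ (by decide)) (hq _ _ (by decide))
          (hq _ _ (by decide)) (hq _ _ (by decide)) (hq _ _ (by decide)) (hq _ _ (by decide))
          (hq _ _ (by decide)) (hq _ _ (by decide)) (hq _ _ (by decide)) (hq _ _ (by decide))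
      · refine false_of_K4_of_not_hasInd_three hG.1 hG.2 hind (fun s hs => ?_) hK
        have := Fintype.ofFinite V
        rw [Nat.card_eq_fintype_card] at hcard
        by_contra! hall
        have := Finset.card_le_card (fun u _ => hall u : Finset.univ ⊆ s)
        rw [Finset.card_univ] at this
        have : 8 < Fintype.card V := hcard
        omega
      · have hδ : MinDeg G (noK5Bound (a + 3) - noK5Bound (a + 2)) := by
          refine (ih (by omega)).minDeg hereditary_noC6_noK5 hG hind ?_
          have : noK5Bound (a + 2) ≤ noK5Bound (a + 3) := by
            have : a ≤ 5 := by omega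
            interval_cases a <;> decide
          change noK5Bound (a + 3) < Nat.card V at hcard
          change noK5Bound (a + 2) + _ < _
          omega
        have hδ5 : MinDeg G 5 := hδ.le (by
          have : a ≤ 5 := by omega
          interval_cases a <;> decide)
        obtain ⟨h7, h9⟩ := hasInd_of_K4 hG.1 hG.2 hδ5 hK
        rcases lt_or_ge a 4 with ha4 | ha4
        · exact hind (h7.le (by omega))
        · refine hind ((h9 (hδ.le ?_)).le (by omega))
          have : a ≤ 5 := by omega
          interval_cases a <;> decide

theorem bound_noC6 (ha : a ≤ 8) : Bound NoC6 a (5 * a) := by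
  induction a with
  | zero => exact bound_zero
  | succ a ih =>
    intro V _ G h6 hind
    by_contra! hcard
    by_cases h5 : NoK5 G
    · have := bound_noK5 ha V G ⟨h6, h5⟩ hind
      have : noK5Bound (a + 1) ≤ 5 * (a + 1) := by
        have : a ≤ 7 := by omega
        interval_cases a <;> decide
      omega
    · have hδ : MinDeg G 5 := (ih (by omega)).minDeg hereditary_noC6 h6 hind (by omega)
      simp only [NoK5, not_forall] at h5
      obtain ⟨x, y, z, w, t, xy, xz, xw, xt, yz, yw, yt, zw, zt, wt, -⟩ := h5
      refine hind ((hasInd_of_K5 (q := ![x, y, z, w, t]) h6 hδ fun i j hij => ?_).le (by omega))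
      fin_cases i <;> fin_cases j <;>
        first
          | exact absurd rfl hij
          | assumption
          | (apply SimpleGraph.Adj.symm; assumption)

end Bounds

section Coloring

/-- The graph formed by the edges of color `1`. -/
def colorGraph {n : ℕ} (c : Sym2 (Fin n) → Fin 2) : SimpleGraph (Fin n) where
  Adj u v := u ≠ v ∧ c s(u, v) = 1
  symm := ⟨fun u v h => ⟨h.1.symm, by rw [Sym2.eq_swap]; exact h.2⟩⟩
  loopless := ⟨fun _ h => h.1 rfl⟩

lemma noC6_colorGraph {n : ℕ} {c : Sym2 (Fin n) → Fin 2}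
    (hc : ¬ HasMonoCopy (SimpleGraph.cycleGraph 6) c 1) : NoC6 (colorGraph c) := by
  intro x y z u v w xy yz zu uv vw wx n1 n2 n3 n4 n5 n6 n7 n8 n9
  refine hc ⟨![x, y, z, u, v, w], ?_, ?_⟩
  · have := xy.1
    have := yz.1
    have := zu.1
    have := uv.1
    have := vw.1
    have := wx.1.symm
    rw [← List.nodup_ofFn]
    simp [List.ofFn_succ, *]
  · intro i j hij
    have hadj : (colorGraph c).Adj (![x, y, z, u, v, w] i) (![x, y, z, u, v, w] j) := by
      revert hij
      rw [SimpleGraph.cycleGraph_adj]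
      fin_cases i <;> fin_cases j <;> intro hij <;>
        first
          | (exfalso; revert hij; decide)
          | assumption
          | (apply SimpleGraph.Adj.symm; assumption)
    exact hadj.2

lemma hasMonoCopy_top_of_hasInd {n k : ℕ} {c : Sym2 (Fin n) → Fin 2}
    (h : HasInd (colorGraph c) Set.univ k) : HasMonoCopy (⊤ : SimpleGraph (Fin k)) c 0 := by
  obtain ⟨s, -, hs, hk⟩ := h
  obtain ⟨f⟩ : Nonempty (Fin k ↪ s) := Function.Embedding.nonempty_of_card_le (by simpa using hk)
  refine ⟨fun i => f i, fun i j hij => f.injective (Subtype.ext hij), fun u v huv => ?_⟩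
  have hne : (f u : Fin n) ≠ f v := fun e => huv (f.injective (Subtype.ext e))
  have hc := hs (f u).2 (f v).2 hne
  have key : ∀ x : Fin 2, x ≠ 1 → x = 0 := by decide
  exact key _ fun e => hc ⟨hne, e⟩

/-- Two vertices get color `1` exactly when they lie in the same block of five consecutive
vertices. -/
def blockColoring : Sym2 (Fin 40) → Fin 2 :=
  Sym2.lift ⟨fun u v => if u.val / 5 = v.val / 5 then 1 else 0, fun u v => by simp [eq_comm]⟩

lemma blockColoring_eq_one {u v : Fin 40} :
    blockColoring s(u, v) = 1 ↔ u.val / 5 = v.val / 5 := by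
  simp [blockColoring]

lemma not_hasMonoCopy_top_blockColoring :
    ¬ HasMonoCopy (⊤ : SimpleGraph (Fin 9)) blockColoring 0 := by
  rintro ⟨f, -, hf⟩
  obtain ⟨u, v, huv, he⟩ := Fintype.exists_ne_map_eq_of_card_lt
    (fun i => (⟨(f i).val / 5, by omega⟩ : Fin 8)) (by simp)
  have h0 := hf u v huv
  rw [blockColoring_eq_one.2 (by simpa using he)] at h0
  exact absurd h0 (by decide)

lemma not_hasMonoCopy_cycleGraph_blockColoring :
    ¬ HasMonoCopy (SimpleGraph.cycleGraph 6) blockColoring 1 := by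
  rintro ⟨f, hinj, hf⟩
  have hstep : ∀ i j : Fin 6, (SimpleGraph.cycleGraph 6).Adj i j →
      (f i).val / 5 = (f j).val / 5 := fun i j hij => blockColoring_eq_one.1 (hf i j hij)
  have hblock : ∀ i, (f i).val / 5 = (f 0).val / 5 := by
    have h1 := hstep 0 1 (by decide)
    have h2 := hstep 1 2 (by decide)
    have h3 := hstep 2 3 (by decide)
    have h4 := hstep 3 4 (by decide)
    have h5 := hstep 4 5 (by decide)
    intro i
    fin_cases i <;> simp only [Fin.zero_eta, Fin.mk_one, Fin.reduceFinMk] <;> omega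
  obtain ⟨u, v, huv, he⟩ := Fintype.exists_ne_map_eq_of_card_lt
    (fun i => (⟨(f i).val % 5, by omega⟩ : Fin 5)) (by simp)
  refine huv (hinj (Fin.ext ?_))
  have hu := hblock u
  have hv := hblock v
  have he' : (f u).val % 5 = (f v).val % 5 := by simpa using he
  omega

end Coloring

end RamseyC6

/-- `R(K₉, C₆) = 41`. -/
theorem ramsey_K9_C6 :
    (∀ c : Sym2 (Fin 41) → Fin 2,
      HasMonoCopy (⊤ : SimpleGraph (Fin 9)) c 0 ∨ HasMonoCopy (SimpleGraph.cycleGraph 6) c 1) ∧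
    (∃ c : Sym2 (Fin 40) → Fin 2,
      ¬ HasMonoCopy (⊤ : SimpleGraph (Fin 9)) c 0 ∧
      ¬ HasMonoCopy (SimpleGraph.cycleGraph 6) c 1) := by
  refine ⟨fun c => ?_, RamseyC6.blockColoring, RamseyC6.not_hasMonoCopy_top_blockColoring,
    RamseyC6.not_hasMonoCopy_cycleGraph_blockColoring⟩
  by_contra! h
  have hcard := RamseyC6.bound_noC6 (a := 8) le_rfl (Fin 41) (RamseyC6.colorGraph c)
    (RamseyC6.noC6_colorGraph h.2) fun hind => h.1 (RamseyC6.hasMonoCopy_top_of_hasInd hind)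
  simp at hcard
end

section
/- R(K_4^-, K_5^-; 3) = 12. That is: (i) for every coloring of the 3-element subsets of a 12-element set with 2 colors, either there are 4 vertices at least 3 of whose four 3-element subsets have color 1 (a K_4^- in color 1), or there are 5 vertices at least 9 of whose ten 3-element subsets have color 2 (a K_5^- in color 2); and (ii) there exists such a 2-coloring of the 3-element subsets of an 11-element set admitting neither configuration. -/
/-- The 2-coloring `c` of the 3-element subsets of `Fin n` contains a copy of the 3-uniform
hypergraph `K₄⁻` in color `i`: a set of 4 vertices at least 3 of whose four 3-element subsets
have color `i`. -/
def HasK4minus {n k : ℕ} (c : Finset (Fin n) → Fin k) (i : Fin k) : Prop :=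
  ∃ S : Finset (Fin n), S.card = 4 ∧
    3 ≤ ((S.powersetCard 3).filter fun t => c t = i).card

/-- The 2-coloring `c` of the 3-element subsets of `Fin n` contains a copy of the 3-uniform
hypergraph `K₅⁻` in color `i`: a set of 5 vertices at least 9 of whose ten 3-element subsets
have color `i`. -/
def HasK5minus {n k : ℕ} (c : Finset (Fin n) → Fin k) (i : Fin k) : Prop :=
  ∃ S : Finset (Fin n), S.card = 5 ∧
    9 ≤ ((S.powersetCard 3).filter fun t => c t = i).card

/-- The `6`-element subsets of `Fin 12` that contain `T`. -/
def supersets (T : Finset (Fin 12)) : Finset (Finset (Fin 12)) :=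
  (Finset.univ.powersetCard 6).filter (T ⊆ ·)

theorem supersets_empty : supersets ∅ = Finset.univ.powersetCard 6 := by
  simp [supersets]

theorem sum_supersets_sum (T : Finset (Fin 12)) (f : Finset (Fin 12) → Fin 12 → ℤ) :
    ∑ V ∈ supersets T, ∑ a ∈ V, f V a = ∑ a, ∑ V ∈ supersets (insert a T), f V a := by
  refine Finset.sum_comm' fun V a => ?_
  simp only [supersets, Finset.mem_filter, Finset.insert_subset_iff, Finset.mem_univ, and_true]
  tauto

theorem card_supersets {T : Finset (Fin 12)} (hT : T.card ≤ 6) :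
    (supersets T).card = (12 - T.card).choose (6 - T.card) := by
  have himage : supersets T = (Tᶜ.powersetCard (6 - T.card)).image (T ∪ ·) := by
    ext V
    simp only [supersets, Finset.mem_filter, Finset.mem_powersetCard, Finset.mem_image,
      Finset.subset_univ, true_and]
    constructor
    · rintro ⟨hV, hTV⟩
      refine ⟨V \ T, ⟨?_, ?_⟩, Finset.union_sdiff_of_subset hTV⟩
      · intro v hv
        simpa using (Finset.mem_sdiff.1 hv).2
      · rw [Finset.card_sdiff_of_subset hTV, hV]
    · rintro ⟨W, ⟨hW, hcard⟩, rfl⟩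
      refine ⟨?_, Finset.subset_union_left⟩
      rw [Finset.card_union_of_disjoint (Finset.subset_compl_iff_disjoint_left.1 hW), hcard]
      omega
  rw [himage, Finset.card_image_of_injOn, Finset.card_powersetCard, Finset.card_compl,
    Fintype.card_fin]
  intro W hW W' hW' heq
  have hW := Finset.subset_compl_iff_disjoint_left.1 (Finset.mem_powersetCard.1 hW).1
  have hW' := Finset.subset_compl_iff_disjoint_left.1 (Finset.mem_powersetCard.1 hW').1
  have := congrArg (· \ T) heq
  simpa [Finset.union_sdiff_cancel_left hW, Finset.union_sdiff_cancel_left hW'] using this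

theorem sum_sq_book_nonneg (φ : Fin 12 → Fin 12 → Fin 12 → Fin 12 → Fin 12 → ℤ)
    (hφ : ∀ a b c d w, φ a b c d w ≠ 0 → [a, b, c, d, w].Nodup) :
    0 ≤ ∑ V ∈ Finset.univ.powersetCard 6, ∑ a ∈ V, ∑ b ∈ V, ∑ c ∈ V, ∑ d ∈ V,
      (7 * (∑ w ∈ V, φ a b c d w) ^ 2 - 6 * ∑ w ∈ V, φ a b c d w ^ 2) := by
  have expand : ∀ (V : Finset (Fin 12)) (a b c d : Fin 12),
      7 * (∑ w ∈ V, φ a b c d w) ^ 2 - 6 * ∑ w ∈ V, φ a b c d w ^ 2 =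
        ∑ w ∈ V, ∑ w' ∈ V,
          (7 - if w = w' then 6 else 0) * (φ a b c d w * φ a b c d w') := by
    intro V a b c d
    rw [sq, Finset.sum_mul_sum, Finset.mul_sum, Finset.mul_sum, ← Finset.sum_sub_distrib]
    refine Finset.sum_congr rfl fun w hw => ?_
    simp only [sub_mul, Finset.sum_sub_distrib, ite_mul, zero_mul, Finset.sum_ite_eq, hw, if_true,
      Finset.mul_sum, sq]
  have count : ∀ a b c d w w',
      ((supersets {w', w, d, c, b, a}).card : ℤ) *
        ((7 - if w = w' then 6 else 0) * (φ a b c d w * φ a b c d w')) =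
        7 * (φ a b c d w * φ a b c d w') := by
    intro a b c d w w'
    by_cases h₁ : φ a b c d w = 0
    · simp [h₁]
    by_cases h₂ : φ a b c d w' = 0
    · simp [h₂]
    have h₁ := hφ _ _ _ _ _ h₁
    have h₂ := hφ _ _ _ _ _ h₂
    simp only [List.nodup_cons, List.mem_cons, List.not_mem_nil, or_false, not_or] at h₁ h₂
    by_cases hw : w = w'
    · subst hw
      have : ({w, w, d, c, b, a} : Finset (Fin 12)).card = 5 := by
        rw [Finset.insert_eq_of_mem (Finset.mem_insert_self _ _)]
        grind
      rw [card_supersets (by omega), this]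
      norm_num [Nat.choose]
    · have : ({w', w, d, c, b, a} : Finset (Fin 12)).card = 6 := by
        grind
      rw [card_supersets (by omega), this]
      norm_num [hw]
  simp_rw [expand, ← supersets_empty, sum_supersets_sum, insert_empty_eq, Finset.sum_const,
    nsmul_eq_mul, count, ← Finset.mul_sum, ← Finset.sum_mul]
  simp_rw [← sq]
  positivity

theorem sum_sq_pair_nonneg (ψ : Fin 12 → Fin 12 → Fin 12 → Fin 12 → ℤ)
    (hψ : ∀ u v x y, ψ u v x y ≠ 0 → [u, v, x, y].Nodup)
    (hsymm : ∀ u v x y, ψ u v x y = ψ u v y x) :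
    0 ≤ ∑ V ∈ Finset.univ.powersetCard 6, ∑ u ∈ V, ∑ v ∈ V,
      (28 * (∑ x ∈ V, ∑ y ∈ V, ψ u v x y) ^ 2 - 96 * ∑ x ∈ V, (∑ y ∈ V, ψ u v x y) ^ 2 +
        42 * ∑ x ∈ V, ∑ y ∈ V, ψ u v x y ^ 2) := by
  let κ (x y x' y' : Fin 12) : ℤ := 28 - 24 * ((if x = x' then 1 else 0) +
    (if x = y' then 1 else 0) + (if y = x' then 1 else 0) + (if y = y' then 1 else 0)) +
    21 * ((if x = x' then if y = y' then 1 else 0 else 0) +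
      (if x = y' then if y = x' then 1 else 0 else 0))
  have expand : ∀ (V : Finset (Fin 12)) (u v : Fin 12),
      28 * (∑ x ∈ V, ∑ y ∈ V, ψ u v x y) ^ 2 - 96 * ∑ x ∈ V, (∑ y ∈ V, ψ u v x y) ^ 2 +
        42 * ∑ x ∈ V, ∑ y ∈ V, ψ u v x y ^ 2 =
      ∑ x ∈ V, ∑ y ∈ V, ∑ x' ∈ V, ∑ y' ∈ V, κ x y x' y' * (ψ u v x y * ψ u v x' y') := by
    intro V u v
    let D (x : Fin 12) : ℤ := ∑ y ∈ V, ψ u v x y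
    have inner : ∀ x ∈ V, ∀ y ∈ V,
        ∑ x' ∈ V, ∑ y' ∈ V, κ x y x' y' * (ψ u v x y * ψ u v x' y') =
        28 * (ψ u v x y * ∑ x' ∈ V, D x') - 48 * (ψ u v x y * D x) - 48 * (ψ u v x y * D y) +
          42 * ψ u v x y ^ 2 := by
      intro x hx y hy
      have hcol : ∀ z, ∑ x' ∈ V, ψ u v x' z = D z := fun z =>
        Finset.sum_congr rfl fun x' _ => hsymm u v x' z
      simp only [κ, sub_mul, add_mul, mul_add, ite_mul, zero_mul, mul_ite,
        mul_zero, mul_one, Finset.sum_add_distrib, Finset.sum_sub_distrib, Finset.sum_ite_eq,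
        Finset.sum_ite_irrel, Finset.sum_const_zero, hx, hy, if_true, ← Finset.mul_sum, hcol]
      rw [hsymm u v y x]
      simp only [D]
      ring
    rw [Finset.sum_congr rfl fun x hx => Finset.sum_congr rfl (inner x hx)]
    have hcomm : ∑ x ∈ V, ∑ y ∈ V, ψ u v x y * D y = ∑ x ∈ V, ∑ y ∈ V, ψ u v x y * D x := by
      rw [Finset.sum_comm]
      simp_rw [fun x y => hsymm u v y x]
    simp only [Finset.sum_add_distrib, Finset.sum_sub_distrib, ← Finset.mul_sum, hcomm]
    simp only [← Finset.sum_mul, D, ← sq]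
    ring
  have count : ∀ u v x y x' y',
      ((supersets {y', x', y, x, v, u}).card : ℤ) *
        (κ x y x' y' * (ψ u v x y * ψ u v x' y')) = 28 * (ψ u v x y * ψ u v x' y') := by
    intro u v x y x' y'
    by_cases h₁ : ψ u v x y = 0
    · simp [h₁]
    by_cases h₂ : ψ u v x' y' = 0
    · simp [h₂]
    have h₁ := hψ _ _ _ _ h₁
    have h₂ := hψ _ _ _ _ h₂
    simp only [List.nodup_cons, List.mem_cons, List.not_mem_nil, or_false, not_or] at h₁ h₂
    have hbase : ({y, x, v, u} : Finset (Fin 12)).card = 4 := by grind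
    have hx' : x' ∈ ({y, x, v, u} : Finset (Fin 12)) ↔ x = x' ∨ y = x' := by
      simp only [Finset.mem_insert, Finset.mem_singleton]
      grind
    have hy' : y' ∈ insert x' ({y, x, v, u} : Finset (Fin 12)) ↔ x = y' ∨ y = y' := by
      simp only [Finset.mem_insert, Finset.mem_singleton]
      grind
    have hcard : ({y', x', y, x, v, u} : Finset (Fin 12)).card =
        4 + (if x = x' ∨ y = x' then 0 else 1) + (if x = y' ∨ y = y' then 0 else 1) := by
      rw [Finset.card_insert_eq_ite, Finset.card_insert_eq_ite]
      simp only [hx', hy', hbase]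
      split_ifs <;> rfl
    rw [card_supersets (by rw [hcard]; split_ifs <;> omega), hcard, ← mul_assoc]
    congr 1
    simp only [κ]
    have hxy : x ≠ y := by grind
    have hxy' : x' ≠ y' := by grind
    by_cases e₁ : x = x' <;> by_cases e₂ : x = y' <;> by_cases e₃ : y = x' <;>
      by_cases e₄ : y = y' <;> first | (exfalso; grind) | (simp [e₁, e₂, e₃, e₄, hxy', hxy'.symm,
          Nat.choose])
  simp_rw [expand, ← supersets_empty, sum_supersets_sum, insert_empty_eq, Finset.sum_const,
    nsmul_eq_mul, count, ← Finset.mul_sum, ← Finset.sum_mul, ← sq]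
  positivity

/-- At most `m` of the four Booleans are `true`. -/
def atMost (m : ℕ) (p q r s : Bool) : Bool :=
  Nat.ble (p.toNat + q.toNat + r.toNat + s.toNat) m

/-- At least two of the ten Booleans are `true`. -/
def atLeastTwo (p₁ p₂ p₃ p₄ p₅ p₆ p₇ p₈ p₉ p₁₀ : Bool) : Bool :=
  Nat.ble 2 (p₁.toNat + p₂.toNat + p₃.toNat + p₄.toNat + p₅.toNat + p₆.toNat + p₇.toNat +
    p₈.toNat + p₉.toNat + p₁₀.toNat)

/-- `{a, b, d}` is a triple of color `0`. -/
def isEdge {n : ℕ} (c : Finset (Fin n) → Fin 2) (a b d : Fin n) : Bool :=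
  decide ([a, b, d].Nodup ∧ c {a, b, d} = 0)

theorem isEdge_swap_left {n : ℕ} (c : Finset (Fin n) → Fin 2) (a b d : Fin n) :
    isEdge c a b d = isEdge c b a d := by
  have : ({a, b, d} : Finset (Fin n)) = {b, a, d} := Finset.insert_comm a b {d}
  simp only [isEdge, this, decide_eq_decide]
  grind

theorem isEdge_swap_right {n : ℕ} (c : Finset (Fin n) → Fin 2) (a b d : Fin n) :
    isEdge c a b d = isEdge c a d b := by
  have : ({a, b, d} : Finset (Fin n)) = {a, d, b} := by rw [Finset.pair_comm]
  simp only [isEdge, this, decide_eq_decide]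
  grind

theorem sum_powersetCard_succ_insert {α : Type*} [DecidableEq α] {x : α} {s : Finset α}
    (hx : x ∉ s) (m : ℕ) (f : Finset α → ℕ) :
    ∑ t ∈ (insert x s).powersetCard (m + 1), f t =
      ∑ t ∈ s.powersetCard (m + 1), f t + ∑ t ∈ s.powersetCard m, f (insert x t) := by
  rw [Finset.powersetCard_succ_insert hx, Finset.sum_union, Finset.sum_image]
  · intro t ht t' ht' heq
    have ht : x ∉ t := fun h => hx ((Finset.mem_powersetCard.1 ht).1 h)
    have ht' : x ∉ t' := fun h => hx ((Finset.mem_powersetCard.1 ht').1 h)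
    rw [← Finset.erase_insert ht, heq, Finset.erase_insert ht']
  · rw [Finset.disjoint_left]
    rintro t ht ht'
    obtain ⟨t', -, rfl⟩ := Finset.mem_image.1 ht'
    exact hx ((Finset.mem_powersetCard.1 ht).1 (Finset.mem_insert_self _ _))

theorem sum_powersetCard_three_of_four {α : Type*} [DecidableEq α] {p q r s : α}
    (hnd : [p, q, r, s].Nodup) (f : Finset α → ℕ) :
    ∑ T ∈ ({p, q, r, s} : Finset α).powersetCard 3, f T =
      f {p, q, r} + f {p, q, s} + f {p, r, s} + f {q, r, s} := by
  simp only [List.nodup_cons, List.mem_cons, List.not_mem_nil, or_false, not_or, not_false_eq_true,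
    List.nodup_nil, and_true] at hnd
  obtain ⟨⟨h₁, h₂, h₃⟩, ⟨h₄, h₅⟩, h₆⟩ := hnd
  have h_two : ({s} : Finset α).powersetCard 2 = ∅ := rfl
  have h_three : ({s} : Finset α).powersetCard 3 = ∅ := rfl
  simp [sum_powersetCard_succ_insert, Finset.powersetCard_one, *]
  ring

theorem sum_powersetCard_three_of_five {α : Type*} [DecidableEq α] {p q r s t : α}
    (hnd : [p, q, r, s, t].Nodup) (f : Finset α → ℕ) :
    ∑ T ∈ ({p, q, r, s, t} : Finset α).powersetCard 3, f T =
      f {p, q, r} + f {p, q, s} + f {p, q, t} + f {p, r, s} + f {p, r, t} + f {p, s, t} +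
        f {q, r, s} + f {q, r, t} + f {q, s, t} + f {r, s, t} := by
  simp only [List.nodup_cons, List.mem_cons, List.not_mem_nil, or_false, not_or, not_false_eq_true,
    List.nodup_nil, and_true] at hnd
  obtain ⟨⟨h₁, h₂, h₃, h₄⟩, ⟨h₅, h₆, h₇⟩, ⟨h₈, h₉⟩, h₁₀⟩ := hnd
  have h_two : ({t} : Finset α).powersetCard 2 = ∅ := rfl
  have h_three : ({t} : Finset α).powersetCard 3 = ∅ := rfl
  simp [sum_powersetCard_succ_insert, Finset.powersetCard_one, *]
  ring

theorem atMost_two_of_not_hasK4minus {n : ℕ} {c : Finset (Fin n) → Fin 2}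
    (hc : ¬ HasK4minus c 0) {p q r s : Fin n} (hnd : [p, q, r, s].Nodup) :
    atMost 2 (isEdge c p q r) (isEdge c p q s) (isEdge c p r s) (isEdge c q r s) = true := by
  have hcard : ({p, q, r, s} : Finset (Fin n)).card = 4 := by
    simpa using List.toFinset_card_of_nodup hnd
  have hle : ¬ 3 ≤ _ := fun h => hc ⟨{p, q, r, s}, hcard, h⟩
  rw [Finset.card_filter, sum_powersetCard_three_of_four hnd] at hle
  simp only [List.nodup_cons, List.mem_cons, List.not_mem_nil, or_false, not_or, not_false_eq_true,
    List.nodup_nil, and_true] at hnd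
  obtain ⟨⟨h₁, h₂, h₃⟩, ⟨h₄, h₅⟩, h₆⟩ := hnd
  simp only [atMost, isEdge, Nat.ble_eq]
  simpa [Bool.toNat, Bool.cond_decide, h₁, h₂, h₃, h₄, h₅, h₆] using Nat.lt_succ_iff.1
      (not_le.1 hle)

theorem nine_le_card_filter_one_iff {n : ℕ} {c : Finset (Fin n) → Fin 2} {S : Finset (Fin n)}
    (hS : S.card = 5) :
    9 ≤ ((S.powersetCard 3).filter fun t => c t = 1).card ↔
      ((S.powersetCard 3).filter fun t => c t = 0).card ≤ 1 := by
  have hcompl := Finset.card_filter_add_card_filter_not (s := S.powersetCard 3) (fun t => c t = 0)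
  have hcolor : ∀ t, ¬ c t = 0 ↔ c t = 1 := fun t => by omega
  rw [Finset.card_powersetCard, hS, show Nat.choose 5 3 = 10 from rfl] at hcompl
  simp only [hcolor] at hcompl
  omega

theorem atLeastTwo_of_not_hasK5minus {n : ℕ} {c : Finset (Fin n) → Fin 2}
    (hc : ¬ HasK5minus c 1) {p q r s t : Fin n} (hnd : [p, q, r, s, t].Nodup) :
    atLeastTwo (isEdge c p q r) (isEdge c p q s) (isEdge c p q t) (isEdge c p r s)
      (isEdge c p r t) (isEdge c p s t) (isEdge c q r s) (isEdge c q r t) (isEdge c q s t)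
      (isEdge c r s t) = true := by
  have hcard : ({p, q, r, s, t} : Finset (Fin n)).card = 5 := by
    simpa using List.toFinset_card_of_nodup hnd
  have hedges : ¬ 9 ≤ _ := fun h => hc ⟨{p, q, r, s, t}, hcard, h⟩
  rw [nine_le_card_filter_one_iff hcard, Finset.card_filter, not_le, Nat.lt_iff_add_one_le]
    at hedges
  rw [sum_powersetCard_three_of_five hnd] at hedges
  simp only [List.nodup_cons, List.mem_cons, List.not_mem_nil, or_false, not_or, not_false_eq_true,
    List.nodup_nil, and_true] at hnd
  obtain ⟨⟨h₁, h₂, h₃, h₄⟩, ⟨h₅, h₆, h₇⟩, ⟨h₈, h₉⟩, h₁₀⟩ := hnd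
  simp only [atLeastTwo, isEdge, Nat.ble_eq]
  simpa [Bool.toNat, Bool.cond_decide, h₁, h₂, h₃, h₄, h₅, h₆, h₇, h₈, h₉, h₁₀] using hedges

/-- First weighting of a book `abc, abd` with a further vertex `w`; the arguments tell which pairs
of `a, b, c, d` form a triple with `w`. -/
def bookFlag₁ (ab cd ac ad bc bd : Bool) : ℤ :=
  bif ab then bif cd then 19 else -10
  else bif (ac && bd) || (ad && bc) then bif cd then 10 else 4
  else bif (ac && ad) || (bc && bd) then -1
  else bif ac || ad || bc || bd then bif cd then 3 else -8
  else bif cd then -9 else -8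

/-- Second weighting of a book `abc, abd` with a further vertex. -/
def bookFlag₂ (ab cd ac ad bc bd : Bool) : ℤ :=
  bif ab then bif cd then -17 else 20
  else bif (ac && bd) || (ad && bc) then bif cd then 2 else 7
  else bif (ac && ad) || (bc && bd) then 0
  else bif ac || ad || bc || bd then bif cd then -4 else 4
  else bif cd then -1 else -8

/-- First symmetric weighting of a pair `u, v` with two further vertices `x, y`. -/
def pairFlag₁ (uvx uvy uxy vxy : Bool) : ℤ :=
  bif uvx && uvy then -3
  else bif uvx || uvy then bif uxy || vxy then 2 else -3
  else bif uxy && vxy then 7 else bif uxy || vxy then 3 else -4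

/-- Second symmetric weighting of a pair `u, v` with two further vertices. -/
def pairFlag₂ (uvx uvy uxy vxy : Bool) : ℤ :=
  bif uvx && uvy then -27
  else bif uvx || uvy then bif uxy || vxy then -7 else -10
  else bif uxy && vxy then 20 else bif uxy || vxy then 3 else 21

/-- Weighting of a pair `u, v` with two further vertices, antisymmetric in `u, v`. -/
def pairFlag₃ (uvx uvy uxy vxy : Bool) : ℤ :=
  bif uxy then bif vxy then 0 else bif uvx || uvy then 9 else 11
  else bif vxy then bif uvx || uvy then -9 else -11 else 0

/-- The contribution of the pair `u, v`, the book `uvx, uvy` and the further vertices `z, w`. -/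
def bookLocal (F : Bool → Bool → Bool → Bool → Bool → Bool → ℤ)
    (uvx uvy uvz uvw xyz xyw uxz uxw uyz uyw vxz vxw vyz vyw : Bool) : ℤ :=
  bif uvx && uvy then
    F uvz xyz uxz uyz vxz vyz * F uvz xyz uxz uyz vxz vyz +
      F uvw xyw uxw uyw vxw vyw * F uvw xyw uxw uyw vxw vyw +
      14 * (F uvz xyz uxz uyz vxz vyz * F uvw xyw uxw uyw vxw vyw)
  else 0

/-- The contribution of all books with spine `u, v` inside the six vertices `u, v, x, y, z, w`. -/
def books (F : Bool → Bool → Bool → Bool → Bool → Bool → ℤ)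
    (uvx uvy uvz uvw uxy uxz uxw uyz uyw uzw vxy vxz vxw vyz vyw vzw xyz xyw xzw yzw : Bool) :
    ℤ :=
  bookLocal F uvx uvy uvz uvw xyz xyw uxz uxw uyz uyw vxz vxw vyz vyw +
    bookLocal F uvx uvz uvy uvw xyz xzw uxy uxw uyz uzw vxy vxw vyz vzw +
    bookLocal F uvx uvw uvy uvz xyw xzw uxy uxz uyw uzw vxy vxz vyw vzw +
    bookLocal F uvy uvz uvx uvw xyz yzw uxy uyw uxz uzw vxy vyw vxz vzw +
    bookLocal F uvy uvw uvx uvz xyw yzw uxy uyz uxw uzw vxy vyz vxw vzw +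
    bookLocal F uvz uvw uvx uvy xzw yzw uxz uyz uxw uyw vxz vyz vxw vyw

/-- The contribution of a weighting of the six pairs of a `4`-set. -/
def pairQuad (a b c d e f : ℤ) : ℤ :=
  28 * ((a + b + c + d + e + f) * (a + b + c + d + e + f)) -
    24 * ((a + b + c) * (a + b + c) + (a + d + e) * (a + d + e) + (b + d + f) * (b + d + f) +
      (c + e + f) * (c + e + f)) +
    21 * (a * a + b * b + c * c + d * d + e * e + f * f)

/-- The contribution of all pairs of vertices outside `u, v`. -/
def pairs (F : Bool → Bool → Bool → Bool → ℤ)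
    (uvx uvy uvz uvw uxy uxz uxw uyz uyw uzw vxy vxz vxw vyz vyw vzw : Bool) : ℤ :=
  pairQuad (F uvx uvy uxy vxy) (F uvx uvz uxz vxz) (F uvx uvw uxw vxw) (F uvy uvz uyz vyz)
    (F uvy uvw uyw vyw) (F uvz uvw uzw vzw)

/-- The contribution of the pair `u, v` to the six vertices `u, v, x, y, z, w`. -/
def pairTotal
    (uvx uvy uvz uvw uxy uxz uxw uyz uyw uzw vxy vxz vxw vyz vyw vzw xyz xyw xzw yzw : Bool) :
    ℤ :=
  8 * (books bookFlag₁ uvx uvy uvz uvw uxy uxz uxw uyz uyw uzw vxy vxz vxw vyz vyw vzw xyz xyw xzw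
    yzw + books bookFlag₂ uvx uvy uvz uvw uxy uxz uxw uyz uyw uzw vxy vxz vxw vyz vyw vzw xyz xyw
    xzw yzw) + (pairs pairFlag₁ uvx uvy uvz uvw uxy uxz uxw uyz uyw uzw vxy vxz vxw vyz vyw vzw +
    pairs pairFlag₂ uvx uvy uvz uvw uxy uxz uxw uyz uyw uzw vxy vxz vxw vyz vyw vzw + pairs
    pairFlag₃ uvx uvy uvz uvw uxy uxz uxw uyz uyw uzw vxy vxz vxw vyz vyw vzw)

/-- The total contribution of six vertices `a, b, c, d, s, t`. -/
def total
    (abc abd acd bcd abs acs bcs ads bds cds abt act bct adt bdt cdt ast bst cst dst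
      : Bool) : ℤ :=
  pairTotal abc abd abs abt acd acs act ads adt ast bcd bcs bct bds bdt bst cds cdt cst dst +
  pairTotal abc acd acs act abd abs abt ads adt ast bcd bcs bct cds cdt cst bds bdt bst dst +
  pairTotal abd acd ads adt abc abs abt acs act ast bcd bds bdt cds cdt dst bcs bct bst cst +
  pairTotal abs acs ads ast abc abd abt acd act adt bcs bds bst cds cst dst bcd bct bdt cdt +
  pairTotal abt act adt ast abc abd abs acd acs ads bct bdt bst cdt cst dst bcd bcs bds cds +
  pairTotal abc bcd bcs bct abd abs abt bds bdt bst acd acs act cds cdt cst ads adt ast dst +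
  pairTotal abd bcd bds bdt abc abs abt bcs bct bst acd ads adt cds cdt dst acs act ast cst +
  pairTotal abs bcs bds bst abc abd abt bcd bct bdt acs ads ast cds cst dst acd act adt cdt +
  pairTotal abt bct bdt bst abc abd abs bcd bcs bds act adt ast cdt cst dst acd acs ads cds +
  pairTotal acd bcd cds cdt abc acs act bcs bct cst abd ads adt bds bdt dst abs abt ast bst +
  pairTotal acs bcs cds cst abc acd act bcd bct cdt abs ads ast bds bst dst abd abt adt bdt +
  pairTotal act bct cdt cst abc acd acs bcd bcs cds abt adt ast bdt bst dst abd abs ads bds +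
  pairTotal ads bds cds dst abd acd adt bcd bdt cdt abs acs ast bcs bst cst abc abt act bct +
  pairTotal adt bdt cdt dst abd acd ads bcd bds cds abt act ast bct bst cst abc abs acs bcs +
  pairTotal ast bst cst dst abs acs ads bcs bds cds abt act adt bct bdt cdt abc abd acd bcd

section Counting

variable {α : Type*} [DecidableEq α]

/-- The flag `F` evaluated at the book `abc, abd` and the vertex `w`. -/
def bookVal (F : Bool → Bool → Bool → Bool → Bool → Bool → ℤ) (h : α → α → α → Bool)
    (a b c d w : α) : ℤ :=
  if [a, b, c, d, w].Nodup then
    bif h a b c && h a b d then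
      F (h a b w) (h c d w) (h a c w) (h a d w) (h b c w) (h b d w)
    else 0
  else 0

/-- The flag `F` evaluated at the pair `u, v` and the vertices `x, y`. -/
def pairVal (F : Bool → Bool → Bool → Bool → ℤ) (h : α → α → α → Bool) (u v x y : α) : ℤ :=
  if [u, v, x, y].Nodup then F (h u v x) (h u v y) (h u x y) (h v x y) else 0

/-- The book part of the double counting, for a fixed set `V` and a fixed spine `u, v`. -/
def bookSum (φ : α → α → α → α → α → ℤ) (V : Finset α) (u v : α) : ℤ :=
  ∑ c ∈ V, ∑ d ∈ V, (7 * (∑ w ∈ V, φ u v c d w) ^ 2 - 6 * ∑ w ∈ V, φ u v c d w ^ 2)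

/-- The pair part of the double counting, for a fixed set `V` and a fixed pair `u, v`. -/
def pairSum (ψ : α → α → α → α → ℤ) (V : Finset α) (u v : α) : ℤ :=
  28 * (∑ x ∈ V, ∑ y ∈ V, ψ u v x y) ^ 2 - 96 * ∑ x ∈ V, (∑ y ∈ V, ψ u v x y) ^ 2 +
    42 * ∑ x ∈ V, ∑ y ∈ V, ψ u v x y ^ 2

/-- All contributions to `V` of the pair `u, v`. -/
def localSum (h : α → α → α → Bool) (V : Finset α) (u v : α) : ℤ :=
  16 * (bookSum (bookVal bookFlag₁ h) V u v + bookSum (bookVal bookFlag₂ h) V u v) +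
    (pairSum (pairVal pairFlag₁ h) V u v + pairSum (pairVal pairFlag₂ h) V u v +
      pairSum (pairVal pairFlag₃ h) V u v)

variable {h : α → α → α → Bool}

theorem bookVal_inner_eq {F : Bool → Bool → Bool → Bool → Bool → Bool → ℤ} {V : Finset α}
    {u v x y z w : α} (hnd : [u, v, x, y, z, w].Nodup)
    (hV : ∀ f : α → ℤ, ∑ i ∈ V, f i = f u + f v + f x + f y + f z + f w) :
    7 * (∑ i ∈ V, bookVal F h u v x y i) ^ 2 - 6 * ∑ i ∈ V, bookVal F h u v x y i ^ 2 =
      bookLocal F (h u v x) (h u v y) (h u v z) (h u v w) (h x y z) (h x y w) (h u x z) (h u x w)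
        (h u y z) (h u y w) (h v x z) (h v x w) (h v y z) (h v y w) := by
  rw [hV, hV]
  simp only [List.nodup_cons, List.mem_cons, List.not_mem_nil, or_false, not_or, not_false_eq_true,
    List.nodup_nil, and_true] at hnd
  obtain ⟨⟨h₁, h₂, h₃, h₄, h₅⟩, ⟨h₆, h₇, h₈, h₉⟩, ⟨h₁₀, h₁₁, h₁₂⟩, ⟨h₁₃, h₁₄⟩, h₁₅⟩ := hnd
  cases h₁₆ : h u v x && h u v y <;>
    simp [bookVal, bookLocal, *]
  ring

theorem bookSum_eq (swap_left : ∀ a b c, h a b c = h b a c)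
    (swap_right : ∀ a b c, h a b c = h a c b) {F : Bool → Bool → Bool → Bool → Bool → Bool → ℤ}
    (hF : ∀ ab cd ac ad bc bd, F ab cd ac ad bc bd = F ab cd ad ac bd bc) {V : Finset α}
    {u v x y z w : α} (hnd : [u, v, x, y, z, w].Nodup)
    (hV : ∀ f : α → ℤ, ∑ i ∈ V, f i = f u + f v + f x + f y + f z + f w) :
    bookSum (bookVal F h) V u v = 2 *
      books F (h u v x) (h u v y) (h u v z) (h u v w) (h u x y) (h u x z) (h u x w) (h u y z)
        (h u y w) (h u z w) (h v x y) (h v x z) (h v x w) (h v y z) (h v y w) (h v z w) (h x y z)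
        (h x y w) (h x z w) (h y z w) := by
  let I (c d : α) : ℤ :=
    7 * (∑ i ∈ V, bookVal F h u v c d i) ^ 2 - 6 * ∑ i ∈ V, bookVal F h u v c d i ^ 2
  have hzero : ∀ c d, ¬ [u, v, c, d].Nodup → I c d = 0 := by
    intro c d hcd
    have : ∀ i, bookVal F h u v c d i = 0 := fun i => if_neg fun hn =>
      hcd (hn.sublist (List.sublist_append_left [u, v, c, d] [i]))
    simp [I, this]
  have hsymm : ∀ c d, I c d = I d c := by
    intro c d
    have : ∀ i, bookVal F h u v c d i = bookVal F h u v d c i := by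
      intro i
      simp only [bookVal, Bool.and_comm (h u v c), swap_left c d, hF (h u v i) _ (h u c i)]
      congr 1
      grind
    simp only [I, this]
  have hxy : I x y = bookLocal F (h u v x) (h u v y) (h u v z) (h u v w) (h x y z) (h x y w)
      (h u x z) (h u x w) (h u y z) (h u y w) (h v x z) (h v x w) (h v y z) (h v y w) :=
    bookVal_inner_eq hnd hV
  have hxz : I x z = bookLocal F (h u v x) (h u v z) (h u v y) (h u v w) (h x z y) (h x z w)
      (h u x y) (h u x w) (h u z y) (h u z w) (h v x y) (h v x w) (h v z y) (h v z w) :=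
    bookVal_inner_eq (by clear * - hnd; grind) fun f => by rw [hV]; ring
  have hxw : I x w = bookLocal F (h u v x) (h u v w) (h u v y) (h u v z) (h x w y) (h x w z)
      (h u x y) (h u x z) (h u w y) (h u w z) (h v x y) (h v x z) (h v w y) (h v w z) :=
    bookVal_inner_eq (by clear * - hnd; grind) fun f => by rw [hV]; ring
  have hyz : I y z = bookLocal F (h u v y) (h u v z) (h u v x) (h u v w) (h y z x) (h y z w)
      (h u y x) (h u y w) (h u z x) (h u z w) (h v y x) (h v y w) (h v z x) (h v z w) :=
    bookVal_inner_eq (by clear * - hnd; grind) fun f => by rw [hV]; ring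
  have hyw : I y w = bookLocal F (h u v y) (h u v w) (h u v x) (h u v z) (h y w x) (h y w z)
      (h u y x) (h u y z) (h u w x) (h u w z) (h v y x) (h v y z) (h v w x) (h v w z) :=
    bookVal_inner_eq (by clear * - hnd; grind) fun f => by rw [hV]; ring
  have hzw : I z w = bookLocal F (h u v z) (h u v w) (h u v x) (h u v y) (h z w x) (h z w y)
      (h u z x) (h u z y) (h u w x) (h u w y) (h v z x) (h v z y) (h v w x) (h v w y) :=
    bookVal_inner_eq (by clear * - hnd; grind) fun f => by rw [hV]; ring
  have hu : ∀ c, I u c = 0 ∧ I v c = 0 ∧ I c u = 0 ∧ I c v = 0 ∧ I c c = 0 := fun c =>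
    ⟨hzero _ _ (by simp), hzero _ _ (by simp), hzero _ _ (by simp), hzero _ _ (by simp),
      hzero _ _ (by simp)⟩
  change ∑ c ∈ V, ∑ d ∈ V, I c d = _
  simp only [hV, hu, hsymm y x, hsymm z x, hsymm w x, hsymm z y, hsymm w y, hsymm w z, hxy, hxz,
    hxw, hyz, hyw, hzw, books]
  simp only [swap_left, swap_right]
  ring

theorem pairVal_comm (swap_right : ∀ a b c, h a b c = h a c b)
    {F : Bool → Bool → Bool → Bool → ℤ}
    (hF : ∀ uvx uvy uxy vxy, F uvx uvy uxy vxy = F uvy uvx uxy vxy) (u v x y : α) :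
    pairVal F h u v x y = pairVal F h u v y x := by
  simp only [pairVal, swap_right _ x y, hF (h u v x)]
  congr 1
  grind

theorem pairSum_eq (swap_right : ∀ a b c, h a b c = h a c b)
    {F : Bool → Bool → Bool → Bool → ℤ}
    (hF : ∀ uvx uvy uxy vxy, F uvx uvy uxy vxy = F uvy uvx uxy vxy) {V : Finset α}
    {u v x y z w : α} (hnd : [u, v, x, y, z, w].Nodup)
    (hV : ∀ f : α → ℤ, ∑ i ∈ V, f i = f u + f v + f x + f y + f z + f w) :
    pairSum (pairVal F h) V u v = 4 *
      pairs F (h u v x) (h u v y) (h u v z) (h u v w) (h u x y) (h u x z) (h u x w) (h u y z)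
        (h u y w) (h u z w) (h v x y) (h v x z) (h v x w) (h v y z) (h v y w) (h v z w) := by
  have hzero : ∀ c d, ¬ [u, v, c, d].Nodup → pairVal F h u v c d = 0 := fun c d hcd => if_neg hcd
  have hsymm := pairVal_comm swap_right hF u v
  have hu : ∀ c, pairVal F h u v u c = 0 ∧ pairVal F h u v v c = 0 ∧ pairVal F h u v c u = 0 ∧
      pairVal F h u v c v = 0 ∧ pairVal F h u v c c = 0 := fun c =>
    ⟨hzero _ _ (by simp), hzero _ _ (by simp), hzero _ _ (by simp), hzero _ _ (by simp),
      hzero _ _ (by simp)⟩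
  have hval : ∀ c d, [u, v, c, d].Nodup →
      pairVal F h u v c d = F (h u v c) (h u v d) (h u c d) (h v c d) := fun c d hcd => if_pos hcd
  simp only [pairSum, hV, hu, hsymm y x, hsymm z x, hsymm w x, hsymm z y, hsymm w y, hsymm w z]
  rw [hval x y (by clear * - hnd; grind), hval x z (by clear * - hnd; grind), hval x w
      (by clear * - hnd; grind), hval y z (by clear * - hnd; grind),
    hval y w (by clear * - hnd; grind), hval z w (by clear * - hnd; grind)]
  simp only [pairs, pairQuad]
  ring

theorem localSum_eq (swap_left : ∀ a b c, h a b c = h b a c)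
    (swap_right : ∀ a b c, h a b c = h a c b) {V : Finset α} {u v x y z w : α} (hnd : [u, v, x,
        y, z, w].Nodup)
    (hV : ∀ f : α → ℤ, ∑ i ∈ V, f i = f u + f v + f x + f y + f z + f w) :
    localSum h V u v = 4 *
      pairTotal (h u v x) (h u v y) (h u v z) (h u v w) (h u x y) (h u x z) (h u x w) (h u y z)
        (h u y w) (h u z w) (h v x y) (h v x z) (h v x w) (h v y z) (h v y w) (h v z w) (h x y z)
        (h x y w) (h x z w) (h y z w) := by
  rw [localSum, bookSum_eq swap_left swap_right (by decide) hnd hV,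
    bookSum_eq swap_left swap_right (by decide) hnd hV, pairSum_eq swap_right (by decide) hnd hV,
    pairSum_eq swap_right (by decide) hnd hV, pairSum_eq swap_right (by decide) hnd hV, pairTotal]
  ring

theorem localSum_self (V : Finset α) (u : α) : localSum h V u u = 0 := by
  simp [localSum, bookSum, bookVal, pairSum, pairVal]

theorem localSum_comm (swap_left : ∀ a b c, h a b c = h b a c) (V : Finset α)
    (u v : α) : localSum h V u v = localSum h V v u := by
  have hbook : ∀ F : Bool → Bool → Bool → Bool → Bool → Bool → ℤ,
      (∀ ab cd ac ad bc bd, F ab cd ac ad bc bd = F ab cd bc bd ac ad) →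
      bookSum (bookVal F h) V u v = bookSum (bookVal F h) V v u := by
    intro F hF
    have : ∀ c d w, bookVal F h u v c d w = bookVal F h v u c d w := by
      intro c d w
      simp only [bookVal, swap_left u v, hF _ _ (h u c w)]
      congr 1
      grind
    simp only [bookSum, this]
  have hpair : ∀ (F : Bool → Bool → Bool → Bool → ℤ) (ε : ℤ), ε ^ 2 = 1 →
      (∀ uvx uvy uxy vxy, F uvx uvy uxy vxy = ε * F uvx uvy vxy uxy) →
      pairSum (pairVal F h) V u v = pairSum (pairVal F h) V v u := by
    intro F ε hε hF
    have : ∀ x y, pairVal F h u v x y = ε * pairVal F h v u x y := by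
      intro x y
      simp only [pairVal, swap_left u v, hF _ _ (h u x y), mul_ite, mul_zero]
      congr 1
      grind
    simp only [pairSum, this, ← Finset.mul_sum, mul_pow, hε, one_mul]
  simp only [localSum, hbook bookFlag₁ (by decide), hbook bookFlag₂ (by decide),
    hpair pairFlag₁ 1 rfl (by decide), hpair pairFlag₂ 1 rfl (by decide),
    hpair pairFlag₃ (-1) rfl (by decide)]

theorem sum_localSum_eq (swap_left : ∀ a b c, h a b c = h b a c)
    (swap_right : ∀ a b c, h a b c = h a c b) {V : Finset α} {a b c d s t : α} (hnd : [a, b, c,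
        d, s, t].Nodup)
    (hV : ∀ g : α → ℤ, ∑ i ∈ V, g i = g a + g b + g c + g d + g s + g t) :
    ∑ u ∈ V, ∑ v ∈ V, localSum h V u v = 8 *
      total (h a b c) (h a b d) (h a c d) (h b c d) (h a b s) (h a c s) (h b c s) (h a d s)
        (h b d s) (h c d s) (h a b t) (h a c t) (h b c t) (h a d t) (h b d t) (h c d t) (h a s t)
        (h b s t) (h c s t) (h d s t) := by
  have key : ∀ {u v x y z w : α}, [u, v, x, y, z, w].Nodup →
      (∀ g : α → ℤ, g a + g b + g c + g d + g s + g t = g u + g v + g x + g y + g z + g w) →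
      localSum h V u v = 4 * pairTotal (h u v x) (h u v y) (h u v z) (h u v w) (h u x y) (h u x z)
          (h u x w) (h u y z) (h u y w) (h u z w) (h v x y) (h v x z) (h v x w) (h v y z)
          (h v y w) (h v z w) (h x y z) (h x y w) (h x z w) (h y z w) :=
    fun hnd hg => localSum_eq swap_left swap_right hnd fun g => (hV g).trans (hg g)
  have comm := localSum_comm swap_left V
  simp only [hV, localSum_self, comm b a, comm c a, comm d a, comm s a, comm t a, comm c b,
      comm d b, comm s b, comm t b, comm d c, comm s c, comm t c, comm s d, comm t d, comm t s]
  rw [key (u := a) (v := b) (x := c) (y := d) (z := s) (w := t) (by clear * - hnd; grind)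
      (fun g => by ring),
    key (u := a) (v := c) (x := b) (y := d) (z := s) (w := t) (by clear * - hnd; grind)
        (fun g => by ring),
    key (u := a) (v := d) (x := b) (y := c) (z := s) (w := t) (by clear * - hnd; grind)
        (fun g => by ring),
    key (u := a) (v := s) (x := b) (y := c) (z := d) (w := t) (by clear * - hnd; grind)
        (fun g => by ring),
    key (u := a) (v := t) (x := b) (y := c) (z := d) (w := s) (by clear * - hnd; grind)
        (fun g => by ring),
    key (u := b) (v := c) (x := a) (y := d) (z := s) (w := t) (by clear * - hnd; grind)
        (fun g => by ring),
    key (u := b) (v := d) (x := a) (y := c) (z := s) (w := t) (by clear * - hnd; grind)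
        (fun g => by ring),
    key (u := b) (v := s) (x := a) (y := c) (z := d) (w := t) (by clear * - hnd; grind)
        (fun g => by ring),
    key (u := b) (v := t) (x := a) (y := c) (z := d) (w := s) (by clear * - hnd; grind)
        (fun g => by ring),
    key (u := c) (v := d) (x := a) (y := b) (z := s) (w := t) (by clear * - hnd; grind)
        (fun g => by ring),
    key (u := c) (v := s) (x := a) (y := b) (z := d) (w := t) (by clear * - hnd; grind)
        (fun g => by ring),
    key (u := c) (v := t) (x := a) (y := b) (z := d) (w := s) (by clear * - hnd; grind)
        (fun g => by ring),
    key (u := d) (v := s) (x := a) (y := b) (z := c) (w := t) (by clear * - hnd; grind)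
        (fun g => by ring),
    key (u := d) (v := t) (x := a) (y := b) (z := c) (w := s) (by clear * - hnd; grind)
        (fun g => by ring),
    key (u := s) (v := t) (x := a) (y := b) (z := c) (w := d) (by clear * - hnd; grind)
        (fun g => by ring)]
  simp only [total, swap_left, swap_right]
  ring

end Counting

/-- `p` holds for both Booleans. -/
def allBool (p : Bool → Bool) : Bool := p true && p false

/-- Implication that does not evaluate its conclusion when the premise is `false`. -/
def implies (p q : Bool) : Bool := bif p then q else true

theorem allBool_eq_true {p : Bool → Bool} : allBool p = true ↔ ∀ b, p b = true := by
  simp [allBool, Bool.forall_bool, and_comm]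

theorem implies_eq_true {p q : Bool} : implies p q = true ↔ (p = true → q = true) := by
  cases p <;> simp [implies]

/-- Every `3`-graph on `a, b, c, d, s, t` with the prescribed values at `abc` and `abd`, all of
whose `4`-sets satisfy `four` and all of whose `5`-sets have at least two edges, has a negative
total. -/
def allNegative (four : Bool → Bool → Bool → Bool → Bool) (abc abd : Bool) : Bool :=
  allBool fun acd =>
  allBool fun bcd =>
  implies (four abc abd acd bcd) <|
  allBool fun abs =>
  allBool fun acs =>
  allBool fun bcs =>
  implies (four abc abs acs bcs) <|
  allBool fun ads =>
  allBool fun bds =>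
  implies (four abd abs ads bds) <|
  allBool fun cds =>
  implies (four acd acs ads cds) <|
  implies (four bcd bcs bds cds) <|
  implies (atLeastTwo abc abd abs acd acs ads bcd bcs bds cds) <|
  allBool fun abt =>
  allBool fun act =>
  allBool fun bct =>
  implies (four abc abt act bct) <|
  allBool fun adt =>
  allBool fun bdt =>
  implies (four abd abt adt bdt) <|
  allBool fun cdt =>
  implies (four acd act adt cdt) <|
  implies (four bcd bct bdt cdt) <|
  implies (atLeastTwo abc abd abt acd act adt bcd bct bdt cdt) <|
  allBool fun ast =>
  allBool fun bst =>
  implies (four abs abt ast bst) <|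
  allBool fun cst =>
  implies (four acs act ast cst) <|
  implies (four bcs bct bst cst) <|
  implies (atLeastTwo abc abs abt acs act ast bcs bct bst cst) <|
  allBool fun dst =>
  implies (four ads adt ast dst) <|
  implies (four bds bdt bst dst) <|
  implies (four cds cdt cst dst) <|
  implies (atLeastTwo abd abs abt ads adt ast bds bdt bst dst) <|
  implies (atLeastTwo acd acs act ads adt ast cds cdt cst dst) <|
  implies (atLeastTwo bcd bcs bct bds bdt bst cds cdt cst dst) <|
  decide (total abc abd acd bcd abs acs bcs ads bds cds abt act bct adt bdt cdt ast bst cst dst <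
    0)

set_option maxRecDepth 100000 in
theorem allNegative_book : allNegative (atMost 2) true true = true := by
  decide +kernel

set_option maxRecDepth 100000 in
theorem allNegative_sparse : ∀ abc abd, allNegative (atMost 1) abc abd = true := by
  decide +kernel

theorem total_neg {α : Type*} {h : α → α → α → Bool}
    {four : Bool → Bool → Bool → Bool → Bool} {a b c d s t : α}
    (hneg : allNegative four (h a b c) (h a b d) = true) (hnd : [a, b, c, d, s, t].Nodup)
    (hfour : ∀ x ∈ [a, b, c, d, s, t], ∀ y ∈ [a, b, c, d, s, t], ∀ z ∈ [a, b, c, d, s, t],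
      ∀ w ∈ [a, b, c, d, s, t], [x, y, z, w].Nodup →
      four (h x y z) (h x y w) (h x z w) (h y z w) = true)
    (hfive : ∀ p q r x y, [p, q, r, x, y].Nodup →
      atLeastTwo (h p q r) (h p q x) (h p q y) (h p r x) (h p r y) (h p x y) (h q r x) (h q r y)
        (h q x y) (h r x y) = true) :
    total (h a b c) (h a b d) (h a c d) (h b c d) (h a b s) (h a c s) (h b c s) (h a d s)
      (h b d s) (h c d s) (h a b t) (h a c t) (h b c t) (h a d t) (h b d t) (h c d t) (h a s t)
      (h b s t) (h c s t) (h d s t) < 0 := by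
  simp only [allNegative, allBool_eq_true, implies_eq_true, decide_eq_true_eq] at hneg
  have hsub : ∀ l : List α, l.Sublist [a, b, c, d, s, t] → l.Nodup := fun l hl => hnd.sublist hl
  have hfour' : ∀ x y z w, [x, y, z, w].Sublist [a, b, c, d, s, t] →
      four (h x y z) (h x y w) (h x z w) (h y z w) = true := fun x y z w hl =>
    hfour x (hl.subset (by simp)) y (hl.subset (by simp)) z (hl.subset (by simp)) w
      (hl.subset (by simp)) (hsub _ hl)
  have hfive' : ∀ p q r x y, [p, q, r, x, y].Sublist [a, b, c, d, s, t] →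
      atLeastTwo (h p q r) (h p q x) (h p q y) (h p r x) (h p r y) (h p x y) (h q r x) (h q r y)
        (h q x y) (h r x y) = true := fun p q r x y hl => hfive p q r x y (hsub _ hl)
  apply hneg <;> first | (apply hfour'; simp) | (apply hfive'; simp)

theorem sum_localSum_neg {α : Type*} [DecidableEq α] {h : α → α → α → Bool}
    (swap_left : ∀ a b c, h a b c = h b a c) (swap_right : ∀ a b c, h a b c = h a c b)
    (hfour : ∀ x y z w, [x, y, z, w].Nodup →
      atMost 2 (h x y z) (h x y w) (h x z w) (h y z w) = true)
    (hfive : ∀ p q r x y, [p, q, r, x, y].Nodup →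
      atLeastTwo (h p q r) (h p q x) (h p q y) (h p r x) (h p r y) (h p x y) (h q r x) (h q r y)
        (h q x y) (h r x y) = true)
    {V : Finset α} (hV : V.card = 6) : ∑ u ∈ V, ∑ v ∈ V, localSum h V u v < 0 := by
  have hsum : ∀ {a b c d s t : α}, [a, b, c, d, s, t].Nodup → V = {a, b, c, d, s, t} →
      ∀ g : α → ℤ, ∑ i ∈ V, g i = g a + g b + g c + g d + g s + g t := by
    rintro a b c d s t hnd rfl g
    simp only [List.nodup_cons, List.mem_cons, List.not_mem_nil, or_false, not_or,
      not_false_eq_true, List.nodup_nil, and_true] at hnd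
    simp [Finset.sum_insert, hnd, add_assoc]
  by_cases hbook : ∃ a ∈ V, ∃ b ∈ V, ∃ c ∈ V, ∃ d ∈ V, [a, b, c, d].Nodup ∧
      h a b c = true ∧ h a b d = true
  · obtain ⟨a, ha, b, hb, c, hc, d, hd, hnd, habc, habd⟩ := hbook
    have hsub : ({a, b, c, d} : Finset α) ⊆ V := by
      simp [Finset.insert_subset_iff, ha, hb, hc, hd]
    have hcard : ({a, b, c, d} : Finset α).card = 4 := by
      simpa using List.toFinset_card_of_nodup hnd
    have hrest : (V \ {a, b, c, d}).card = 2 := by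
      rw [Finset.card_sdiff_of_subset hsub, hV, hcard]
    obtain ⟨s, t, hst, heq⟩ := Finset.card_eq_two.1 hrest
    have hs : s ∈ V \ {a, b, c, d} := by simp [heq]
    have ht : t ∈ V \ {a, b, c, d} := by simp [heq]
    have hnd' : [a, b, c, d, s, t].Nodup := by
      clear * - hnd hs ht hst
      grind
    have hVeq : V = {a, b, c, d, s, t} := by
      rw [← Finset.union_sdiff_of_subset hsub, heq]
      ext i
      simp only [Finset.mem_union, Finset.mem_insert, Finset.mem_singleton, or_assoc]
    rw [sum_localSum_eq swap_left swap_right hnd' (hsum hnd' hVeq)]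
    have := total_neg (h := h) (by rw [habc, habd]; exact allNegative_book) hnd'
      (fun x _ y _ z _ w _ => hfour x y z w) hfive
    omega
  · have hsparse : ∀ x ∈ V, ∀ y ∈ V, ∀ z ∈ V, ∀ w ∈ V, [x, y, z, w].Nodup →
        atMost 1 (h x y z) (h x y w) (h x z w) (h y z w) = true := by
      intro x hx y hy z hz w hw hnd
      have hpair : ∀ a ∈ V, ∀ b ∈ V, ∀ c ∈ V, ∀ d ∈ V, [a, b, c, d].Nodup →
          ¬ (h a b c = true ∧ h a b d = true) :=
        fun a ha b hb c hc d hd hn he => hbook ⟨a, ha, b, hb, c, hc, d, hd, hn, he⟩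
      have h₁ := hpair x hx y hy z hz w hw hnd
      have h₂ := hpair x hx z hz y hy w hw (by clear * - hnd; grind)
      have h₃ := hpair y hy z hz x hx w hw (by clear * - hnd; grind)
      have h₄ := hpair x hx w hw y hy z hz (by clear * - hnd; grind)
      have h₅ := hpair y hy w hw x hx z hz (by clear * - hnd; grind)
      have h₆ := hpair z hz w hw x hx y hy (by clear * - hnd; grind)
      rw [swap_right x z y] at h₂
      rw [swap_right y z x, swap_left y x z] at h₃
      rw [swap_right x w y, swap_right x w z] at h₄
      rw [swap_right y w x, swap_left y x w, swap_right y w z] at h₅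
      rw [swap_right z w x, swap_left z x w, swap_right z w y, swap_left z y w] at h₆
      revert h₁ h₂ h₃ h₄ h₅ h₆
      generalize h x y z = p, h x y w = q, h x z w = r, h y z w = o
      revert p q r o
      decide
    obtain ⟨a, V₁, ha, rfl, hV₁⟩ := Finset.card_eq_succ.1 hV
    obtain ⟨b, V₂, hb, rfl, hV₂⟩ := Finset.card_eq_succ.1 hV₁
    obtain ⟨c, V₃, hc, rfl, hV₃⟩ := Finset.card_eq_succ.1 hV₂
    obtain ⟨d, V₄, hd, rfl, hV₄⟩ := Finset.card_eq_succ.1 hV₃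
    obtain ⟨s, t, hst, rfl⟩ := Finset.card_eq_two.1 hV₄
    have hnd : [a, b, c, d, s, t].Nodup := by
      clear * - ha hb hc hd hst
      grind
    rw [sum_localSum_eq swap_left swap_right hnd (hsum hnd rfl)]
    have := total_neg (h := h) (allNegative_sparse _ _) hnd
      (fun x hx y hy z hz w hw => hsparse x (by simpa using hx) y (by simpa using hy) z
        (by simpa using hz) w (by simpa using hw)) hfive
    omega

theorem hasK4minus_or_hasK5minus (c : Finset (Fin 12) → Fin 2) :
    HasK4minus c 0 ∨ HasK5minus c 1 := by
  by_contra! hc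
  have hneg : ∑ V ∈ Finset.univ.powersetCard 6, ∑ u ∈ V, ∑ v ∈ V, localSum (isEdge c) V u v < 0 :=
    Finset.sum_neg (fun V hV => sum_localSum_neg (isEdge_swap_left c) (isEdge_swap_right c)
      (fun x y z w => atMost_two_of_not_hasK4minus hc.1)
      (fun p q r x y => atLeastTwo_of_not_hasK5minus hc.2) (Finset.mem_powersetCard.1 hV).2)
      (Finset.powersetCard_nonempty.2 (by simp))
  have hbook : ∀ F, 0 ≤ ∑ V ∈ Finset.univ.powersetCard 6, ∑ u ∈ V, ∑ v ∈ V,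
      bookSum (bookVal F (isEdge c)) V u v := fun F =>
    sum_sq_book_nonneg (bookVal F (isEdge c)) fun _ _ _ _ _ hne => by
      by_contra hnd
      exact hne (if_neg hnd)
  have hpair : ∀ F : Bool → Bool → Bool → Bool → ℤ,
      (∀ uvx uvy uxy vxy, F uvx uvy uxy vxy = F uvy uvx uxy vxy) →
      0 ≤ ∑ V ∈ Finset.univ.powersetCard 6, ∑ u ∈ V, ∑ v ∈ V,
        pairSum (pairVal F (isEdge c)) V u v := by
    intro F hF
    refine sum_sq_pair_nonneg (pairVal F (isEdge c)) (fun _ _ _ _ hne => ?_) fun u v x y =>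
      pairVal_comm (isEdge_swap_right c) hF u v x y
    by_contra hnd
    exact hne (if_neg hnd)
  have h₁ := hbook bookFlag₁
  have h₂ := hbook bookFlag₂
  have h₃ := hpair pairFlag₁ (by decide)
  have h₄ := hpair pairFlag₂ (by decide)
  have h₅ := hpair pairFlag₃ (by decide)
  simp only [localSum, Finset.sum_add_distrib, ← Finset.mul_sum] at hneg
  linarith

/-- Color `0` on the sets that contain their mean modulo `11`; for triples, these are the
three-term arithmetic progressions. -/
def meanColoring (T : Finset (Fin 11)) : Fin 2 :=
  if ∃ y ∈ T, ∑ i ∈ T, i = 3 * y then 0 else 1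

/-- The mean of `x, y, z` modulo `11` is one of them. -/
def containsMean (x y z : Fin 11) : Bool :=
  let m := (x.val + y.val + z.val) % 11
  Nat.beq m (3 * x.val % 11) || Nat.beq m (3 * y.val % 11) || Nat.beq m (3 * z.val % 11)

theorem meanColoring_eq {x y z : Fin 11} (hxy : x < y) (hyz : y < z) :
    meanColoring {x, y, z} = bif containsMean x y z then 0 else 1 := by
  have hsum : ∑ i ∈ ({x, y, z} : Finset (Fin 11)), i = x + y + z := by
    simp [Finset.sum_insert, hxy.ne, hyz.ne, (hxy.trans hyz).ne, add_assoc]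
  rw [meanColoring, hsum, Bool.cond_eq_ite]
  congr 1
  simp only [Finset.mem_insert, Finset.mem_singleton, exists_eq_or_imp, exists_eq_left]
  simp [containsMean, Fin.ext_iff, Fin.val_add, Fin.val_mul, or_assoc]

theorem ite_cond_eq_zero (b : Bool) :
    (if (bif b then (0 : Fin 2) else 1) = 0 then 1 else 0) = b.toNat := by
  revert b
  decide

set_option maxRecDepth 100000 in
theorem not_hasK4minus_meanColoring : ¬ HasK4minus meanColoring 0 := by
  have key : ∀ p q : Fin 11, p < q → ∀ r, q < r → ∀ s, r < s →
      atMost 2 (containsMean p q r) (containsMean p q s) (containsMean p r s)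
        (containsMean q r s) = true := by
    decide +kernel
  rintro ⟨S, hS, hcard⟩
  let e := S.orderEmbOfFin hS
  have h₀ : e 0 < e 1 := e.strictMono (by decide)
  have h₁ : e 1 < e 2 := e.strictMono (by decide)
  have h₂ : e 2 < e 3 := e.strictMono (by decide)
  have hSeq : S = {e 0, e 1, e 2, e 3} := by
    rw [← Finset.image_orderEmbOfFin_univ S hS,
      show (Finset.univ : Finset (Fin 4)) = {0, 1, 2, 3} from rfl]
    simp only [Finset.image_insert, Finset.image_singleton, e]
  have key := key _ _ h₀ _ h₁ _ h₂
  rw [hSeq, Finset.card_filter, sum_powersetCard_three_of_four (by grind),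
    meanColoring_eq h₀ h₁, meanColoring_eq h₀ (h₁.trans h₂), meanColoring_eq (h₀.trans h₁) h₂,
    meanColoring_eq h₁ h₂] at hcard
  simp only [atMost, Nat.ble_eq] at key
  simp only [ite_cond_eq_zero] at hcard
  omega

set_option maxRecDepth 100000 in
theorem not_hasK5minus_meanColoring : ¬ HasK5minus meanColoring 1 := by
  have key : ∀ p q : Fin 11, p < q → ∀ r, q < r → ∀ s, r < s → ∀ t, s < t →
      atLeastTwo (containsMean p q r) (containsMean p q s) (containsMean p q t)
        (containsMean p r s) (containsMean p r t) (containsMean p s t) (containsMean q r s)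
        (containsMean q r t) (containsMean q s t) (containsMean r s t) = true := by
    decide +kernel
  rintro ⟨S, hS, hcard⟩
  let e := S.orderEmbOfFin hS
  have h₀ : e 0 < e 1 := e.strictMono (by decide)
  have h₁ : e 1 < e 2 := e.strictMono (by decide)
  have h₂ : e 2 < e 3 := e.strictMono (by decide)
  have h₃ : e 3 < e 4 := e.strictMono (by decide)
  have hSeq : S = {e 0, e 1, e 2, e 3, e 4} := by
    rw [← Finset.image_orderEmbOfFin_univ S hS,
      show (Finset.univ : Finset (Fin 5)) = {0, 1, 2, 3, 4} from rfl]
    simp only [Finset.image_insert, Finset.image_singleton, e]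
  have key := key _ _ h₀ _ h₁ _ h₂ _ h₃
  rw [nine_le_card_filter_one_iff hS, hSeq, Finset.card_filter, sum_powersetCard_three_of_five
      (by grind),
    meanColoring_eq h₀ h₁, meanColoring_eq h₀ (h₁.trans h₂),
    meanColoring_eq h₀ (h₁.trans (h₂.trans h₃)), meanColoring_eq (h₀.trans h₁) h₂,
    meanColoring_eq (h₀.trans h₁) (h₂.trans h₃), meanColoring_eq (h₀.trans (h₁.trans h₂)) h₃,
    meanColoring_eq h₁ h₂, meanColoring_eq h₁ (h₂.trans h₃), meanColoring_eq (h₁.trans h₂) h₃,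
    meanColoring_eq h₂ h₃] at hcard
  simp only [atLeastTwo, Nat.ble_eq] at key
  simp only [ite_cond_eq_zero] at hcard
  omega

/-- `R(K₄⁻, K₅⁻; 3) = 12`. -/
theorem ramsey3_K4minus_K5minus :
    (∀ c : Finset (Fin 12) → Fin 2, HasK4minus c 0 ∨ HasK5minus c 1) ∧
    (∃ c : Finset (Fin 11) → Fin 2, ¬ HasK4minus c 0 ∧ ¬ HasK5minus c 1) := by
  exact ⟨hasK4minus_or_hasK5minus, meanColoring, not_hasK4minus_meanColoring,
    not_hasK5minus_meanColoring⟩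
end
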